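/- Let R be a commutative Noetherian local domain containing a field of characteristic p > 0, with maximal ideal 𝔪. Assume R is a surjective image of a Gorenstein local ring. Let R^+ denote the absolute integral closure of R, i.e. the integral closure of R in a fixed algebraic closure K̄ of its fraction field K. Then H^i_𝔪(R^+) = 0 for all i < dim R. -/

import Mathlib

open CategoryTheory IsLocalRing

set_option synthInstance.maxHeartbeats 1000000
set_option maxHeartbeats 2000000

universe u

/-- A commutative local ring `A` is a *Gorenstein local ring* if it is Noetherian, local,
and has finite injective dimension as a module over itself; finiteness of the injective
dimension is expressed (equivalently, by dimension shifting) by the vanishing of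
`Ext^i(N, A)` for all `A`-modules `N` and all `i` larger than some fixed bound `n`. -/
def IsGorensteinLocalRing (A : Type u) [CommRing A] : Prop :=
  IsNoetherianRing A ∧ IsLocalRing A ∧
    ∃ n : ℕ, ∀ i : ℕ, n < i → ∀ N : ModuleCat.{u} A,
      Subsingleton (((Ext A (ModuleCat.{u} A) i).obj (Opposite.op N)).obj (ModuleCat.of A A))

/-- `R` is a surjective (ring-homomorphic) image of a Gorenstein local ring. -/
def IsImageOfGorensteinLocalRing (R : Type u) [CommRing R] : Prop :=
  ∃ (A : Type u) (_ : CommRing A), IsGorensteinLocalRing A ∧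
    ∃ f : A →+* R, Function.Surjective f

universe v

section PowerIdeal

variable {B : Type*} [CommRing B] {ι : Type*}

/-- The ideal generated by the powers `x i ^ t i`, `i ∈ J`. -/
def powIdeal (x : ι → B) (t : ι → ℕ) (J : Finset ι) : Ideal B :=
  Ideal.span ((fun i => x i ^ t i) '' (J : Set ι))

theorem powIdeal_empty (x : ι → B) (t : ι → ℕ) : powIdeal x t ∅ = ⊥ := by
  simp [powIdeal]

theorem powIdeal_insert [DecidableEq ι] (x : ι → B) (t : ι → ℕ) (i : ι) (J : Finset ι) :
    powIdeal x t (insert i J) = Ideal.span {x i ^ t i} ⊔ powIdeal x t J := by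
  simp [powIdeal, Set.image_insert_eq, Ideal.span_insert]

theorem powIdeal_congr {x : ι → B} {t t' : ι → ℕ} {J : Finset ι} (h : ∀ i ∈ J, t i = t' i) :
    powIdeal x t J = powIdeal x t' J := by
  unfold powIdeal
  congr 1
  exact Set.image_congr fun i hi => by rw [h i hi]

theorem powIdeal_mono {x : ι → B} {t : ι → ℕ} {J J' : Finset ι} (h : J ⊆ J') :
    powIdeal x t J ≤ powIdeal x t J' :=
  Ideal.span_mono (Set.image_mono h)

theorem pow_mem_powIdeal (x : ι → B) (t : ι → ℕ) {J : Finset ι} {i : ι} (h : i ∈ J) :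
    x i ^ t i ∈ powIdeal x t J :=
  Ideal.subset_span ⟨i, h, rfl⟩

variable {M : Type*} [AddCommGroup M] [Module B M]

theorem mem_powIdeal_insert_smul [DecidableEq ι] {x : ι → B} {t : ι → ℕ} {i : ι} {J : Finset ι}
    {S : Submodule B M} {w : M} :
    w ∈ powIdeal x t (insert i J) • S ↔
      ∃ a ∈ S, ∃ u ∈ powIdeal x t J • S, w = x i ^ t i • a + u := by
  rw [powIdeal_insert, Submodule.sup_smul, Submodule.mem_sup]
  constructor
  · rintro ⟨y, hy, z, hz, rfl⟩
    rw [Submodule.ideal_span_singleton_smul] at hy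
    obtain ⟨a, ha, rfl⟩ := (Submodule.mem_smul_pointwise_iff_exists _ _ _).1 hy
    exact ⟨a, ha, z, hz, rfl⟩
  · rintro ⟨a, ha, u, hu, rfl⟩
    exact ⟨_, Submodule.smul_mem_smul (Ideal.mem_span_singleton_self _) ha, u, hu, rfl⟩

theorem mem_powIdeal_smul {x : ι → B} {t : ι → ℕ} {J : Finset ι}
    {S : Submodule B M} {w : M} :
    w ∈ powIdeal x t J • S ↔ ∃ c : ι → M, (∀ i, c i ∈ S) ∧ w = ∑ i ∈ J, x i ^ t i • c i := by
  classical
  constructor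
  · intro h
    induction J using Finset.induction_on generalizing w with
    | empty =>
      rw [powIdeal_empty] at h
      exact ⟨0, fun i => S.zero_mem, by simpa using h⟩
    | insert i J hi ih =>
      obtain ⟨a, ha, u, hu, rfl⟩ := mem_powIdeal_insert_smul.1 h
      obtain ⟨c, hc, rfl⟩ := ih hu
      refine ⟨Function.update c i a, fun j => ?_, ?_⟩
      · by_cases hj : j = i
        · subst hj; simpa using ha
        · simpa [hj] using hc j
      · rw [Finset.sum_insert hi]
        congr 1
        · simp
        · exact Finset.sum_congr rfl fun j hj => by
            rw [Function.update_of_ne (by rintro rfl; exact hi hj)]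
  · rintro ⟨c, hc, rfl⟩
    exact Submodule.sum_mem _ fun i hi => Submodule.smul_mem_smul (pow_mem_powIdeal x t hi) (hc i)

theorem mem_powIdeal_zero {x : ι → B} {t : ι → ℕ} {J : Finset ι}
    {S : Submodule B M} {w : M} (hw : w ∈ S) {i : ι} (hi : i ∈ J) (ht : t i = 0) :
    w ∈ powIdeal x t J • S := by
  have := Submodule.smul_mem_smul (pow_mem_powIdeal x t hi) hw
  simpa [ht] using this

theorem prod_smul_mem_powIdeal {x : ι → B} {t m : ι → ℕ} {J : Finset ι}
    {S : Submodule B M} {w : M} (hw : w ∈ powIdeal x t J • S) :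
    (∏ i ∈ J, x i ^ m i) • w ∈ powIdeal x (fun i => t i + m i) J • S := by
  classical
  obtain ⟨c, hc, rfl⟩ := mem_powIdeal_smul.1 hw
  rw [Finset.smul_sum]
  refine Submodule.sum_mem _ fun i hi => ?_
  have : (∏ i ∈ J, x i ^ m i) • x i ^ t i • c i
      = x i ^ (t i + m i) • (∏ j ∈ J.erase i, x j ^ m j) • c i := by
    rw [← Finset.mul_prod_erase J _ hi, smul_smul, smul_smul]
    congr 1
    ring
  rw [this]
  exact Submodule.smul_mem_smul (pow_mem_powIdeal x (fun i => t i + m i) hi)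
    (S.smul_mem _ (hc i))

end PowerIdeal

section Integral

variable {B Ω : Type*} [CommRing B] [Field Ω] [Algebra B Ω]

theorem exists_finite_subalgebra_of_integral {ι : Type*} (J : Finset ι) (v : ι → Ω)
    (hv : ∀ i ∈ J, IsIntegral B (v i)) (S : Subalgebra B Ω) (hS : S.toSubmodule.FG) :
    ∃ S' : Subalgebra B Ω, S ≤ S' ∧ S'.toSubmodule.FG ∧ ∀ i ∈ J, v i ∈ S' := by
  classical
  refine ⟨S ⊔ Algebra.adjoin B (v '' J), le_sup_left, ?_, fun i hi =>
    (le_sup_right : _ ≤ S ⊔ Algebra.adjoin B (v '' J)) (Algebra.subset_adjoin ⟨i, hi, rfl⟩)⟩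
  have h1 : (Algebra.adjoin B (v '' J)).toSubmodule.FG :=
    fg_adjoin_of_finite (J.finite_toSet.image v) (by rintro _ ⟨i, hi, rfl⟩; exact hv i hi)
  have : Module.Finite B S := Module.Finite.iff_fg.2 hS
  have : Module.Finite B (Algebra.adjoin B (v '' J)) := Module.Finite.iff_fg.2 h1
  exact Module.Finite.iff_fg.1 (Subalgebra.finite_sup S (Algebra.adjoin B (v '' J)))

theorem sup_fg {S S' : Subalgebra B Ω} (hS : S.toSubmodule.FG) (hS' : S'.toSubmodule.FG) :
    (S ⊔ S').toSubmodule.FG := by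
  have : Module.Finite B S := Module.Finite.iff_fg.2 hS
  have : Module.Finite B S' := Module.Finite.iff_fg.2 hS'
  exact Module.Finite.iff_fg.1 (Subalgebra.finite_sup S S')

theorem isIntegral_of_mem_fg {S : Subalgebra B Ω} (hS : S.toSubmodule.FG) {v : Ω} (hv : v ∈ S) :
    IsIntegral B v :=
  IsIntegral.of_mem_of_fg S hS v hv

open Polynomial in
theorem monic_pow_sub_sum {A : Type*} [CommRing A] [Nontrivial A] {q : ℕ} (hq : 0 < q)
    (s : Finset ℕ) (hs : ∀ j ∈ s, j < q) (b : ℕ → A) (u : A) :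
    (X ^ q - (∑ j ∈ s, C (b j) * X ^ j + C u) : A[X]).Monic ∧
    (X ^ q - (∑ j ∈ s, C (b j) * X ^ j + C u) : A[X]).degree = q := by
  have hdeg : (∑ j ∈ s, C (b j) * X ^ j + C u : A[X]).degree < q := by
    rw [← Polynomial.mem_degreeLT]
    refine Submodule.add_mem _ (Submodule.sum_mem _ fun j hj => ?_) ?_
    · rw [Polynomial.mem_degreeLT]
      exact (Polynomial.degree_C_mul_X_pow_le j _).trans_lt (by exact_mod_cast hs j hj)
    · rw [Polynomial.mem_degreeLT]
      exact (Polynomial.degree_C_le).trans_lt (by exact_mod_cast hq)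
  refine ⟨Polynomial.monic_X_pow_sub hdeg, ?_⟩
  rw [Polynomial.degree_sub_eq_left_of_degree_lt (by rwa [Polynomial.degree_X_pow]),
    Polynomial.degree_X_pow]

open Polynomial in
/-- An equation `v ^ q = ∑ b j * v ^ j + u` forces integrality. -/
theorem isIntegral_of_pow_eq {q : ℕ} (hq : 0 < q) (s : Finset ℕ) (hs : ∀ j ∈ s, j < q)
    (b : ℕ → B) {u v : Ω} (hu : IsIntegral B u) (h : v ^ q = ∑ j ∈ s, b j • v ^ j + u) :
    IsIntegral B v := by
  let A := integralClosure B Ω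
  let u0 : A := ⟨u, hu⟩
  have hC : IsIntegral A v := by
    refine ⟨_, (monic_pow_sub_sum hq s hs (fun j => algebraMap B A (b j)) u0).1, ?_⟩
    simp only [eval₂_sub, eval₂_add, eval₂_finsetSum, eval₂_mul, eval₂_pow, eval₂_X, eval₂_C]
    rw [h]
    simp only [← IsScalarTower.algebraMap_apply, Algebra.smul_def]
    exact sub_self _
  exact isIntegral_trans (R := B) (A := A) v hC

open Polynomial in
theorem exists_pow_eq [IsAlgClosed Ω] {q : ℕ} (hq : 0 < q) (s : Finset ℕ) (hs : ∀ j ∈ s, j < q)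
    (b : ℕ → B) (u : Ω) : ∃ v : Ω, v ^ q = ∑ j ∈ s, b j • v ^ j + u := by
  obtain ⟨v, hv⟩ := IsAlgClosed.exists_root _ (by
    rw [(monic_pow_sub_sum hq s hs (fun j => algebraMap B Ω (b j)) u).2]
    exact_mod_cast hq.ne')
  refine ⟨v, ?_⟩
  simp only [IsRoot, eval_sub, eval_add, eval_finsetSum, eval_mul, eval_pow, eval_X, eval_C] at hv
  simpa [Algebra.smul_def] using sub_eq_zero.1 hv

/-- Splitting a solution of an additive equation along a decomposition of its right-hand side. -/
theorem exists_integral_decomposition [IsAlgClosed Ω] {p : ℕ} [Fact p.Prime] [CharP Ω p]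
    {ι : Type*} (J : Finset ι) (e : ℕ) (b : ℕ → B) (u : ι → Ω) (d : ι → B)
    (hd : ∀ i ∈ J, algebraMap B Ω (d i) ≠ 0) (hu : ∀ i ∈ J, IsIntegral B (u i)) (y : Ω)
    (hy : y ^ p ^ e = ∑ j ∈ Finset.range e, b j • y ^ p ^ j
      + ∑ i ∈ J, u i / algebraMap B Ω (d i)) :
    ∃ (v₀ : Ω) (v : ι → Ω), IsIntegral B v₀ ∧ (∀ i ∈ J, IsIntegral B (v i)) ∧
      y = v₀ + ∑ i ∈ J, v i / algebraMap B Ω (d i) := by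
  classical
  have hp1 : 1 < p := (Fact.out : p.Prime).one_lt
  have hq : 0 < p ^ e := by positivity
  have hinj : Function.Injective fun j : ℕ => p ^ j := Nat.pow_right_injective hp1
  let s : Finset ℕ := (Finset.range e).image fun j => p ^ j
  have hs : ∀ j ∈ s, j < p ^ e := by
    intro j hj
    obtain ⟨k, hk, rfl⟩ := Finset.mem_image.1 hj
    exact Nat.pow_lt_pow_right hp1 (Finset.mem_range.1 hk)
  have hsum : ∀ (c : ℕ → B) (v : Ω), ∑ j ∈ s, c (Nat.log p j) • v ^ j
      = ∑ j ∈ Finset.range e, c j • v ^ p ^ j := by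
    intro c v
    rw [Finset.sum_image (fun a _ b _ h => hinj h)]
    exact Finset.sum_congr rfl fun j _ => by rw [Nat.log_pow hp1]
  have hroot : ∀ i, ∃ Y : Ω, Y ^ p ^ e = ∑ j ∈ Finset.range e, b j • Y ^ p ^ j
      + u i / algebraMap B Ω (d i) := by
    intro i
    obtain ⟨v, hv⟩ := exists_pow_eq (B := B) hq s hs (fun j => b (Nat.log p j))
      (u i / algebraMap B Ω (d i))
    exact ⟨v, by rw [hv, hsum b]⟩
  choose Y hY using hroot
  refine ⟨y - ∑ i ∈ J, Y i, fun i => algebraMap B Ω (d i) * Y i, ?_, fun i hi => ?_, ?_⟩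
  · refine isIntegral_of_pow_eq hq s hs (fun j => b (Nat.log p j)) (u := 0) isIntegral_zero ?_
    rw [hsum b, sub_pow_char_pow, sum_pow_char_pow, hy]
    simp only [sub_pow_char_pow, sum_pow_char_pow, smul_sub, Finset.sum_sub_distrib, hY,
      Finset.sum_add_distrib, Finset.smul_sum, add_zero]
    rw [Finset.sum_comm]
    ring
  · refine isIntegral_of_pow_eq hq s hs
      (fun j => b (Nat.log p j) * d i ^ (p ^ e - p ^ Nat.log p j))
      (u := algebraMap B Ω (d i ^ (p ^ e - 1)) * u i)
      ((isIntegral_algebraMap).mul (hu i hi)) ?_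
    rw [hsum (fun j => b j * d i ^ (p ^ e - p ^ j)), mul_pow, hY, mul_add, Finset.mul_sum]
    congr 1
    · refine Finset.sum_congr rfl fun j hj => ?_
      have hle : p ^ j ≤ p ^ e := (Nat.pow_lt_pow_right hp1 (Finset.mem_range.1 hj)).le
      rw [Algebra.smul_def, Algebra.smul_def, mul_pow, map_mul, map_pow]
      have : algebraMap B Ω (d i) ^ p ^ e
          = algebraMap B Ω (d i) ^ (p ^ e - p ^ j) * algebraMap B Ω (d i) ^ p ^ j := by
        rw [← pow_add, Nat.sub_add_cancel hle]
      rw [this]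
      ring
    · have : algebraMap B Ω (d i) ^ p ^ e
          = algebraMap B Ω (d i) ^ (p ^ e - 1) * algebraMap B Ω (d i) := by
        rw [← pow_succ, Nat.sub_add_cancel hq]
      rw [this, map_pow]
      field_simp [hd i hi]
  · rw [Finset.sum_congr rfl fun i hi => mul_div_cancel_left₀ (Y i) (hd i hi)]
    ring

end Integral

section ColonCapture

variable {B Ω : Type*} [CommRing B] [Field Ω] [Algebra B Ω] {ι : Type*}

/-- Colon relations for `x l` modulo powers of the `x i`, `i ∈ J`, in a finite subalgebra become
trivial in a larger finite subalgebra. -/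
def ColonTrivial (Ω : Type*) [Field Ω] [Algebra B Ω] (x : ι → B) (J : Finset ι) (l : ι) : Prop :=
  ∀ S : Subalgebra B Ω, S.toSubmodule.FG → ∃ S' : Subalgebra B Ω, S ≤ S' ∧ S'.toSubmodule.FG ∧
    ∀ (t : ι → ℕ) (s : ℕ), ∀ w ∈ S, x l ^ s • w ∈ powIdeal x t J • S.toSubmodule →
      w ∈ powIdeal x t J • S'.toSubmodule

/-- Colon relations for `x l` modulo powers of the `x i`, `i ∈ J`, in a finite subalgebra are
killed by fixed powers of the `x i` in a larger finite subalgebra. -/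
def ColonBounded (Ω : Type*) [Field Ω] [Algebra B Ω] (x : ι → B) (J : Finset ι) (l : ι) : Prop :=
  ∀ S : Subalgebra B Ω, S.toSubmodule.FG → ∃ S' : Subalgebra B Ω, S ≤ S' ∧ S'.toSubmodule.FG ∧
    ∃ N : ℕ, ∀ (t : ι → ℕ) (s : ℕ), ∀ w ∈ S, x l ^ s • w ∈ powIdeal x t J • S.toSubmodule →
      ∀ i ∈ J, x i ^ N • w ∈ powIdeal x t J • S'.toSubmodule

theorem smul_sub_mono {I : Ideal B} {S S' : Subalgebra B Ω} (h : S ≤ S') :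
    I • S.toSubmodule ≤ I • S'.toSubmodule :=
  Submodule.smul_mono le_rfl h

variable [DecidableEq ι]

theorem ColonTrivial.shift {x : ι → B} {J : Finset ι} {i : ι} (hi : i ∈ J)
    (h : ColonTrivial Ω x (J.erase i) i) (S : Subalgebra B Ω) (hS : S.toSubmodule.FG) :
    ∃ S' : Subalgebra B Ω, S ≤ S' ∧ S'.toSubmodule.FG ∧
      ∀ (t : ι → ℕ) (m : ℕ), ∀ a ∈ S, x i ^ m • a ∈ powIdeal x t J • S.toSubmodule →
        a ∈ powIdeal x (Function.update t i (t i - m)) J • S'.toSubmodule := by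
  obtain ⟨S', hSS', hS', H⟩ := h S hS
  refine ⟨S', hSS', hS', fun t m a ha hrel => ?_⟩
  rcases le_or_gt (t i) m with hm | hm
  · exact mem_powIdeal_zero (hSS' ha) hi (by simp [hm])
  · rw [← Finset.insert_erase hi] at hrel ⊢
    obtain ⟨b, hb, u, hu, hw⟩ := mem_powIdeal_insert_smul.1 hrel
    have h1 : a - x i ^ (t i - m) • b ∈ powIdeal x t (J.erase i) • S'.toSubmodule := by
      refine H t m _ (S.sub_mem ha (S.smul_mem hb _)) ?_
      rw [smul_sub, hw, smul_smul, ← pow_add, Nat.add_sub_cancel' hm.le, add_sub_cancel_left]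
      exact hu
    refine mem_powIdeal_insert_smul.2 ⟨b, hSS' hb, a - x i ^ (t i - m) • b, ?_, by simp⟩
    rwa [powIdeal_congr (t' := t) (fun j hj => by
      rw [Function.update_of_ne (Finset.ne_of_mem_erase hj)])]

theorem ColonTrivial.peel {x : ι → B} {J : Finset ι}
    (h : ∀ i ∈ J, ColonTrivial Ω x (J.erase i) i) (K : Finset ι) (hK : K ⊆ J)
    (S : Subalgebra B Ω) (hS : S.toSubmodule.FG) :
    ∃ S' : Subalgebra B Ω, S ≤ S' ∧ S'.toSubmodule.FG ∧
      ∀ (t m : ι → ℕ), ∀ a ∈ S, (∏ i ∈ K, x i ^ m i) • a ∈ powIdeal x t J • S.toSubmodule →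
        a ∈ powIdeal x (fun i => if i ∈ K then t i - m i else t i) J • S'.toSubmodule := by
  induction K using Finset.induction_on generalizing S with
  | empty => exact ⟨S, le_rfl, hS, fun t m a ha h => by simpa using h⟩
  | insert k K hk ih =>
    obtain ⟨S₁, h1, hS₁, H1⟩ := (h k (hK (Finset.mem_insert_self _ _))).shift
      (hK (Finset.mem_insert_self _ _)) S hS
    obtain ⟨S₂, h2, hS₂, H2⟩ := ih ((Finset.subset_insert _ _).trans hK) S₁ hS₁
    refine ⟨S₂, h1.trans h2, hS₂, fun t m a ha hrel => ?_⟩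
    rw [Finset.prod_insert hk, mul_smul] at hrel
    have := H2 _ m a (h1 ha) (H1 t (m k) _ (S.smul_mem ha _) hrel)
    rwa [powIdeal_congr (fun i hi => ?_)] at this
    by_cases hik : i = k
    · subst hik; simp [hk]
    · simp [hik]

theorem ColonTrivial.peel_all {x : ι → B} {J : Finset ι}
    (h : ∀ i ∈ J, ColonTrivial Ω x (J.erase i) i)
    (S : Subalgebra B Ω) (hS : S.toSubmodule.FG) :
    ∃ S' : Subalgebra B Ω, S ≤ S' ∧ S'.toSubmodule.FG ∧
      ∀ (t m : ι → ℕ), ∀ a ∈ S, (∏ i ∈ J, x i ^ m i) • a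
          ∈ powIdeal x (fun i => t i + m i) J • S.toSubmodule →
        a ∈ powIdeal x t J • S'.toSubmodule := by
  obtain ⟨S', h1, hS', H⟩ := ColonTrivial.peel h J subset_rfl S hS
  refine ⟨S', h1, hS', fun t m a ha hrel => ?_⟩
  have := H _ m a ha hrel
  rwa [powIdeal_congr (t' := t) (fun i hi => by simp [hi])] at this

theorem ColonTrivial.exists_prod_smul {x : ι → B} {J : Finset ι}
    (h : ∀ i ∈ J, ColonTrivial Ω x (J.erase i) i) (K : Finset ι) (hK : K ⊆ J)
    (S : Subalgebra B Ω) (hS : S.toSubmodule.FG) :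
    ∃ S' : Subalgebra B Ω, S ≤ S' ∧ S'.toSubmodule.FG ∧
      ∀ (t : ι → ℕ) (N : ℕ), ∀ w ∈ S,
        (∀ i ∈ J, x i ^ N • w ∈ powIdeal x t J • S.toSubmodule) →
        ∃ a ∈ S', w - (∏ i ∈ K, x i ^ (t i - N)) • a ∈ powIdeal x t J • S'.toSubmodule := by
  induction K using Finset.induction_on with
  | empty =>
    exact ⟨S, le_rfl, hS, fun t N w hw _ => ⟨w, hw, by simp⟩⟩
  | insert l K hl ih =>
    obtain ⟨S₁, h1, hS₁, H1⟩ := ih ((Finset.subset_insert _ _).trans hK)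
    obtain ⟨S₂, h2, hS₂, H2⟩ := ColonTrivial.peel h (insert l K) hK S₁ hS₁
    refine ⟨S₂, h1.trans h2, hS₂, fun t N w hw hrel => ?_⟩
    obtain ⟨a, ha, hwa⟩ := H1 t N w hw hrel
    have hlJ : l ∈ J := hK (Finset.mem_insert_self _ _)
    have hKJ : K ⊆ J := (Finset.subset_insert _ _).trans hK
    have h3 : a ∈ powIdeal x (fun i => if i ∈ insert l K then
        t i - (if i = l then N else t i - N) else t i) J • S₂.toSubmodule := by
      refine H2 t (fun i => if i = l then N else t i - N) a ha ?_
      rw [Finset.prod_insert hl, if_pos rfl, mul_smul]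
      have h4 : ∏ i ∈ K, x i ^ (if i = l then N else t i - N) = ∏ i ∈ K, x i ^ (t i - N) :=
        Finset.prod_congr rfl fun i hi => by rw [if_neg (by rintro rfl; exact hl hi)]
      rw [h4]
      have h5 := Submodule.sub_mem _ (smul_sub_mono h1 (hrel l hlJ))
        (Submodule.smul_mem _ (x l ^ N) hwa)
      rw [smul_sub, sub_sub_cancel] at h5
      exact h5
    rw [← Finset.insert_erase hlJ] at h3
    obtain ⟨b, hb, u, hu, hau⟩ := mem_powIdeal_insert_smul.1 h3
    refine ⟨b, hb, ?_⟩
    have h6 : (∏ i ∈ K, x i ^ (t i - N)) • u ∈ powIdeal x t J • S₂.toSubmodule := by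
      obtain ⟨c, hc, rfl⟩ := mem_powIdeal_smul.1 hu
      rw [Finset.smul_sum]
      refine Submodule.sum_mem _ fun i hi => ?_
      have hil : i ≠ l := Finset.ne_of_mem_erase hi
      have hiJ : i ∈ J := Finset.mem_of_mem_erase hi
      by_cases hiK : i ∈ K
      · rw [← Finset.mul_prod_erase K _ hiK, mul_comm, mul_smul, smul_smul (x i ^ (t i - N)),
          ← pow_add, smul_comm]
        have hle : t i ≤ t i - N + (if i ∈ insert l K then t i - (if i = l then N else t i - N)
            else t i) := by
          simp only [Finset.mem_insert, hiK, hil, or_true, if_true, if_false]; omega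
        rw [← Nat.add_sub_cancel' hle, pow_add, mul_smul]
        exact Submodule.smul_mem_smul (pow_mem_powIdeal x t hiJ)
          (S₂.smul_mem (S₂.smul_mem (hc i) _) _)
      · rw [if_neg (by simp [hil, hiK]), smul_comm]
        exact Submodule.smul_mem_smul (pow_mem_powIdeal x t hiJ) (S₂.smul_mem (hc i) _)
    have h7 : w - (∏ i ∈ insert l K, x i ^ (t i - N)) • b
        = (w - (∏ i ∈ K, x i ^ (t i - N)) • a) + (∏ i ∈ K, x i ^ (t i - N)) • u := by
      rw [hau, Finset.prod_insert hl, if_pos (Finset.mem_insert_self _ _), if_pos rfl,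
        mul_comm, mul_smul, smul_add]
      abel
    rw [h7]
    exact Submodule.add_mem _ (smul_sub_mono h2 hwa) h6

end ColonCapture

section Frobenius

variable {B Ω : Type*} [CommRing B] [Field Ω] [Algebra B Ω] {ι : Type*}

theorem pow_char_mem_powIdeal {p : ℕ} [Fact p.Prime] [CharP Ω p] {x : ι → B} {t : ι → ℕ}
    {J : Finset ι} {S : Subalgebra B Ω} {u : Ω} (hu : u ∈ powIdeal x t J • S.toSubmodule) (j : ℕ) :
    u ^ p ^ j ∈ powIdeal x (fun i => p ^ j * t i) J • S.toSubmodule := by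
  obtain ⟨c, hc, rfl⟩ := mem_powIdeal_smul.1 hu
  rw [sum_pow_char_pow]
  refine Submodule.sum_mem _ fun i hi => ?_
  rw [smul_pow, ← pow_mul, mul_comm]
  exact Submodule.smul_mem_smul (pow_mem_powIdeal x (fun i => p ^ j * t i) hi)
    (S.pow_mem (hc i) _)

theorem exists_eq_sum_range_smul [IsNoetherianRing B] {M : Type*} [AddCommGroup M] [Module B M]
    (S : Submodule B M) (hS : S.FG) (a : ℕ → M) (ha : ∀ j, a j ∈ S) :
    ∃ (e : ℕ) (b : ℕ → B), a e = ∑ j ∈ Finset.range e, b j • a j := by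
  have : Module.Finite B S := Module.Finite.iff_fg.2 hS
  have hN : IsNoetherian B S := inferInstance
  let a' : ℕ → S := fun j => ⟨a j, ha j⟩
  let f : ℕ →o Submodule B S :=
    ⟨fun n => Submodule.span B (a' '' (Finset.range n : Set ℕ)), fun m n hmn =>
      Submodule.span_mono (Set.image_mono (by
        intro k hk; simp only [Finset.coe_range, Set.mem_Iio] at hk ⊢; omega))⟩
  obtain ⟨n, hn⟩ := monotone_stabilizes_iff_noetherian.2 hN f
  have h1 : a' n ∈ f n := by
    rw [hn (n + 1) (Nat.le_succ n)]
    exact Submodule.subset_span ⟨n, by simp, rfl⟩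
  obtain ⟨b, hb⟩ := (Submodule.mem_span_image_finset_iff_exists_fun B).1 h1
  refine ⟨n, fun j => if h : j ∈ Finset.range n then b ⟨j, h⟩ else 0, ?_⟩
  have := congrArg (S.subtype) hb
  simp only [map_sum, map_smul] at this
  rw [← Finset.sum_coe_sort (Finset.range n)]
  refine this.symm.trans (Finset.sum_congr rfl fun j _ => ?_)
  simp only [j.2, dite_true]
  rfl

theorem ColonTrivial.mem_of_frobenius_bounded [DecidableEq ι] [IsNoetherianRing B] [IsAlgClosed Ω]
    {p : ℕ} [Fact p.Prime] [CharP Ω p] {x : ι → B} (hx : ∀ i, algebraMap B Ω (x i) ≠ 0)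
    {J : Finset ι} (hJ : J.Nonempty) (h : ∀ i ∈ J, ColonTrivial Ω x (J.erase i) i)
    (S : Subalgebra B Ω) (hS : S.toSubmodule.FG) (N : ℕ) (t : ι → ℕ) (w : Ω) (hwS : w ∈ S)
    (H : ∀ j : ℕ, ∃ a ∈ S, ∃ u ∈ powIdeal x (fun i => p ^ j * t i) J • S.toSubmodule,
      (∏ i ∈ J, x i ^ N) • w ^ p ^ j
        = (∏ i ∈ J, x i ^ (p ^ j * t i)) • a + (∏ i ∈ J, x i ^ N) • u) :
    ∃ S' : Subalgebra B Ω, S ≤ S' ∧ S'.toSubmodule.FG ∧ w ∈ powIdeal x t J • S'.toSubmodule := by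
  choose a ha u hu hrel using H
  choose c hc huc using fun j => mem_powIdeal_smul.1 (hu j)
  obtain ⟨e, b, hab⟩ := exists_eq_sum_range_smul S.toSubmodule hS a ha
  have hp1 : 1 < p := (Fact.out : p.Prime).one_lt
  let X : ι → Ω := fun i => algebraMap B Ω (x i)
  have hX : ∀ i, X i ≠ 0 := hx
  have hprod : ∀ (K : Finset ι) (m : ι → ℕ), (∏ i ∈ K, X i ^ m i) ≠ 0 := fun K m =>
    Finset.prod_ne_zero_iff.2 fun i _ => pow_ne_zero _ (hX i)
  have hmap : ∀ (K : Finset ι) (m : ι → ℕ), algebraMap B Ω (∏ i ∈ K, x i ^ m i)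
      = ∏ i ∈ K, X i ^ m i := fun K m => by simp [X]
  let D : ι → ℕ → Ω := fun i q => ∏ k ∈ J.erase i, X k ^ (q * t k)
  have hD : ∀ i q, D i q ≠ 0 := fun i q => hprod _ _
  let P : Ω := ∏ i ∈ J, X i ^ N
  have hP : P ≠ 0 := hprod J fun _ => N
  let T : ℕ → Ω := fun q => ∏ i ∈ J, X i ^ (q * t i)
  have hT : ∀ q, T q ≠ 0 := fun q => hprod _ _
  have hTD : ∀ q, ∀ i ∈ J, T q = X i ^ (q * t i) * D i q := fun q i hi =>
    (Finset.mul_prod_erase J _ hi).symm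
  have hTpow : ∀ q, T 1 ^ q = T q := fun q => by
    simp only [T, ← Finset.prod_pow, ← pow_mul]
    exact Finset.prod_congr rfl fun i _ => by ring_nf
  have hDadd : ∀ i q q', D i (q + q') = D i q * D i q' := fun i q q' => by
    simp only [D, ← Finset.prod_mul_distrib, ← pow_add, add_mul]
  let y : Ω := w / T 1
  have hy : ∀ j, y ^ p ^ j = a j / P + ∑ i ∈ J, c j i / D i (p ^ j) := by
    intro j
    have h1 := hrel j
    rw [Algebra.smul_def, Algebra.smul_def, Algebra.smul_def, hmap J fun _ => N,
      hmap J fun i => p ^ j * t i, huc j] at h1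
    change P * w ^ p ^ j = T (p ^ j) * a j + P * _ at h1
    have h2 : w ^ p ^ j = T (p ^ j) * a j / P + ∑ i ∈ J, x i ^ (p ^ j * t i) • c j i := by
      field_simp
      linear_combination h1
    rw [div_pow, hTpow, h2, add_div, Finset.sum_div]
    congr 1
    · have := hT (p ^ j)
      field_simp
    · refine Finset.sum_congr rfl fun i hi => ?_
      rw [hTD _ i hi, Algebra.smul_def, map_pow, mul_div_mul_left _ _ (pow_ne_zero _ (hX i))]
  have hDmem : ∀ i q, D i q * 1 ∈ S := fun i q => by
    have : D i q = algebraMap B Ω (∏ k ∈ J.erase i, x k ^ (q * t k)) := (hmap _ _).symm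
    rw [mul_one, this]
    exact S.algebraMap_mem _
  let v : ι → Ω := fun i => c e i - ∑ j ∈ Finset.range e, b j • (c j i * D i (p ^ e - p ^ j))
  have hv : ∀ i ∈ J, IsIntegral B (v i) := fun i _ => isIntegral_of_mem_fg hS
    (S.sub_mem (hc e i) (S.sum_mem fun j _ => S.smul_mem (S.mul_mem (hc j i)
      (by simpa using hDmem i (p ^ e - p ^ j))) _))
  have hdec := exists_integral_decomposition (p := p) J e b v
    (fun i => ∏ k ∈ J.erase i, x k ^ (p ^ e * t k))
    (fun i _ => by rw [hmap]; exact hD i (p ^ e)) hv y (by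
      have h3 : ∀ i, algebraMap B Ω (∏ k ∈ J.erase i, x k ^ (p ^ e * t k)) = D i (p ^ e) :=
        fun i => hmap _ _
      simp only [h3, hy]
      rw [show a e = ∑ j ∈ Finset.range e, b j • a j from hab]
      simp only [v, smul_add, Finset.sum_add_distrib, sub_div, Finset.sum_sub_distrib,
        Finset.smul_sum, Finset.sum_div]
      rw [Finset.sum_comm (s := J)]
      have h4 : ∀ j ∈ Finset.range e, ∑ i ∈ J, b j • (c j i * D i (p ^ e - p ^ j)) / D i (p ^ e)
          = ∑ i ∈ J, b j • (c j i / D i (p ^ j)) := by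
        intro j hj
        refine Finset.sum_congr rfl fun i hi => ?_
        have h5 : D i (p ^ e) = D i (p ^ e - p ^ j) * D i (p ^ j) := by
          rw [← hDadd, Nat.sub_add_cancel
            (Nat.pow_le_pow_right hp1.le (Finset.mem_range.1 hj).le)]
        rw [h5, Algebra.smul_def, Algebra.smul_def]
        have := hD i (p ^ e - p ^ j)
        have := hD i (p ^ j)
        field_simp
      rw [Finset.sum_congr rfl h4]
      simp only [Algebra.smul_def, mul_div_assoc]
      ring)
  obtain ⟨v₀, v', hv₀, hv', hyv⟩ := hdec
  obtain ⟨S₁, h1, hS₁, hm⟩ := exists_finite_subalgebra_of_integral (Finset.univ : Finset Unit)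
    (fun _ => v₀) (fun _ _ => hv₀) S hS
  obtain ⟨S₂, h2, hS₂, hm'⟩ := exists_finite_subalgebra_of_integral J v' hv' S₁ hS₁
  have hv₀S : v₀ ∈ S₂ := h2 (hm () (Finset.mem_univ _))
  obtain ⟨S₃, h3, hS₃, H3⟩ := ColonTrivial.peel_all h S₂ hS₂
  refine ⟨S₃, h1.trans (h2.trans h3), hS₃, H3 t (fun i => p ^ e * t i) w (h2 (h1 hwS)) ?_⟩
  have hw : w = T 1 * (v₀ + ∑ i ∈ J, v' i / D i (p ^ e)) := by
    have : ∀ i, algebraMap B Ω (∏ k ∈ J.erase i, x k ^ (p ^ e * t k)) = D i (p ^ e) :=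
        fun i => hmap _ _
    simp only [this] at hyv
    rw [← hyv]
    exact (mul_div_cancel₀ _ (hT 1)).symm
  have hsmul : (∏ i ∈ J, x i ^ (p ^ e * t i)) • w = T (p ^ e) * w := by
    rw [Algebra.smul_def, hmap J fun i => p ^ e * t i]
  rw [hsmul]
  rw [hw, mul_add, mul_add, Finset.mul_sum, Finset.mul_sum]
  refine Submodule.add_mem _ ?_ (Submodule.sum_mem _ fun i hi => ?_)
  · obtain ⟨i, hi⟩ := hJ
    have : T (p ^ e) * (T 1 * v₀) = x i ^ (t i + p ^ e * t i) •
        (D i (p ^ e) * 1 * (D i 1 * 1) * v₀) := by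
      rw [hTD _ i hi, hTD _ i hi, Algebra.smul_def, map_pow]
      ring
    rw [this]
    exact Submodule.smul_mem_smul (pow_mem_powIdeal x (fun i => t i + p ^ e * t i) hi)
      (S₂.mul_mem (S₂.mul_mem (h2 (h1 (hDmem i _))) (h2 (h1 (hDmem i _)))) hv₀S)
  · have : T (p ^ e) * (T 1 * (v' i / D i (p ^ e))) = x i ^ (t i + p ^ e * t i) •
        (D i 1 * 1 * v' i) := by
      rw [hTD _ i hi, hTD _ i hi, Algebra.smul_def, map_pow]
      have := hD i (p ^ e)
      field_simp
      ring
    rw [this]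
    exact Submodule.smul_mem_smul (pow_mem_powIdeal x (fun i => t i + p ^ e * t i) hi)
      (S₂.mul_mem (h2 (h1 (hDmem i _))) (hm' i hi))

end Frobenius

section FrobeniusMain

variable {B Ω : Type*} [CommRing B] [Field Ω] [Algebra B Ω] {ι : Type*}

theorem ColonTrivial.of_bounded [DecidableEq ι] [IsNoetherianRing B] [IsAlgClosed Ω]
    {p : ℕ} [Fact p.Prime] [CharP Ω p] {x : ι → B} (hx : ∀ i, algebraMap B Ω (x i) ≠ 0)
    (H : ∀ (J : Finset ι) (l : ι), l ∉ J → ColonBounded Ω x J l) (J : Finset ι) :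
    ∀ l ∉ J, ColonTrivial Ω x J l := by
  induction J using Finset.strongInduction with
  | H J ih =>
  intro l hl S hS
  have h : ∀ i ∈ J, ColonTrivial Ω x (J.erase i) i := fun i hi =>
    ih _ (Finset.erase_ssubset hi) i (Finset.notMem_erase i J)
  rcases J.eq_empty_or_nonempty with rfl | hJ
  · refine ⟨S, le_rfl, hS, fun t s w hw hrel => ?_⟩
    rw [powIdeal_empty, Submodule.bot_smul, Submodule.mem_bot] at hrel ⊢
    rw [Algebra.smul_def, map_pow] at hrel
    exact (mul_eq_zero.1 hrel).resolve_left (pow_ne_zero _ (hx l))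
  obtain ⟨S₁, h1, hS₁, N, H1⟩ := H J l hl S hS
  obtain ⟨S₂, h2, hS₂, H2⟩ := ColonTrivial.exists_prod_smul h J subset_rfl S₁ hS₁
  let R : Ω → (ι → ℕ) → Prop := fun w t =>
    w ∈ S ∧ ∃ s : ℕ, x l ^ s • w ∈ powIdeal x t J • S.toSubmodule
  have hRfrob : ∀ w t j, R w t → R (w ^ p ^ j) (fun i => p ^ j * t i) := by
    rintro w t j ⟨hw, s, hrel⟩
    refine ⟨S.pow_mem hw _, s * p ^ j, ?_⟩
    have := pow_char_mem_powIdeal (p := p) hrel j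
    rwa [smul_pow, ← pow_mul] at this
  have hR : ∀ w t, R w t → ∃ a ∈ S₂, ∃ u ∈ powIdeal x t J • S₂.toSubmodule,
      (∏ i ∈ J, x i ^ N) • w = (∏ i ∈ J, x i ^ t i) • a + (∏ i ∈ J, x i ^ N) • u := by
    rintro w t ⟨hw, s, hrel⟩
    obtain ⟨a, ha, hu⟩ := H2 t N w (h1 hw) (H1 t s w hw hrel)
    refine ⟨(∏ i ∈ J, x i ^ (N - t i)) • a, S₂.smul_mem ha _, _, hu, ?_⟩
    rw [smul_sub, smul_smul, smul_smul, ← Finset.prod_mul_distrib, ← Finset.prod_mul_distrib]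
    have : ∏ i ∈ J, x i ^ t i * x i ^ (N - t i) = ∏ i ∈ J, x i ^ N * x i ^ (t i - N) :=
      Finset.prod_congr rfl fun i _ => by
        rw [← pow_add, ← pow_add]; congr 1; omega
    rw [this]
    abel
  let 𝓐 : Set Ω := {a | a ∈ S₂ ∧ ∃ w t, R w t ∧ ∃ u ∈ powIdeal x t J • S₂.toSubmodule,
    (∏ i ∈ J, x i ^ N) • w = (∏ i ∈ J, x i ^ t i) • a + (∏ i ∈ J, x i ^ N) • u}
  have hfg : (Submodule.span B 𝓐).FG := by
    have : Module.Finite B S₂.toSubmodule := Module.Finite.iff_fg.2 hS₂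
    have hN : IsNoetherian B S₂.toSubmodule := inferInstance
    exact isNoetherian_submodule.1 hN _ (Submodule.span_le.2 fun a ha => ha.1)
  obtain ⟨𝓕, h𝓕, hspan⟩ := (Submodule.fg_span_iff_fg_span_finset_subset _).1 hfg
  have hmem : ∀ a ∈ 𝓐, ∃ S' : Subalgebra B Ω, S₂ ≤ S' ∧ S'.toSubmodule.FG ∧
      a ∈ powIdeal x (fun _ => N) J • S'.toSubmodule := by
    rintro a ⟨ha, w, t, hwt, u, hu, hrel⟩
    obtain ⟨S₃, h3, hS₃, hw⟩ := ColonTrivial.mem_of_frobenius_bounded (p := p) hx hJ h S₂ hS₂ N t w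
      (h2 (h1 hwt.1)) (fun j => hR _ _ (hRfrob w t j hwt))
    obtain ⟨S₄, h4, hS₄, H4⟩ := ColonTrivial.peel_all h S₃ hS₃
    refine ⟨S₄, h3.trans h4, hS₄, H4 _ t a (h3 ha) ?_⟩
    have h5 := Submodule.sub_mem _ (prod_smul_mem_powIdeal (m := fun _ => N) hw)
      (prod_smul_mem_powIdeal (m := fun _ => N) (smul_sub_mono h3 hu))
    rw [hrel, add_sub_cancel_right] at h5
    rwa [powIdeal_congr (t' := fun i => N + t i) (fun i _ => add_comm _ _)] at h5
  have hsup : ∀ 𝓕 : Finset Ω, (𝓕 : Set Ω) ⊆ 𝓐 → ∃ S' : Subalgebra B Ω, S₂ ≤ S' ∧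
      S'.toSubmodule.FG ∧ ∀ a ∈ 𝓕, a ∈ powIdeal x (fun _ => N) J • S'.toSubmodule := by
    classical
    intro 𝓕 h𝓕
    induction 𝓕 using Finset.induction_on with
    | empty => exact ⟨S₂, le_rfl, hS₂, by simp⟩
    | insert a 𝓕 _ ih =>
      obtain ⟨S₃, h3, hS₃, H3⟩ := ih (fun b hb => h𝓕 (by simp_all))
      obtain ⟨S₄, h4, hS₄, H4⟩ := hmem a (h𝓕 (by simp))
      refine ⟨S₃ ⊔ S₄, h3.trans le_sup_left, sup_fg hS₃ hS₄, fun b hb => ?_⟩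
      rcases Finset.mem_insert.1 hb with rfl | hb
      · exact smul_sub_mono le_sup_right H4
      · exact smul_sub_mono le_sup_left (H3 b hb)
  obtain ⟨S₃, h3, hS₃, H3⟩ := hsup 𝓕 h𝓕
  obtain ⟨S₄, h4, hS₄, H4⟩ := ColonTrivial.peel_all h S₃ hS₃
  refine ⟨S₄, h1.trans (h2.trans (h3.trans h4)), hS₄, fun t s w hw hrel => ?_⟩
  obtain ⟨a, ha, u, hu, hwa⟩ := hR w t ⟨hw, s, hrel⟩
  have haN : a ∈ powIdeal x (fun _ => N) J • S₃.toSubmodule := by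
    have h5 : Submodule.span B 𝓐 ≤ powIdeal x (fun _ => N) J • S₃.toSubmodule := by
      rw [hspan]
      exact Submodule.span_le.2 H3
    exact h5 (Submodule.subset_span ⟨ha, w, t, ⟨hw, s, hrel⟩, u, hu, hwa⟩)
  refine H4 t (fun _ => N) w (h3 (h2 (h1 hw))) ?_
  rw [hwa]
  refine Submodule.add_mem _ ?_ (prod_smul_mem_powIdeal (m := fun _ => N) (smul_sub_mono h3 hu))
  have := prod_smul_mem_powIdeal (m := t) haN
  rwa [powIdeal_congr (t' := fun i => t i + N) (fun i _ => add_comm _ _)] at this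

end FrobeniusMain

section

open Matrix

/-- An exact complex of finite free modules with chosen bases. -/
structure FreeComplex (B : Type*) [CommRing B] where
  /-- the ranks -/
  r : ℕ → ℕ
  /-- the differentials -/
  D : ∀ j, Matrix (Fin (r j)) (Fin (r (j + 1))) B
  D_mul : ∀ j, D j * D (j + 1) = 0
  ker_le : ∀ j (v : Fin (r (j + 1)) → B), D j *ᵥ v = 0 → ∃ w, v = D (j + 1) *ᵥ w

namespace FreeComplex

variable {B : Type*} [CommRing B]

/-- Chain maps between complexes of based free modules. -/
structure Hom (F G : FreeComplex B) where
  /-- the components -/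
  φ : ∀ j, Matrix (Fin (G.r j)) (Fin (F.r j)) B
  comm : ∀ j, G.D j * φ (j + 1) = φ j * F.D j

/-- Composition of chain maps. -/
def Hom.comp {F G H : FreeComplex B} (φ' : Hom G H) (φ : Hom F G) : Hom F H where
  φ j := φ'.φ j * φ.φ j
  comm j := by
    rw [← Matrix.mul_assoc, φ'.comm, Matrix.mul_assoc, φ.comm, Matrix.mul_assoc]

/-- Modulo `I`, the map induced on cohomology of the duals is killed by `c` in positive degrees. -/
def EK (c : B) (I : Ideal B) {F G : FreeComplex B} (φ : Hom F G) : Prop :=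
  ∀ (j : ℕ) (g : Fin (G.r (j + 1)) → B), (∀ k, (g ᵥ* G.D (j + 1)) k ∈ I) →
    ∃ ψ : Fin (F.r j) → B, ∀ k, (c • (g ᵥ* φ.φ (j + 1)) - ψ ᵥ* F.D j) k ∈ I

/-- Modulo `I`, the map is zero on homology in positive degrees. -/
def TorZero (I : Ideal B) {F G : FreeComplex B} (φ : Hom F G) : Prop :=
  ∀ (j : ℕ) (z : Fin (F.r (j + 1)) → B), (∀ k, (F.D j *ᵥ z) k ∈ I) →
    ∃ v, ∀ k, (φ.φ (j + 1) *ᵥ z - G.D (j + 1) *ᵥ v) k ∈ I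

theorem mulVec_mem {m n : ℕ} {I : Ideal B} (M : Matrix (Fin m) (Fin n) B) {v : Fin n → B}
    (hv : ∀ k, v k ∈ I) (k : Fin m) : (M *ᵥ v) k ∈ I := by
  simp only [Matrix.mulVec, dotProduct]
  exact I.sum_mem fun _ _ => I.mul_mem_left _ (hv _)

theorem vecMul_mem {m n : ℕ} {I : Ideal B} (M : Matrix (Fin m) (Fin n) B) {v : Fin m → B}
    (hv : ∀ k, v k ∈ I) (k : Fin n) : (v ᵥ* M) k ∈ I := by
  simp only [Matrix.vecMul, dotProduct]
  exact I.sum_mem fun _ _ => I.mul_mem_right _ (hv _)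

theorem dotProduct_mem {n : ℕ} {I : Ideal B} (g : Fin n → B) {v : Fin n → B}
    (hv : ∀ k, v k ∈ I) : g ⬝ᵥ v ∈ I :=
  I.sum_mem fun _ _ => I.mul_mem_left _ (hv _)

theorem dotProduct_mem' {n : ℕ} {I : Ideal B} (g : Fin n → B) {v : Fin n → B}
    (hv : ∀ k, v k ∈ I) : v ⬝ᵥ g ∈ I :=
  I.sum_mem fun _ _ => I.mul_mem_right _ (hv _)

variable {ι : Type*}

/-- Powers of the `x i` form a permutable regular sequence. -/
def PowRegular (x : ι → B) : Prop :=
  ∀ (t : ι → ℕ) (J : Finset ι) (l : ι), l ∉ J → ∀ (s : ℕ) (b : B),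
    x l ^ s * b ∈ powIdeal x t J → b ∈ powIdeal x t J

theorem exists_of_mem_powIdeal_insert [DecidableEq ι] {x : ι → B} {t : ι → ℕ} {l : ι}
    {J : Finset ι} {n : ℕ} {v : Fin n → B} (hv : ∀ k, v k ∈ powIdeal x t (insert l J)) :
    ∃ w u : Fin n → B, (∀ k, u k ∈ powIdeal x t J) ∧ v = x l ^ t l • w + u := by
  have : ∀ k, ∃ w u, u ∈ powIdeal x t J ∧ v k = x l ^ t l * w + u := by
    intro k
    have h := hv k
    rw [powIdeal_insert, Ideal.mem_span_singleton_sup] at h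
    obtain ⟨a, b, hb, h⟩ := h
    exact ⟨a, b, hb, by rw [← h]; ring⟩
  choose w u hu h using this
  exact ⟨w, u, hu, funext h⟩

theorem mem_powIdeal_insert [DecidableEq ι] {x : ι → B} {t : ι → ℕ} {l : ι}
    {J : Finset ι} {a b : B} (hb : b ∈ powIdeal x t J) :
    x l ^ t l * a + b ∈ powIdeal x t (insert l J) :=
  Ideal.add_mem _ (Ideal.mul_mem_right _ _ (pow_mem_powIdeal x t (Finset.mem_insert_self _ _)))
    (powIdeal_mono (Finset.subset_insert _ _) hb)

theorem EK.ladder [DecidableEq ι] {x : ι → B} (hx : PowRegular x) {t : ι → ℕ} {l : ι}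
    {J : Finset ι} (hl : l ∉ J) {c c' : B} {F G H : FreeComplex B} {φ : Hom F G} {φ' : Hom G H}
    (h : EK c (powIdeal x t J) φ) (h' : EK c' (powIdeal x t J) φ') :
    EK (c * c') (powIdeal x t (insert l J)) (φ'.comp φ) := by
  intro j g hg
  obtain ⟨w, u, hu, hw⟩ := exists_of_mem_powIdeal_insert hg
  have hwD : ∀ k, (w ᵥ* H.D (j + 2)) k ∈ powIdeal x t J := by
    intro k
    refine hx t J l hl (t l) _ ?_
    have h1 : (x l ^ t l • w + u) ᵥ* H.D (j + 2) = 0 := by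
      rw [← hw, Matrix.vecMul_vecMul, H.D_mul, Matrix.vecMul_zero]
    rw [Matrix.add_vecMul, Matrix.smul_vecMul] at h1
    have h2 := congrFun h1 k
    simp only [Pi.add_apply, Pi.smul_apply, smul_eq_mul, Pi.zero_apply] at h2
    rw [eq_neg_of_add_eq_zero_left h2]
    exact neg_mem (vecMul_mem _ hu k)
  obtain ⟨ψ, hψ⟩ := h' (j + 1) w hwD
  obtain ⟨ψ', hψ'⟩ := h j (c' • (g ᵥ* φ'.φ (j + 1)) - x l ^ t l • ψ) (by
    intro k
    have h3 : (c' • (g ᵥ* φ'.φ (j + 1)) - x l ^ t l • ψ) ᵥ* G.D (j + 1)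
        = x l ^ t l • (c' • (w ᵥ* φ'.φ (j + 2)) - ψ ᵥ* G.D (j + 1))
          + c' • (u ᵥ* φ'.φ (j + 2)) := by
      rw [Matrix.sub_vecMul, Matrix.smul_vecMul, Matrix.smul_vecMul, Matrix.vecMul_vecMul,
        ← φ'.comm, ← Matrix.vecMul_vecMul, hw, Matrix.add_vecMul, Matrix.smul_vecMul, smul_sub,
        smul_add, smul_comm c']
      abel
    rw [h3]
    exact Ideal.add_mem _ (Ideal.mul_mem_left _ _ (hψ k))
      (Ideal.mul_mem_left _ _ (vecMul_mem _ hu k)))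
  refine ⟨ψ', fun k => ?_⟩
  have h4 : (c * c') • (g ᵥ* (φ'.comp φ).φ (j + 1)) - ψ' ᵥ* F.D j
      = x l ^ t l • (c • (ψ ᵥ* φ.φ (j + 1))) +
        (c • ((c' • (g ᵥ* φ'.φ (j + 1)) - x l ^ t l • ψ) ᵥ* φ.φ (j + 1)) - ψ' ᵥ* F.D j) := by
    simp only [Hom.comp, ← Matrix.vecMul_vecMul, Matrix.sub_vecMul, Matrix.smul_vecMul, smul_sub,
      smul_smul, mul_comm c]
    abel
  rw [h4]
  exact mem_powIdeal_insert (hψ' k)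

/-- Injectivity of `B ⧸ I` over itself, in matrix form. -/
def MatrixInjective (I : Ideal B) : Prop :=
  ∀ (m n : ℕ) (D : Matrix (Fin n) (Fin m) B) (a : Fin m → B),
    (∀ z, (∀ k, (D *ᵥ z) k ∈ I) → a ⬝ᵥ z ∈ I) → ∃ ψ, ∀ k, (a - ψ ᵥ* D) k ∈ I

/-- `B ⧸ I` cogenerates finite modules, in matrix form. -/
def MatrixCogenerator (I : Ideal B) : Prop :=
  ∀ (n : ℕ) (N : Submodule B (Fin n → B)), (∀ v : Fin n → B, (∀ k, v k ∈ I) → v ∈ N) →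
    ∀ v ∉ N, ∃ g : Fin n → B, (∀ w ∈ N, g ⬝ᵥ w ∈ I) ∧ g ⬝ᵥ v ∉ I

theorem EK.of_torZero {I : Ideal B} (hI : MatrixInjective I) {F G : FreeComplex B} {φ : Hom F G}
    (h : TorZero I φ) : EK 1 I φ := by
  intro j g hg
  obtain ⟨ψ, hψ⟩ := hI _ _ (F.D j) (g ᵥ* φ.φ (j + 1)) (fun z hz => by
    obtain ⟨v, hv⟩ := h j z hz
    have : (g ᵥ* φ.φ (j + 1)) ⬝ᵥ z
        = g ⬝ᵥ (φ.φ (j + 1) *ᵥ z - G.D (j + 1) *ᵥ v) + (g ᵥ* G.D (j + 1)) ⬝ᵥ v := by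
      rw [dotProduct_sub, Matrix.dotProduct_mulVec, Matrix.dotProduct_mulVec, sub_add_cancel]
    rw [this]
    exact Ideal.add_mem _ (dotProduct_mem _ hv) (dotProduct_mem' _ hg))
  exact ⟨ψ, by simpa using hψ⟩

theorem EK.dual {c : B} {I : Ideal B} (hI : MatrixCogenerator I) {F G : FreeComplex B}
    {φ : Hom F G} (h : EK c I φ) (z : Fin (F.r 1) → B) (hz : ∀ k, (F.D 0 *ᵥ z) k ∈ I) :
    ∃ v, ∀ k, (c • (φ.φ 1 *ᵥ z) - G.D 1 *ᵥ v) k ∈ I := by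
  let N : Submodule B (Fin (G.r 1) → B) :=
    { carrier := {w | ∃ v, ∀ k, (w - G.D 1 *ᵥ v) k ∈ I}
      zero_mem' := ⟨0, fun k => by simp⟩
      add_mem' := by
        rintro a b ⟨v, hv⟩ ⟨w, hw⟩
        refine ⟨v + w, fun k => ?_⟩
        have := Ideal.add_mem _ (hv k) (hw k)
        rw [Matrix.mulVec_add, add_sub_add_comm]
        exact this
      smul_mem' := by
        rintro b a ⟨v, hv⟩
        refine ⟨b • v, fun k => ?_⟩
        rw [Matrix.mulVec_smul, ← smul_sub]
        exact Ideal.mul_mem_left _ _ (hv k) }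
  by_contra hcon
  obtain ⟨g, hg, hgv⟩ := hI _ N (fun v hv => ⟨0, by simpa using hv⟩) (c • (φ.φ 1 *ᵥ z)) hcon
  obtain ⟨ψ, hψ⟩ := h 0 g (fun k => by
    have := hg (G.D 1 *ᵥ Pi.single k 1) ⟨Pi.single k 1, fun k => by simp⟩
    rwa [Matrix.dotProduct_mulVec, dotProduct_single, mul_one] at this)
  refine hgv ?_
  have : g ⬝ᵥ (c • (φ.φ 1 *ᵥ z)) = (c • (g ᵥ* φ.φ 1) - ψ ᵥ* F.D 0) ⬝ᵥ z
      + ψ ⬝ᵥ (F.D 0 *ᵥ z) := by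
    rw [sub_dotProduct, Matrix.dotProduct_mulVec ψ, sub_add_cancel, dotProduct_smul,
      smul_dotProduct, Matrix.dotProduct_mulVec]
  rw [this]
  exact Ideal.add_mem _ (dotProduct_mem' _ hψ) (dotProduct_mem _ hz)

theorem MatrixInjective.cogenerator [IsNoetherianRing B] [IsLocalRing B] {I : Ideal B}
    (hI : MatrixInjective I) {σ : B} (hσ : σ ∉ I)
    (hσm : ∀ b ∈ IsLocalRing.maximalIdeal B, σ * b ∈ I) : MatrixCogenerator I := by
  intro n N hN v hv
  obtain ⟨m, C, hC⟩ := Submodule.fg_iff_exists_fin_generating_family.1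
    (IsNoetherian.noetherian N)
  let D : Matrix (Fin n) (Fin (m + 1)) B := fun i => Fin.snoc (fun j => C j i) (v i)
  have hD : ∀ z : Fin (m + 1) → B, D *ᵥ z
      = ∑ j : Fin m, z (Fin.castSucc j) • C j + z (Fin.last m) • v := by
    intro z
    ext i
    simp [Matrix.mulVec, dotProduct, Fin.sum_univ_castSucc, D, Finset.sum_apply, mul_comm]
  obtain ⟨ψ, hψ⟩ := hI _ _ D (Pi.single (Fin.last m) σ) (fun z hz => by
    rw [single_dotProduct]
    refine hσm _ ?_
    rw [IsLocalRing.mem_maximalIdeal, mem_nonunits_iff]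
    intro hu
    have h1 := hN _ hz
    rw [hD] at h1
    have h2 : z (Fin.last m) • v ∈ N := by
      refine (Submodule.add_mem_iff_right N ?_).1 h1
      exact N.sum_mem fun j _ => N.smul_mem _ (hC ▸ Submodule.subset_span ⟨j, rfl⟩)
    obtain ⟨u, hu⟩ := hu
    rw [← hu] at h2
    exact hv ((Submodule.smul_mem_iff_of_isUnit N u.isUnit).1 h2))
  refine ⟨ψ, fun w hw => ?_, fun hcon => hσ ?_⟩
  · rw [← hC] at hw
    induction hw using Submodule.span_induction with
    | mem w hw =>
      obtain ⟨j, rfl⟩ := hw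
      have := hψ (Fin.castSucc j)
      rw [Pi.sub_apply, Pi.single_eq_of_ne (Fin.castSucc_lt_last j).ne, zero_sub,
        neg_mem_iff] at this
      simpa [Matrix.vecMul, D] using this
    | zero => simp
    | add a b _ _ ha hb => rw [dotProduct_add]; exact Ideal.add_mem _ ha hb
    | smul a b _ hb => rw [dotProduct_smul]; exact Ideal.mul_mem_left _ _ hb
  · have := hψ (Fin.last m)
    rw [Pi.sub_apply, Pi.single_eq_same] at this
    have h3 : (ψ ᵥ* D) (Fin.last m) = ψ ⬝ᵥ v := by simp [Matrix.vecMul, D]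
    rw [h3] at this
    exact (Submodule.sub_mem_iff_left I hcon).1 this

end FreeComplex

end

section

open Matrix

namespace FreeComplex

variable {B : Type*} [CommRing B] {ι : Type*}

/-- Colon relations for `x l` modulo `x i ^ t i`, `i ∈ J`, on the zeroth homology are killed by `c`
under the chain map. -/
def ColonKilled (c : B) (x : ι → B) (t : ι → ℕ) (J : Finset ι) (l : ι) {F G : FreeComplex B}
    (φ : Hom F G) : Prop :=
  ∀ (s : ℕ) (z : Fin (F.r 1) → B) (w : Fin (F.r 0) → B),
    (∀ k, (F.D 0 *ᵥ z - x l ^ s • w) k ∈ powIdeal x t J) →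
    ∃ v, ∀ k, (c • (φ.φ 0 *ᵥ w) - G.D 0 *ᵥ v) k ∈ powIdeal x t J

theorem TorZero.ladder [DecidableEq ι] {x : ι → B} (hx : PowRegular x) {t : ι → ℕ} {l : ι}
    {J : Finset ι} (hl : l ∉ J) {F G H K : FreeComplex B} {φ₁ : Hom F G} {φ₂ : Hom G H}
    {φ₃ : Hom H K} (h₁ : ColonKilled 1 x t J l φ₁) (h₂ : TorZero (powIdeal x t J) φ₂)
    (h₃ : TorZero (powIdeal x t J) φ₃) :
    TorZero (powIdeal x t (insert l J)) (φ₃.comp (φ₂.comp φ₁)) := by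
  intro j z hz
  obtain ⟨w, u, hu, hw⟩ := exists_of_mem_powIdeal_insert hz
  have key : ∃ v, ∀ k, (φ₂.φ j *ᵥ (φ₁.φ j *ᵥ w) - H.D j *ᵥ v) k ∈ powIdeal x t J := by
    cases j with
    | zero =>
      obtain ⟨v, hv⟩ := h₁ (t l) z w (by rw [hw]; simpa using hu)
      refine ⟨φ₂.φ 1 *ᵥ v, fun k => ?_⟩
      rw [Matrix.mulVec_mulVec v, φ₂.comm, ← Matrix.mulVec_mulVec, ← Matrix.mulVec_sub]
      exact mulVec_mem _ (by simpa using hv) k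
    | succ j =>
      refine h₂ j (φ₁.φ (j + 1) *ᵥ w) fun k => ?_
      rw [Matrix.mulVec_mulVec, φ₁.comm, ← Matrix.mulVec_mulVec]
      refine mulVec_mem _ (fun k => hx t J l hl (t l) _ ?_) k
      have h1 : F.D j *ᵥ (x l ^ t l • w + u) = 0 := by
        rw [← hw, Matrix.mulVec_mulVec, F.D_mul, Matrix.zero_mulVec]
      rw [Matrix.mulVec_add, Matrix.mulVec_smul] at h1
      have h2 := congrFun h1 k
      simp only [Pi.add_apply, Pi.smul_apply, smul_eq_mul, Pi.zero_apply] at h2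
      rw [eq_neg_of_add_eq_zero_left h2]
      exact neg_mem (mulVec_mem _ hu k)
  obtain ⟨v, hv⟩ := key
  obtain ⟨v', hv'⟩ := h₃ j (φ₂.φ (j + 1) *ᵥ (φ₁.φ (j + 1) *ᵥ z) - x l ^ t l • v) (by
    intro k
    have h3 : H.D j *ᵥ (φ₂.φ (j + 1) *ᵥ (φ₁.φ (j + 1) *ᵥ z) - x l ^ t l • v)
        = x l ^ t l • (φ₂.φ j *ᵥ (φ₁.φ j *ᵥ w) - H.D j *ᵥ v) + φ₂.φ j *ᵥ (φ₁.φ j *ᵥ u) := by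
      rw [Matrix.mulVec_sub, Matrix.mulVec_mulVec _ (H.D j), φ₂.comm, ← Matrix.mulVec_mulVec,
        Matrix.mulVec_mulVec z, φ₁.comm, ← Matrix.mulVec_mulVec, hw, Matrix.mulVec_add,
        Matrix.mulVec_add, Matrix.mulVec_smul, Matrix.mulVec_smul, Matrix.mulVec_smul, smul_sub]
      abel
    rw [h3]
    exact Ideal.add_mem _ (Ideal.mul_mem_left _ _ (hv k))
      (mulVec_mem _ (mulVec_mem _ hu) k))
  refine ⟨v', fun k => ?_⟩
  have h4 : (φ₃.comp (φ₂.comp φ₁)).φ (j + 1) *ᵥ z - K.D (j + 1) *ᵥ v'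
      = x l ^ t l • (φ₃.φ (j + 1) *ᵥ v) +
        (φ₃.φ (j + 1) *ᵥ (φ₂.φ (j + 1) *ᵥ (φ₁.φ (j + 1) *ᵥ z) - x l ^ t l • v)
          - K.D (j + 1) *ᵥ v') := by
    simp only [Hom.comp, ← Matrix.mulVec_mulVec, Matrix.mulVec_sub, Matrix.mulVec_smul]
    abel
  rw [h4]
  exact mem_powIdeal_insert (hv' k)

theorem TorZero.bot {F G : FreeComplex B} (φ : Hom F G) : TorZero ⊥ φ := by
  intro j z hz
  obtain ⟨w, rfl⟩ := F.ker_le j z (funext hz)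
  refine ⟨φ.φ (j + 2) *ᵥ w, fun k => ?_⟩
  rw [Matrix.mulVec_mulVec, Matrix.mulVec_mulVec, φ.comm, sub_self]
  exact Submodule.zero_mem _

theorem mem_of_forall_sub_mem_pow [IsNoetherianRing B] [IsLocalRing B] {n : ℕ}
    (N : Submodule B (Fin n → B)) (v : Fin n → B)
    (h : ∀ k : ℕ, ∃ u ∈ N, ∀ i, (v - u) i ∈ IsLocalRing.maximalIdeal B ^ k) : v ∈ N := by
  have h1 := Ideal.iInf_pow_smul_eq_bot_of_isLocalRing (M := (Fin n → B) ⧸ N)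
    (IsLocalRing.maximalIdeal B) (Ideal.IsPrime.ne_top inferInstance)
  rw [← Submodule.Quotient.mk_eq_zero N, ← Submodule.mem_bot (R := B), ← h1, Submodule.mem_iInf]
  intro k
  obtain ⟨u, hu, hvu⟩ := h k
  have h2 : (Submodule.Quotient.mk v : (Fin n → B) ⧸ N) = Submodule.Quotient.mk (v - u) := by
    rw [Submodule.Quotient.eq, sub_sub_cancel]
    exact hu
  rw [h2, ← Submodule.mkQ_apply, pi_eq_sum_univ' (v - u), map_sum]
  refine Submodule.sum_mem _ fun i _ => ?_
  rw [map_smul]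
  exact Submodule.smul_mem_smul (hvu i) trivial

/-- The column space of `D` plus vectors with entries in `I`. -/
def rangeSup {m n : ℕ} (D : Matrix (Fin m) (Fin n) B) (I : Ideal B) :
    Submodule B (Fin m → B) where
  carrier := {w | ∃ v, ∀ k, (w - D *ᵥ v) k ∈ I}
  zero_mem' := ⟨0, fun k => by simp⟩
  add_mem' := by
    rintro a b ⟨v, hv⟩ ⟨w, hw⟩
    refine ⟨v + w, fun k => ?_⟩
    have := Ideal.add_mem _ (hv k) (hw k)
    rw [Matrix.mulVec_add, add_sub_add_comm]
    exact this
  smul_mem' := by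
    rintro b a ⟨v, hv⟩
    refine ⟨b • v, fun k => ?_⟩
    rw [Matrix.mulVec_smul, ← smul_sub]
    exact Ideal.mul_mem_left _ _ (hv k)

theorem powIdeal_le_sup_pow {x : ι → B} {𝔪 : Ideal B} (hx : ∀ i, x i ∈ 𝔪) {t t' : ι → ℕ}
    {J J' : Finset ι} {k : ℕ} (h : ∀ i ∈ J', i ∈ J ∧ t i ≤ t' i ∨ k ≤ t' i) :
    powIdeal x t' J' ≤ powIdeal x t J ⊔ 𝔪 ^ k := by
  refine Ideal.span_le.2 ?_
  rintro _ ⟨i, hi, rfl⟩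
  rcases h i hi with ⟨hiJ, ht⟩ | hk
  · exact Ideal.mem_sup_left (Ideal.mem_of_dvd _ (pow_dvd_pow _ ht) (pow_mem_powIdeal x t hiJ))
  · exact Ideal.mem_sup_right (Ideal.pow_le_pow_right hk (Ideal.pow_mem_pow (hx i) _))

theorem ColonKilled.of_EK [DecidableEq ι] [Fintype ι] [IsNoetherianRing B] [IsLocalRing B]
    {x : ι → B} (hxm : ∀ i, x i ∈ IsLocalRing.maximalIdeal B) (hx : PowRegular x)
    (hcog : ∀ t, MatrixCogenerator (powIdeal x t Finset.univ)) {c : B} {F G : FreeComplex B}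
    {φ : Hom F G} (h : ∀ t, EK c (powIdeal x t Finset.univ) φ) (t : ι → ℕ) (J : Finset ι) (l : ι)
    (hl : l ∉ J) : ColonKilled c x t J l φ := by
  intro s z w hrel
  suffices c • (φ.φ 0 *ᵥ w) ∈ rangeSup (G.D 0) (powIdeal x t J) from this
  refine mem_of_forall_sub_mem_pow _ _ fun k => ?_
  let t' : ι → ℕ := fun i => if i = l then s else if i ∈ J then t i else k
  have ht'l : t' l = s := if_pos rfl
  have ht' : ∀ i ∈ J, t' i = t i := fun i hi => by
    simp only [t', hi, if_true]; exact if_neg (by rintro rfl; exact hl hi)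
  have huniv : (Finset.univ : Finset ι) = insert l (Finset.univ.erase l) :=
    (Finset.insert_erase (Finset.mem_univ l)).symm
  have hJ : powIdeal x t J ≤ powIdeal x t' (Finset.univ.erase l) := by
    rw [powIdeal_congr (t' := t') fun i hi => (ht' i hi).symm]
    exact powIdeal_mono fun i hi => Finset.mem_erase.2
      ⟨by rintro rfl; exact hl hi, Finset.mem_univ _⟩
  obtain ⟨v, hv⟩ := (h t').dual (hcog t') z (fun k => by
    rw [huniv]
    have := mem_powIdeal_insert (l := l) (a := w k) (hJ (hrel k))
    rw [ht'l] at this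
    simpa using this)
  rw [huniv] at hv
  obtain ⟨a, u, hu, hau⟩ := exists_of_mem_powIdeal_insert hv
  rw [ht'l] at hau
  have h1 : ∀ k, (c • (φ.φ 0 *ᵥ w) - G.D 0 *ᵥ a) k ∈ powIdeal x t' (Finset.univ.erase l) := by
    intro k
    refine hx t' _ l (Finset.notMem_erase _ _) s _ ?_
    have h2 : x l ^ s • (c • (φ.φ 0 *ᵥ w) - G.D 0 *ᵥ a)
        = G.D 0 *ᵥ u - c • (φ.φ 0 *ᵥ (F.D 0 *ᵥ z - x l ^ s • w)) := by
      have h3 := congrArg (G.D 0 *ᵥ ·) hau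
      simp only [Matrix.mulVec_sub, Matrix.mulVec_smul, Matrix.mulVec_mulVec, Matrix.mulVec_add,
        G.D_mul, Matrix.zero_mulVec, sub_zero, φ.comm] at h3
      rw [Matrix.mulVec_sub, Matrix.mulVec_smul, smul_sub, smul_sub, Matrix.mulVec_mulVec, h3,
        smul_comm c]
      abel
    have h4 := congrFun h2 k
    rw [Pi.smul_apply, smul_eq_mul] at h4
    rw [h4]
    exact Ideal.sub_mem _ (mulVec_mem _ hu k)
      (Ideal.mul_mem_left _ _ (mulVec_mem _ (fun k => hJ (hrel k)) k))
  have h5 : ∀ k', ∃ b ∈ powIdeal x t J, ∃ m ∈ IsLocalRing.maximalIdeal B ^ k,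
      b + m = (c • (φ.φ 0 *ᵥ w) - G.D 0 *ᵥ a) k' := by
    intro k'
    refine Submodule.mem_sup.1 (powIdeal_le_sup_pow hxm (fun i hi => ?_) (h1 k'))
    have hil : i ≠ l := Finset.ne_of_mem_erase hi
    by_cases hiJ : i ∈ J
    · exact Or.inl ⟨hiJ, (ht' i hiJ).ge⟩
    · right
      simp [t', hil, hiJ]
  choose b hb m hm hbm using h5
  refine ⟨G.D 0 *ᵥ a + b, ⟨a, fun k => by simpa using hb k⟩, fun i => ?_⟩
  have : (c • (φ.φ 0 *ᵥ w) - (G.D 0 *ᵥ a + b)) i = m i := by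
    rw [← sub_sub, Pi.sub_apply, ← hbm i, add_sub_cancel_left]
  rw [this]
  exact hm i

theorem EK.bot_of_forall [Fintype ι] [IsNoetherianRing B] [IsLocalRing B]
    {x : ι → B} (hxm : ∀ i, x i ∈ IsLocalRing.maximalIdeal B) {c : B} {F G : FreeComplex B}
    {φ : Hom F G} (h : ∀ t, EK c (powIdeal x t Finset.univ) φ) : EK c ⊥ φ := by
  intro j g hg
  have h1 : c • (g ᵥ* φ.φ (j + 1)) ∈ rangeSup (F.D j)ᵀ ⊥ := by
    refine mem_of_forall_sub_mem_pow _ _ fun k => ?_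
    obtain ⟨ψ, hψ⟩ := h (fun _ => k) j g (fun i => by
      rw [(Submodule.mem_bot B).1 (hg i)]; exact Ideal.zero_mem _)
    refine ⟨ψ ᵥ* F.D j, ⟨ψ, fun i => by simp [Matrix.mulVec_transpose]⟩, fun i => ?_⟩
    have := powIdeal_le_sup_pow (J := ∅) (t := 0) (k := k) hxm (fun i _ => Or.inr le_rfl) (hψ i)
    rwa [powIdeal_empty, bot_sup_eq] at this
  obtain ⟨ψ, hψ⟩ := h1
  exact ⟨ψ, by simpa [Matrix.mulVec_transpose] using hψ⟩

end FreeComplex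

end

section

open Matrix

/-- A based free resolution of a finitely generated submodule of `Ω`. -/
structure FreeResolution (A Ω : Type*) [CommRing A] [AddCommGroup Ω] [Module A Ω]
    extends FreeComplex A where
  /-- the augmentation -/
  e : Fin (r 0) → Ω
  e_exact : ∀ v : Fin (r 0) → A, ∑ i, v i • e i = 0 ↔ ∃ w, v = D 0 *ᵥ w

namespace FreeResolution

section General

variable {A Ω : Type*} [CommRing A] [AddCommGroup Ω] [Module A Ω]

/-- The resolved submodule. -/
def range (F : FreeResolution A Ω) : Submodule A Ω := Submodule.span A (Set.range F.e)

theorem mem_range {F : FreeResolution A Ω} {y : Ω} :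
    y ∈ F.range ↔ ∃ v : Fin (F.r 0) → A, ∑ i, v i • F.e i = y :=
  Submodule.mem_span_range_iff_exists_fun A

/-- A matrix whose columns generate the kernel of a linear map. -/
theorem exists_matrix_ker [IsNoetherianRing A] {n : ℕ} {M : Type*} [AddCommGroup M] [Module A M]
    (f : (Fin n → A) →ₗ[A] M) :
    ∃ (m : ℕ) (D : Matrix (Fin n) (Fin m) A), ∀ v, f v = 0 ↔ ∃ w, v = D *ᵥ w := by
  obtain ⟨m, C, hC⟩ := Submodule.fg_iff_exists_fin_generating_family.1
    (IsNoetherian.noetherian (LinearMap.ker f))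
  refine ⟨m, fun i j => C j i, fun v => ?_⟩
  rw [← LinearMap.mem_ker, ← hC, Submodule.mem_span_range_iff_exists_fun]
  have : ∀ w : Fin m → A, (Matrix.of fun i j => C j i) *ᵥ w = ∑ j, w j • C j := by
    intro w
    ext i
    simp [Matrix.mulVec, dotProduct, Finset.sum_apply, mul_comm]
  constructor
  · rintro ⟨w, rfl⟩; exact ⟨w, (this w).symm⟩
  · rintro ⟨w, rfl⟩; exact ⟨w, (this w).symm⟩

theorem exists_range_eq [IsNoetherianRing A] (M : Submodule A Ω) (hM : M.FG) :
    ∃ F : FreeResolution A Ω, F.range = M := by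
  obtain ⟨n, e, he⟩ := Submodule.fg_iff_exists_fin_generating_family.1 hM
  obtain ⟨m₀, D₀, hD₀⟩ := exists_matrix_ker (Fintype.linearCombination A e)
  choose m D hD using fun (X : Σ p : ℕ × ℕ, Matrix (Fin p.1) (Fin p.2) A) =>
    exists_matrix_ker (Matrix.mulVecLin X.2)
  let step : (Σ p : ℕ × ℕ, Matrix (Fin p.1) (Fin p.2) A) →
    (Σ p : ℕ × ℕ, Matrix (Fin p.1) (Fin p.2) A) := fun X => ⟨(X.1.2, m X), D X⟩
  let Y : ℕ → (Σ p : ℕ × ℕ, Matrix (Fin p.1) (Fin p.2) A) := fun j =>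
    Nat.rec ⟨(n, m₀), D₀⟩ (fun _ X => step X) j
  have hex : ∀ j v, (Y j).2 *ᵥ v = 0 ↔ ∃ w, v = (Y (j + 1)).2 *ᵥ w := fun j => hD (Y j)
  refine ⟨{
    r := fun j => (Y j).1.1
    D := fun j => (Y j).2
    D_mul := fun j => ?_
    ker_le := fun j v hv => (hex j v).1 hv
    e := e
    e_exact := fun v => ?_ }, he⟩
  · ext i k
    have h1 := (hex j ((Y (j + 1)).2 *ᵥ Pi.single k 1)).2 ⟨_, rfl⟩
    rw [Matrix.mulVec_mulVec] at h1
    have h2 := congrFun h1 i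
    rw [Matrix.mulVec_single_one] at h2
    exact h2
  · have := hD₀ v
    rwa [Fintype.linearCombination_apply] at this

/-- A chain map compatible with the augmentations. -/
def IsLift {F G : FreeResolution A Ω} (φ : FreeComplex.Hom F.toFreeComplex G.toFreeComplex) :
    Prop :=
  ∀ v : Fin (F.r 0) → A, ∑ i, (φ.φ 0 *ᵥ v) i • G.e i = ∑ i, v i • F.e i

theorem exists_matrix_of_forall {m n k : ℕ} (D : Matrix (Fin m) (Fin n) A)
    (P : Matrix (Fin m) (Fin k) A) (h : ∀ i, ∃ w, P *ᵥ Pi.single i 1 = D *ᵥ w) :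
    ∃ X, D * X = P := by
  choose w hw using h
  refine ⟨fun a i => w i a, ?_⟩
  ext a i
  have := congrFun (hw i) a
  rw [Matrix.mulVec_single_one] at this
  exact this.symm

theorem exists_lift (F G : FreeResolution A Ω) (h : F.range ≤ G.range) :
    ∃ φ : FreeComplex.Hom F.toFreeComplex G.toFreeComplex, IsLift φ := by
  have h0 : ∃ φ₀ : Matrix (Fin (G.r 0)) (Fin (F.r 0)) A,
      ∀ v : Fin (F.r 0) → A, ∑ i, (φ₀ *ᵥ v) i • G.e i = ∑ i, v i • F.e i := by
    have : ∀ i, ∃ v : Fin (G.r 0) → A, ∑ k, v k • G.e k = F.e i := fun i =>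
      mem_range.1 (h (Submodule.subset_span ⟨i, rfl⟩))
    choose v hv using this
    refine ⟨fun k i => v i k, fun w => ?_⟩
    simp only [Matrix.mulVec, dotProduct, Finset.sum_smul]
    rw [Finset.sum_comm]
    refine Finset.sum_congr rfl fun i _ => ?_
    rw [← hv i, Finset.smul_sum]
    exact Finset.sum_congr rfl fun k _ => by rw [smul_smul, mul_comm]
  obtain ⟨φ₀, hφ₀⟩ := h0
  have h1 : ∃ φ₁, G.D 0 * φ₁ = φ₀ * F.D 0 := by
    refine exists_matrix_of_forall _ _ fun i => (G.e_exact _).1 ?_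
    rw [← Matrix.mulVec_mulVec, hφ₀]
    exact (F.e_exact _).2 ⟨_, rfl⟩
  have hstep : ∀ j (φ : Matrix (Fin (G.r j)) (Fin (F.r j)) A)
      (φ' : Matrix (Fin (G.r (j + 1))) (Fin (F.r (j + 1))) A),
      G.D j * φ' = φ * F.D j → ∃ φ'' : Matrix (Fin (G.r (j + 2))) (Fin (F.r (j + 2))) A,
        G.D (j + 1) * φ'' = φ' * F.D (j + 1) := by
    intro j φ φ' hφ
    refine exists_matrix_of_forall _ _ fun i => G.ker_le j _ ?_
    rw [Matrix.mulVec_mulVec, ← Matrix.mul_assoc, hφ, Matrix.mul_assoc, F.D_mul, Matrix.mul_zero,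
      Matrix.zero_mulVec]
  let T : ℕ → Type _ := fun j => {p : Matrix (Fin (G.r j)) (Fin (F.r j)) A ×
    Matrix (Fin (G.r (j + 1))) (Fin (F.r (j + 1))) A // G.D j * p.2 = p.1 * F.D j}
  let Y : ∀ j, T j := fun j => Nat.rec (motive := T) ⟨(φ₀, h1.choose), h1.choose_spec⟩
    (fun j p => ⟨(p.1.2, (hstep j _ _ p.2).choose), (hstep j _ _ p.2).choose_spec⟩) j
  exact ⟨{ φ := fun j => (Y j).1.1, comm := fun j => (Y j).2 }, hφ₀⟩

theorem IsLift.comp {F G H : FreeResolution A Ω}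
    {φ' : FreeComplex.Hom G.toFreeComplex H.toFreeComplex}
    {φ : FreeComplex.Hom F.toFreeComplex G.toFreeComplex} (h' : IsLift φ') (h : IsLift φ) :
    IsLift (φ'.comp φ) := fun v => by
  simp only [FreeComplex.Hom.comp]
  rw [← Matrix.mulVec_mulVec, h', h]

end General

end FreeResolution

end

section

open Matrix

section BaseChange

variable {A B : Type*} [CommRing A] [CommRing B] [Algebra A B] (M : Submonoid A)
  [IsLocalization M B]

theorem exists_smul_eq_map {n : ℕ} (v : Fin n → B) :
    ∃ m ∈ M, ∃ v' : Fin n → A, algebraMap A B m • v = algebraMap A B ∘ v' := by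
  obtain ⟨m, hm⟩ := IsLocalization.exist_integer_multiples_of_finite M v
  choose v' hv' using hm
  refine ⟨m, m.2, v', funext fun i => ?_⟩
  simp only [Function.comp, Pi.smul_apply, smul_eq_mul, hv', Algebra.smul_def]

theorem exists_smul_eq_zero_of_map_eq_zero {n : ℕ} (v : Fin n → A)
    (h : algebraMap A B ∘ v = 0) : ∃ m ∈ M, m • v = 0 := by
  have : ∀ i, ∃ m : M, (m : A) * v i = 0 := fun i =>
    (IsLocalization.map_eq_zero_iff M B (v i)).1 (congrFun h i)
  choose m hm using this
  refine ⟨∏ i, (m i : A), M.prod_mem fun i _ => (m i).2, funext fun i => ?_⟩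
  rw [Pi.smul_apply, smul_eq_mul, ← Finset.prod_erase_mul _ _ (Finset.mem_univ i), mul_assoc, hm,
    mul_zero, Pi.zero_apply]

theorem map_comp_mulVec {m n : ℕ} (D : Matrix (Fin m) (Fin n) A) (v : Fin n → A) :
    D.map (algebraMap A B) *ᵥ (algebraMap A B ∘ v) = algebraMap A B ∘ (D *ᵥ v) :=
  funext fun i => (RingHom.map_mulVec (algebraMap A B) D v i).symm

theorem map_comp_vecMul {m n : ℕ} (D : Matrix (Fin m) (Fin n) A) (v : Fin m → A) :
    (algebraMap A B ∘ v) ᵥ* D.map (algebraMap A B) = algebraMap A B ∘ (v ᵥ* D) :=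
  funext fun i => (RingHom.map_vecMul (algebraMap A B) D v i).symm

theorem eq_of_smul_eq_smul {E : Type*} [AddCommGroup E] [Module B E] {m : A} (hm : m ∈ M) {v w : E}
    (h : algebraMap A B m • v = algebraMap A B m • w) : v = w :=
  (IsLocalization.map_units B ⟨m, hm⟩).smul_left_cancel.1 h

theorem exists_eq_smul_of_mem {E : Type*} [AddCommGroup E] [Module B E] {m : A} (hm : m ∈ M)
    (v : E) : ∃ w : E, v = algebraMap A B m • w := by
  obtain ⟨u, hu⟩ := IsLocalization.map_units B ⟨m, hm⟩
  exact ⟨(↑u⁻¹ : B) • v, by rw [← hu, smul_smul, Units.mul_inv, one_smul]⟩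

variable (B)

/-- Localization of an exact complex of free modules. -/
@[reducible] def FreeComplex.map (F : FreeComplex A) : FreeComplex B where
  r := F.r
  D j := (F.D j).map (algebraMap A B)
  D_mul j := by
    rw [← Matrix.map_mul, F.D_mul, Matrix.map_zero _ (map_zero _)]
  ker_le j v hv := by
    obtain ⟨m, hm, v', hv'⟩ := exists_smul_eq_map M v
    obtain ⟨m', hm', h⟩ := exists_smul_eq_zero_of_map_eq_zero M (F.D j *ᵥ v') (B := B) (by
      rw [← map_comp_mulVec, ← hv', Matrix.mulVec_smul, hv, smul_zero])
    obtain ⟨w, hw⟩ := F.ker_le j (m' • v') (by rw [Matrix.mulVec_smul, h])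
    obtain ⟨u, hu⟩ := exists_eq_smul_of_mem (B := B) M (M.mul_mem hm' hm) (algebraMap A B ∘ w)
    refine ⟨u, eq_of_smul_eq_smul (B := B) M (M.mul_mem hm' hm) ?_⟩
    rw [← Matrix.mulVec_smul, ← hu, map_comp_mulVec, ← hw, map_mul, mul_smul, hv']
    ext i
    simp

/-- Localization of chain maps. -/
@[reducible] def FreeComplex.Hom.map {F G : FreeComplex A} (φ : FreeComplex.Hom F G) :
    FreeComplex.Hom (F.map B M) (G.map B M) where
  φ j := (φ.φ j).map (algebraMap A B)
  comm j := by
    have := congrArg (fun X => X.map (algebraMap A B)) (φ.comm j)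
    simpa only [Matrix.map_mul] using this

theorem FreeComplex.Hom.map_comp {F G H : FreeComplex A} (φ' : FreeComplex.Hom G H)
    (φ : FreeComplex.Hom F G) : (φ'.comp φ).map B M = (φ'.map B M).comp (φ.map B M) := by
  simp only [FreeComplex.Hom.map, FreeComplex.Hom.comp, Matrix.map_mul]

theorem FreeComplex.EK.map {F G : FreeComplex A} {φ : FreeComplex.Hom F G} {c : A}
    (h : FreeComplex.EK c ⊥ φ) : FreeComplex.EK (algebraMap A B c) ⊥ (φ.map B M) := by
  intro j (g : Fin (G.r (j + 1)) → B) hg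
  have hg0 : g ᵥ* (G.D (j + 1)).map (algebraMap A B) = 0 := funext hg
  obtain ⟨m, hm, g', hg'⟩ := exists_smul_eq_map M g
  obtain ⟨m', hm', h'⟩ := exists_smul_eq_zero_of_map_eq_zero M (g' ᵥ* G.D (j + 1)) (B := B) (by
    rw [← map_comp_vecMul, ← hg', Matrix.smul_vecMul, hg0, smul_zero])
  obtain ⟨ψ, hψ⟩ := h j (m' • g') (fun k => by rw [Matrix.smul_vecMul, h']; exact zero_mem _)
  have hψ' : c • ((m' • g') ᵥ* φ.φ (j + 1)) = ψ ᵥ* F.D j := funext fun k => sub_eq_zero.1 (hψ k)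
  obtain ⟨u, hu⟩ := exists_eq_smul_of_mem (B := B) M (M.mul_mem hm' hm) (algebraMap A B ∘ ψ)
  refine ⟨u, fun k => ?_⟩
  refine (Submodule.mem_bot B).2 (sub_eq_zero.2 (congrFun (?_ :
    algebraMap A B c • (g ᵥ* (φ.φ (j + 1)).map (algebraMap A B))
      = u ᵥ* (F.D j).map (algebraMap A B)) k))
  refine eq_of_smul_eq_smul (B := B) M (M.mul_mem hm' hm) ?_
  have h3 : algebraMap A B (m' * m) • g = algebraMap A B ∘ (m' • g') := by
    rw [map_mul, mul_smul, hg']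
    ext i
    simp
  rw [smul_comm, ← Matrix.smul_vecMul _ g, ← Matrix.smul_vecMul _ u, ← hu, map_comp_vecMul, ← hψ',
    h3, map_comp_vecMul]
  ext i
  simp

theorem FreeComplex.EK.exists_of_map [IsNoetherianRing A] {F G : FreeComplex A}
    {φ : FreeComplex.Hom F G} (h : FreeComplex.EK 1 ⊥ (φ.map B M)) (n : ℕ)
    (hn : ∀ j ≥ n, ∀ g : Fin (G.r (j + 1)) → A, g ᵥ* G.D (j + 1) = 0 → ∃ ψ, g = ψ ᵥ* G.D j) :
    ∃ c ∈ M, FreeComplex.EK c ⊥ φ := by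
  have h1 : ∀ j (g : Fin (G.r (j + 1)) → A), g ᵥ* G.D (j + 1) = 0 →
      ∃ c ∈ M, ∃ ψ, c • (g ᵥ* φ.φ (j + 1)) = ψ ᵥ* F.D j := by
    intro j g hg
    obtain ⟨ψ, hψ⟩ := h j (algebraMap A B ∘ g) (fun k => (Submodule.mem_bot B).2 (congrFun
      (by rw [map_comp_vecMul, hg]; ext; simp :
        (algebraMap A B ∘ g) ᵥ* (G.map B M).D (j + 1) = 0) k))
    have hψ' : (algebraMap A B ∘ g) ᵥ* (φ.φ (j + 1)).map (algebraMap A B)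
        = ψ ᵥ* (F.D j).map (algebraMap A B) := by
      funext k
      have := sub_eq_zero.1 (hψ k)
      rwa [one_smul] at this
    obtain ⟨m, hm, ψ', hψm⟩ := exists_smul_eq_map M ψ
    obtain ⟨m', hm', h'⟩ := exists_smul_eq_zero_of_map_eq_zero M
      (m • (g ᵥ* φ.φ (j + 1)) - ψ' ᵥ* F.D j) (B := B) (by
        rw [map_comp_vecMul] at hψ'
        have h3 : algebraMap A B ∘ (m • (g ᵥ* φ.φ (j + 1)))
            = algebraMap A B ∘ (ψ' ᵥ* F.D j) := by
          rw [← map_comp_vecMul, ← hψm, Matrix.smul_vecMul, ← hψ']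
          ext; simp
        funext k
        have := congrFun h3 k
        simp only [Function.comp] at this ⊢
        rw [Pi.sub_apply, map_sub, this, sub_self, Pi.zero_apply])
    refine ⟨m' * m, M.mul_mem hm' hm, m' • ψ', ?_⟩
    rw [Matrix.smul_vecMul, mul_smul]
    exact sub_eq_zero.1 (by rw [← smul_sub, h'])
  have h2 : ∀ j, ∃ c ∈ M, ∀ g : Fin (G.r (j + 1)) → A, g ᵥ* G.D (j + 1) = 0 →
      ∃ ψ, c • (g ᵥ* φ.φ (j + 1)) = ψ ᵥ* F.D j := by
    intro j
    obtain ⟨k, C, hC⟩ := Submodule.fg_iff_exists_fin_generating_family.1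
      (IsNoetherian.noetherian (LinearMap.ker (Matrix.vecMulLinear (G.D (j + 1)))))
    have hCk : ∀ i, C i ᵥ* G.D (j + 1) = 0 := fun i => by
      have : C i ∈ LinearMap.ker (Matrix.vecMulLinear (G.D (j + 1))) :=
        hC ▸ Submodule.subset_span ⟨i, rfl⟩
      simpa using this
    choose c hc ψ hψ using fun i => h1 j (C i) (hCk i)
    refine ⟨∏ i, c i, M.prod_mem fun i _ => hc i, fun g hg => ?_⟩
    have : g ∈ Submodule.span A (Set.range C) := by
      rw [hC]; simpa using hg
    obtain ⟨a, rfl⟩ := (Submodule.mem_span_range_iff_exists_fun A).1 this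
    refine ⟨∑ i, (a i * ∏ i' ∈ Finset.univ.erase i, c i') • ψ i, ?_⟩
    rw [Matrix.sum_vecMul, Matrix.sum_vecMul, Finset.smul_sum]
    refine Finset.sum_congr rfl fun i _ => ?_
    rw [Matrix.smul_vecMul, Matrix.smul_vecMul, ← hψ, smul_smul, smul_smul,
      ← Finset.prod_erase_mul _ _ (Finset.mem_univ i)]
    congr 1
    ring
  choose c hc hψ using h2
  refine ⟨∏ j ∈ Finset.range n, c j, M.prod_mem fun i _ => hc i, fun j g hg => ?_⟩
  have hg0 : g ᵥ* G.D (j + 1) = 0 := funext hg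
  suffices ∃ ψ, (∏ j ∈ Finset.range n, c j) • (g ᵥ* φ.φ (j + 1)) = ψ ᵥ* F.D j by
    obtain ⟨ψ, h⟩ := this
    exact ⟨ψ, fun k => by rw [h, sub_self]; exact zero_mem _⟩
  rcases lt_or_ge j n with hj | hj
  · obtain ⟨ψ, h⟩ := hψ j g hg0
    refine ⟨(∏ i ∈ (Finset.range n).erase j, c i) • ψ, ?_⟩
    rw [← Finset.prod_erase_mul _ _ (Finset.mem_range.2 hj), mul_smul, h, Matrix.smul_vecMul]
  · obtain ⟨ψ, rfl⟩ := hn j hj g hg0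
    refine ⟨(∏ j ∈ Finset.range n, c j) • (ψ ᵥ* φ.φ j), ?_⟩
    rw [Matrix.vecMul_vecMul, φ.comm, ← Matrix.vecMul_vecMul, Matrix.smul_vecMul]

variable {Ω : Type*} [AddCommGroup Ω] [Module A Ω] [Module B Ω] [IsScalarTower A B Ω]

theorem smul_sum_smul {n : ℕ} (b : B) (v : Fin n → B) (e : Fin n → Ω) :
    b • ∑ i, v i • e i = ∑ i, (b • v) i • e i := by
  rw [Finset.smul_sum]
  exact Finset.sum_congr rfl fun i _ => by rw [Pi.smul_apply, smul_assoc]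

theorem sum_map_smul {n : ℕ} (v : Fin n → A) (e : Fin n → Ω) :
    ∑ i, (algebraMap A B ∘ v) i • e i = ∑ i, v i • e i :=
  Finset.sum_congr rfl fun i _ => by rw [Function.comp, algebraMap_smul]

/-- Localization of free resolutions of submodules of a fixed module. -/
@[reducible] def FreeResolution.map (F : FreeResolution A Ω) : FreeResolution B Ω where
  toFreeComplex := F.toFreeComplex.map B M
  e := F.e
  e_exact v := by
    constructor
    · intro h
      obtain ⟨m, hm, v', hv'⟩ := exists_smul_eq_map M v
      obtain ⟨w, hw⟩ := (F.e_exact v').1 (by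
        rw [← sum_map_smul B, ← hv', ← smul_sum_smul, h, smul_zero])
      obtain ⟨u, hu⟩ := exists_eq_smul_of_mem (B := B) M hm (algebraMap A B ∘ w)
      refine ⟨u, eq_of_smul_eq_smul (B := B) M hm ?_⟩
      rw [← Matrix.mulVec_smul, ← hu, hv', hw]
      exact (map_comp_mulVec _ _).symm
    · rintro ⟨w, rfl⟩
      obtain ⟨m, hm, w', hw'⟩ := exists_smul_eq_map M w
      refine eq_of_smul_eq_smul (B := B) M hm ?_
      rw [smul_zero, smul_sum_smul, ← Matrix.mulVec_smul, hw', map_comp_mulVec, sum_map_smul]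
      exact (F.e_exact _).2 ⟨_, rfl⟩

theorem FreeResolution.IsLift.map {F G : FreeResolution A Ω}
    {φ : FreeComplex.Hom F.toFreeComplex G.toFreeComplex} (h : FreeResolution.IsLift φ) :
    FreeResolution.IsLift (F := F.map B M) (G := G.map B M) (φ.map B M) := by
  intro (v : Fin (F.r 0) → B)
  obtain ⟨m, hm, v', hv'⟩ := exists_smul_eq_map M v
  refine eq_of_smul_eq_smul (B := B) M hm ?_
  rw [smul_sum_smul, smul_sum_smul, ← Matrix.mulVec_smul, hv', map_comp_mulVec, sum_map_smul,
    sum_map_smul]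
  exact h v'

end BaseChange

end

section

open Matrix

namespace FreeResolution

section Relations

variable {B Ω : Type*} [CommRing B] [AddCommGroup Ω] [Module B Ω]

theorem mem_smul_range {F : FreeResolution B Ω} {I : Ideal B} {y : Ω} :
    y ∈ I • F.range ↔ ∃ u : Fin (F.r 0) → B, (∀ k, u k ∈ I) ∧ ∑ i, u i • F.e i = y := by
  rw [range, Submodule.mem_ideal_smul_span_iff_exists_sum]
  constructor
  · rintro ⟨a, ha, rfl⟩
    refine ⟨a, ha, ?_⟩
    rw [Finsupp.sum_fintype _ _ (by simp)]
  · rintro ⟨u, hu, rfl⟩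
    refine ⟨Finsupp.equivFunOnFinite.symm u, hu, ?_⟩
    rw [Finsupp.sum_fintype _ _ (by simp)]
    rfl

theorem sum_sub_smul {n : ℕ} (v w : Fin n → B) (e : Fin n → Ω) :
    ∑ i, (v - w) i • e i = ∑ i, v i • e i - ∑ i, w i • e i := by
  rw [← Finset.sum_sub_distrib]
  exact Finset.sum_congr rfl fun i _ => by rw [Pi.sub_apply, sub_smul]

theorem sum_smul_smul {n : ℕ} (b : B) (v : Fin n → B) (e : Fin n → Ω) :
    ∑ i, (b • v) i • e i = b • ∑ i, v i • e i := by
  rw [Finset.smul_sum]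
  exact Finset.sum_congr rfl fun i _ => by rw [Pi.smul_apply, smul_assoc]

theorem smul_mem_of_colonKilled {ι : Type*} {c : B} {x : ι → B} {t : ι → ℕ} {J : Finset ι} {l : ι}
    {F G : FreeResolution B Ω} {φ : FreeComplex.Hom F.toFreeComplex G.toFreeComplex}
    (hφ : IsLift φ) (h : FreeComplex.ColonKilled c x t J l φ) {s : ℕ} {w : Ω} (hw : w ∈ F.range)
    (hrel : x l ^ s • w ∈ powIdeal x t J • F.range) : c • w ∈ powIdeal x t J • G.range := by
  obtain ⟨v, rfl⟩ := mem_range.1 hw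
  obtain ⟨u, hu, huv⟩ := mem_smul_range.1 hrel
  obtain ⟨z, hz⟩ := (F.e_exact (x l ^ s • v - u)).1 (by
    rw [sum_sub_smul, sum_smul_smul, huv, sub_self])
  obtain ⟨v', hv'⟩ := h s z v (fun k => by
    rw [← hz, sub_sub_cancel_left]; exact neg_mem (hu k))
  refine mem_smul_range.2 ⟨_, hv', ?_⟩
  rw [sum_sub_smul, sum_smul_smul, hφ, (G.e_exact _).2 ⟨v', rfl⟩, sub_zero]

theorem colonKilled_of_forall {ι : Type*} {x : ι → B} {t : ι → ℕ} {J : Finset ι} {l : ι}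
    {F G : FreeResolution B Ω} {φ : FreeComplex.Hom F.toFreeComplex G.toFreeComplex}
    (hφ : IsLift φ) (h : ∀ (s : ℕ), ∀ w ∈ F.range, x l ^ s • w ∈ powIdeal x t J • F.range →
      w ∈ powIdeal x t J • G.range) : FreeComplex.ColonKilled 1 x t J l φ := by
  intro s z v hz
  have h1 := h s _ (mem_range.2 ⟨v, rfl⟩) (mem_smul_range.2
    ⟨-(F.D 0 *ᵥ z - x l ^ s • v), fun k => neg_mem (hz k), by
      rw [neg_sub, sum_sub_smul, (F.e_exact _).2 ⟨z, rfl⟩, sub_zero, sum_smul_smul]⟩)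
  obtain ⟨u, hu, huv⟩ := mem_smul_range.1 h1
  obtain ⟨v', hv'⟩ := (G.e_exact (φ.φ 0 *ᵥ v - u)).1 (by rw [sum_sub_smul, hφ, huv, sub_self])
  refine ⟨v', fun k => ?_⟩
  rw [one_smul, ← hv', sub_sub_cancel]
  exact hu k

end Relations

/-- The resolved submodule is a subalgebra. -/
def IsSub {A Ω : Type*} [CommRing A] [Field Ω] [Algebra A Ω] (F : FreeResolution A Ω) : Prop :=
  ∃ S : Subalgebra A Ω, F.range = S.toSubmodule

/-- The positive Ext modules of finite subalgebras into the base are killed by elements outside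
`Q`, after enlarging the subalgebra. -/
def ExtAnnihilated (A Ω : Type*) [CommRing A] [Field Ω] [Algebra A Ω] (Q : Ideal A) : Prop :=
  ∀ F : FreeResolution A Ω, F.IsSub → ∃ G : FreeResolution A Ω, G.IsSub ∧ F.range ≤ G.range ∧
    ∃ φ : FreeComplex.Hom F.toFreeComplex G.toFreeComplex, IsLift φ ∧
      ∃ c ∉ Q, FreeComplex.EK c ⊥ φ

section Ladder

variable {A B Ω : Type*} [CommRing A] [CommRing B] [Algebra A B] [Field Ω] [Algebra A Ω]
  [Algebra B Ω] [IsScalarTower A B Ω] (M : Submonoid A) [IsLocalization M B]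

theorem range_map (F : FreeResolution A Ω) {S : Subalgebra A Ω} (hF : F.range = S.toSubmodule) :
    (F.map B M).range = (Algebra.adjoin B (S : Set Ω)).toSubmodule := by
  have h1 : (F.map B M).range = Submodule.span B (Set.range F.e) := rfl
  have h2 : (Submonoid.closure (S : Set Ω) : Set Ω) = S :=
    congrArg SetLike.coe (Submonoid.closure_eq S.toSubmonoid)
  rw [h1, Algebra.adjoin_eq_span, h2, ← Submodule.span_span_of_tower A B (Set.range F.e)]
  congr 1
  exact congrArg SetLike.coe hF

theorem range_fg {R N : Type*} [CommRing R] [AddCommGroup N] [Module R N]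
    (F : FreeResolution R N) : F.range.FG :=
  Submodule.fg_span (Set.finite_range _)

theorem exists_le_adjoin (M : Submonoid A) [IsLocalization M B] (T : Subalgebra B Ω) (hT : T.toSubmodule.FG) (S : Subalgebra A Ω)
    (hS : S.toSubmodule.FG) : ∃ S' : Subalgebra A Ω, S ≤ S' ∧ S'.toSubmodule.FG ∧
      T ≤ Algebra.adjoin B (S' : Set Ω) := by
  classical
  obtain ⟨n, y, hy⟩ := Submodule.fg_iff_exists_fin_generating_family.1 hT
  have h1 : ∀ i, ∃ m : M, IsIntegral A ((m : A) • y i) := fun i => by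
    have : IsIntegral B (y i) := isIntegral_of_mem_fg hT (by
      have : y i ∈ T.toSubmodule := hy ▸ Submodule.subset_span ⟨i, rfl⟩
      exact this)
    obtain ⟨m, hm⟩ := this.exists_multiple_integral_of_isLocalization M
    exact ⟨m, hm⟩
  choose m hm using h1
  obtain ⟨S', hSS', hS', h⟩ := exists_finite_subalgebra_of_integral Finset.univ
    (fun i => (m i : A) • y i) (fun i _ => hm i) S hS
  refine ⟨S', hSS', hS', ?_⟩
  change T.toSubmodule ≤ (Algebra.adjoin B (S' : Set Ω)).toSubmodule
  rw [← hy, Submodule.span_le]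
  rintro _ ⟨i, rfl⟩
  obtain ⟨u, hu⟩ := IsLocalization.map_units B (m i)
  have h2 : y i = (↑u⁻¹ : B) • ((m i : A) • y i) := by
    rw [← algebraMap_smul B (m i : A) (y i), ← hu, smul_smul, Units.inv_mul, one_smul]
  rw [h2]
  exact Subalgebra.smul_mem _ (Algebra.subset_adjoin (h i (Finset.mem_univ i))) _

theorem ExtAnnihilated.exists_EK {ι : Type*} [DecidableEq ι] {Q : Ideal A} [Q.IsPrime]
    (h : ExtAnnihilated A Ω Q) {x : ι → B} (hx : FreeComplex.PowRegular x) (J : Finset ι)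
    (F : FreeResolution A Ω) (hF : F.IsSub) :
    ∃ G : FreeResolution A Ω, G.IsSub ∧ F.range ≤ G.range ∧
      ∃ φ : FreeComplex.Hom F.toFreeComplex G.toFreeComplex, IsLift φ ∧
      ∃ c ∉ Q, ∀ t, FreeComplex.EK (algebraMap A B c) (powIdeal x t J) (φ.map B M) := by
  induction J using Finset.induction_on generalizing F with
  | empty =>
    obtain ⟨G, hG, hle, φ, hφ, c, hc, hEK⟩ := h F hF
    exact ⟨G, hG, hle, φ, hφ, c, hc, fun t => by rw [powIdeal_empty]; exact hEK.map B M⟩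
  | insert l J hl ih =>
    obtain ⟨G, hG, hle, φ, hφ, c, hc, hEK⟩ := ih F hF
    obtain ⟨H, hH, hle', φ', hφ', c', hc', hEK'⟩ := ih G hG
    refine ⟨H, hH, hle.trans hle', φ'.comp φ, hφ'.comp hφ, c * c',
      fun h => (Ideal.IsPrime.mem_or_mem inferInstance h).elim hc hc', fun t => ?_⟩
    rw [map_mul, FreeComplex.Hom.map_comp]
    exact (hEK t).ladder hx hl (hEK' t)

theorem exists_torZero [IsNoetherianRing A] {ι : Type*} [DecidableEq ι] {x : ι → B}
    (hx : FreeComplex.PowRegular x) (hcolon : ∀ J, ∀ l ∉ J, ColonTrivial Ω x J l) (J : Finset ι)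
    (F : FreeResolution A Ω) (hF : F.IsSub) :
    ∃ G : FreeResolution A Ω, G.IsSub ∧ F.range ≤ G.range ∧
      ∃ φ : FreeComplex.Hom F.toFreeComplex G.toFreeComplex, IsLift φ ∧
      ∀ t, FreeComplex.TorZero (powIdeal x t J) (φ.map B M) := by
  induction J using Finset.induction_on generalizing F with
  | empty =>
    obtain ⟨φ, hφ⟩ := exists_lift F F le_rfl
    exact ⟨F, hF, le_rfl, φ, hφ, fun t => by
      rw [powIdeal_empty]; exact FreeComplex.TorZero.bot _⟩
  | insert l J hl ih =>
    obtain ⟨S, hS⟩ := hF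
    have hfg := range_fg (F.map B M)
    rw [range_map M F hS] at hfg
    obtain ⟨T, hT, hTfg, hcol⟩ := hcolon J l hl _ hfg
    obtain ⟨S', hSS', hS'fg, hTS'⟩ := exists_le_adjoin M T hTfg S (hS ▸ range_fg F)
    obtain ⟨G₁, hG₁⟩ := exists_range_eq S'.toSubmodule hS'fg
    have hle₁ : F.range ≤ G₁.range := by rw [hS, hG₁]; exact hSS'
    obtain ⟨φ₁, hφ₁⟩ := exists_lift F G₁ hle₁
    obtain ⟨G₂, hG₂, hle₂, φ₂, hφ₂, ht₂⟩ := ih G₁ ⟨S', hG₁⟩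
    obtain ⟨G₃, hG₃, hle₃, φ₃, hφ₃, ht₃⟩ := ih G₂ hG₂
    refine ⟨G₃, hG₃, hle₁.trans (hle₂.trans hle₃), φ₃.comp (φ₂.comp φ₁),
      hφ₃.comp (hφ₂.comp hφ₁), fun t => ?_⟩
    rw [FreeComplex.Hom.map_comp, FreeComplex.Hom.map_comp]
    refine FreeComplex.TorZero.ladder hx hl ?_ (ht₂ t) (ht₃ t)
    refine colonKilled_of_forall (F := F.map B M) (G := G₁.map B M) (hφ₁.map B M)
      fun s w hw hrel => ?_
    rw [range_map M F hS] at hw hrel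
    rw [range_map M G₁ hG₁]
    exact Submodule.smul_mono le_rfl (fun y hy => hTS' hy) (hcol t s w hw hrel)

theorem colonBounded_of_extAnnihilated [IsNoetherianRing A] [IsNoetherianRing B] [IsLocalRing B]
    {ι : Type*} [Fintype ι] [DecidableEq ι] (Q : Ideal A) [Q.IsPrime]
    [IsLocalization.AtPrime B Q]
    (hQ : ∀ Q' : Ideal A, Q'.IsPrime → RingHom.ker (algebraMap A Ω) ≤ Q' → Q' < Q →
      ExtAnnihilated A Ω Q')
    {x : ι → B} (hxm : ∀ i, x i ∈ IsLocalRing.maximalIdeal B) (hx : FreeComplex.PowRegular x)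
    (hcog : ∀ t, FreeComplex.MatrixCogenerator (powIdeal x t Finset.univ)) (J : Finset ι) (l : ι)
    (hl : l ∉ J) : ColonBounded Ω x J l := by
  intro T hT
  let 𝔞 : Ideal B :=
    { carrier := {b | ∃ T' : Subalgebra B Ω, T ≤ T' ∧ T'.toSubmodule.FG ∧
        ∀ (t : ι → ℕ) (s : ℕ), ∀ w ∈ T, x l ^ s • w ∈ powIdeal x t J • T.toSubmodule →
          b • w ∈ powIdeal x t J • T'.toSubmodule}
      zero_mem' := ⟨T, le_rfl, hT, fun t s w hw _ => by rw [zero_smul]; exact zero_mem _⟩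
      add_mem' := by
        rintro a b ⟨T₁, h₁, hT₁, H₁⟩ ⟨T₂, h₂, hT₂, H₂⟩
        refine ⟨T₁ ⊔ T₂, h₁.trans le_sup_left, sup_fg hT₁ hT₂, fun t s w hw hrel => ?_⟩
        rw [add_smul]
        exact add_mem (smul_sub_mono le_sup_left (H₁ t s w hw hrel))
          (smul_sub_mono le_sup_right (H₂ t s w hw hrel))
      smul_mem' := by
        rintro a b ⟨T₁, h₁, hT₁, H₁⟩
        refine ⟨T₁, h₁, hT₁, fun t s w hw hrel => ?_⟩
        rw [smul_eq_mul, mul_smul]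
        exact Submodule.smul_mem _ _ (H₁ t s w hw hrel) }
  have hrad : ∀ i, x i ∈ 𝔞.radical := by
    intro i
    rw [Ideal.radical_eq_sInf, Submodule.mem_sInf]
    rintro q ⟨hq𝔞, hq⟩
    let Q' : Ideal A := Ideal.comap (algebraMap A B) q
    have hQ'Q : Q' ≤ Q := by
      rw [← IsLocalization.AtPrime.under_maximalIdeal B Q]
      exact Ideal.comap_mono (IsLocalRing.le_maximalIdeal hq.ne_top)
    rcases hQ'Q.eq_or_lt with heq | hlt
    · have h1 := IsLocalization.map_under Q.primeCompl B q
      have h2 := IsLocalization.map_under Q.primeCompl B (IsLocalRing.maximalIdeal B)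
      have h3 : q = IsLocalRing.maximalIdeal B := by
        rw [← h1, ← h2, IsLocalization.AtPrime.under_maximalIdeal B Q]
        exact congrArg _ heq
      rw [h3]
      exact hxm i
    · exfalso
      have hQ'p : Q'.IsPrime := Ideal.comap_isPrime _ _
      have hker : RingHom.ker (algebraMap A Ω) ≤ Q' := by
        intro a ha
        refine hq𝔞 ⟨T, le_rfl, hT, fun t s w hw _ => ?_⟩
        have h0 : algebraMap A B a • w = 0 := by
          rw [algebraMap_smul, Algebra.smul_def (A := Ω), (RingHom.mem_ker).1 ha, zero_mul]
        rw [h0]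
        exact zero_mem _
      obtain ⟨S, -, hSfg, hTS⟩ := exists_le_adjoin Q.primeCompl T hT ⊥
        (Subalgebra.fg_bot_toSubmodule)
      obtain ⟨F, hF⟩ := exists_range_eq S.toSubmodule hSfg
      obtain ⟨G, ⟨S', hS'⟩, hle, φ, hφ, c, hc, hEK⟩ :=
        (hQ Q' hQ'p hker hlt).exists_EK Q.primeCompl hx Finset.univ F ⟨S, hF⟩
      refine hc (hq𝔞 ⟨Algebra.adjoin B (S' : Set Ω), ?_, ?_, fun t s w hw hrel => ?_⟩)
      · refine hTS.trans (Algebra.adjoin_mono ?_)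
        rw [hF, hS'] at hle
        exact hle
      · rw [← range_map Q.primeCompl G hS']
        exact range_fg _
      · rw [← range_map Q.primeCompl G hS']
        refine smul_mem_of_colonKilled (F := F.map B Q.primeCompl) (G := G.map B Q.primeCompl)
          (hφ.map B Q.primeCompl)
          (FreeComplex.ColonKilled.of_EK hxm hx hcog hEK t J l hl) (s := s) ?_ ?_
        · rw [range_map Q.primeCompl F hF]
          exact hTS hw
        · rw [range_map Q.primeCompl F hF]
          exact smul_sub_mono hTS hrel
  choose N hN using hrad
  choose T' hTT' hT'fg H using hN
  have hsup : ∀ K : Finset ι, ∃ T'' : Subalgebra B Ω, T ≤ T'' ∧ T''.toSubmodule.FG ∧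
      ∀ i ∈ K, T' i ≤ T'' := by
    intro K
    induction K using Finset.induction_on with
    | empty => exact ⟨T, le_rfl, hT, by simp⟩
    | insert k K _ ih =>
      obtain ⟨T'', h1, h2, h3⟩ := ih
      refine ⟨T' k ⊔ T'', h1.trans le_sup_right, sup_fg (hT'fg k) h2, fun i hi => ?_⟩
      rcases Finset.mem_insert.1 hi with rfl | hi
      · exact le_sup_left
      · exact (h3 i hi).trans le_sup_right
  obtain ⟨T'', h1, h2, h3⟩ := hsup Finset.univ
  refine ⟨T'', h1, h2, ∑ i, N i, fun t s w hw hrel i _ => ?_⟩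
  have hle : N i ≤ ∑ i, N i := Finset.single_le_sum (fun _ _ => Nat.zero_le _) (Finset.mem_univ i)
  rw [← Nat.sub_add_cancel hle, pow_add, mul_smul]
  exact Submodule.smul_mem _ _
    (smul_sub_mono (h3 i (Finset.mem_univ i)) (H i t s w hw hrel))

end Ladder

end FreeResolution

end

/-- Parameters of a Gorenstein local ring which are nonzero in `Ω`. -/
structure GoodParameters (B Ω : Type*) [CommRing B] [IsLocalRing B] [Field Ω] [Algebra B Ω]
    {h : ℕ} (x : Fin h → B) : Prop where
  mem : ∀ i, x i ∈ IsLocalRing.maximalIdeal B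
  ne_zero : ∀ i, algebraMap B Ω (x i) ≠ 0
  powRegular : FreeComplex.PowRegular x
  injective : ∀ t, FreeComplex.MatrixInjective (powIdeal x t Finset.univ)
  cogenerator : ∀ t, FreeComplex.MatrixCogenerator (powIdeal x t Finset.univ)
  pow_le : ∃ N : ℕ, IsLocalRing.maximalIdeal B ^ N ≤ Ideal.span (Set.range x)

/-- Every localization of `A` at a prime containing the kernel of `A → Ω` has good parameters. -/
def LocallyGood (A : Type u) (Ω : Type v) [CommRing A] [Field Ω] [Algebra A Ω] : Prop :=
  ∀ (Q : Ideal A) [Q.IsPrime], RingHom.ker (algebraMap A Ω) ≤ Q →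
    ∀ (B : Type u) [CommRing B] [IsLocalRing B] [Algebra A B] [Algebra B Ω] [IsScalarTower A B Ω]
      [IsLocalization.AtPrime B Q], ∃ (h : ℕ) (x : Fin h → B), GoodParameters B Ω x

/-- Cocycles of high degree in the dual of any free complex are coboundaries. -/
def DualExactAbove (A : Type*) [CommRing A] (n : ℕ) : Prop :=
  ∀ (G : FreeComplex A), ∀ j ≥ n, ∀ g : Fin (G.r (j + 1)) → A,
    Matrix.vecMul g (G.D (j + 1)) = 0 → ∃ ψ, g = Matrix.vecMul ψ (G.D j)

section

variable {A : Type u} {Ω : Type v} [CommRing A] [IsNoetherianRing A] [Field Ω] [IsAlgClosed Ω] [Algebra A Ω]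
  {p : ℕ} [Fact p.Prime] [CharP Ω p]

theorem GoodParameters.colonTrivial {B : Type*} [CommRing B] [IsNoetherianRing B] [IsLocalRing B]
    [Algebra A B] [Algebra B Ω] [IsScalarTower A B Ω] (p : ℕ) [Fact p.Prime] [CharP Ω p]
    (Q : Ideal A) [Q.IsPrime]
    [IsLocalization.AtPrime B Q]
    (hQ : ∀ Q' : Ideal A, Q'.IsPrime → RingHom.ker (algebraMap A Ω) ≤ Q' → Q' < Q →
      FreeResolution.ExtAnnihilated A Ω Q') {h : ℕ} {x : Fin h → B} (hx : GoodParameters B Ω x) :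
    ∀ (J : Finset (Fin h)), ∀ l ∉ J, ColonTrivial Ω x J l :=
  ColonTrivial.of_bounded (p := p) hx.ne_zero
    (FreeResolution.colonBounded_of_extAnnihilated Q hQ hx.mem hx.powRegular hx.cogenerator)

theorem FreeResolution.extAnnihilated_of_goodParameters {B : Type*} [CommRing B]
    [IsNoetherianRing B] [IsLocalRing B]
    [Algebra A B] [Algebra B Ω] [IsScalarTower A B Ω] (p : ℕ) [Fact p.Prime] [CharP Ω p]
    {n : ℕ} (hn : DualExactAbove A n)
    (Q : Ideal A) [Q.IsPrime] [IsLocalization.AtPrime B Q]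
    (hQ : ∀ Q' : Ideal A, Q'.IsPrime → RingHom.ker (algebraMap A Ω) ≤ Q' → Q' < Q →
      FreeResolution.ExtAnnihilated A Ω Q') {h : ℕ} {x : Fin h → B} (hx : GoodParameters B Ω x) :
    FreeResolution.ExtAnnihilated A Ω Q := by
  intro F hF
  obtain ⟨G, hG, hle, φ, hφ, ht⟩ := exists_torZero Q.primeCompl hx.powRegular
    (hx.colonTrivial p Q hQ) Finset.univ F hF
  have h1 : FreeComplex.EK 1 ⊥ (φ.map B Q.primeCompl) :=
    FreeComplex.EK.bot_of_forall hx.mem fun t =>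
      FreeComplex.EK.of_torZero (hx.injective t) (ht t)
  obtain ⟨c, hc, hEK⟩ := FreeComplex.EK.exists_of_map B Q.primeCompl h1 n (hn _)
  exact ⟨G, hG, hle, φ, hφ, c, hc, hEK⟩

theorem LocallyGood.extAnnihilated (p : ℕ) [Fact p.Prime] [CharP Ω p] (hA : LocallyGood A Ω)
    {n : ℕ} (hn : DualExactAbove A n) (Q : Ideal A) (hQ : Q.IsPrime)
    (hker : RingHom.ker (algebraMap A Ω) ≤ Q) : FreeResolution.ExtAnnihilated A Ω Q := by
  induction hd : Q.height using WellFoundedLT.induction generalizing Q with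
  | ind d ih =>
  have hunit : ∀ y : Q.primeCompl, IsUnit (algebraMap A Ω y) := fun y =>
    IsUnit.mk0 _ fun h0 => y.2 (hker h0)
  let : Algebra (Localization.AtPrime Q) Ω := (IsLocalization.lift hunit).toAlgebra
  have : IsScalarTower A (Localization.AtPrime Q) Ω := IsScalarTower.of_algebraMap_eq fun a =>
    (IsLocalization.lift_eq hunit a).symm
  have : IsNoetherianRing (Localization.AtPrime Q) :=
    IsLocalization.isNoetherianRing Q.primeCompl _ inferInstance
  obtain ⟨h, x, hx⟩ := hA Q hker (Localization.AtPrime Q)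
  refine FreeResolution.extAnnihilated_of_goodParameters (B := Localization.AtPrime Q) p hn Q
    (fun Q' hQ' hker' hlt => ?_) hx
  refine ih Q'.height ?_ Q' hQ' hker' rfl
  rw [← hd]
  exact Ideal.height_strict_mono_of_isPrime_of_isPrime hlt

theorem LocallyGood.exists_colonTrivial [IsLocalRing A] (p : ℕ) [Fact p.Prime] [CharP Ω p]
    (hA : LocallyGood A Ω) {n : ℕ} (hn : DualExactAbove A n) :
    ∃ (h : ℕ) (x : Fin h → A), GoodParameters A Ω x ∧ ∀ J, ∀ l ∉ J, ColonTrivial Ω x J l := by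
  have : IsLocalization.AtPrime A (IsLocalRing.maximalIdeal A) :=
    IsLocalization.self fun y hy => by
      by_contra h
      exact hy ((IsLocalRing.mem_maximalIdeal y).2 h)
  obtain ⟨h, x, hx⟩ := hA (IsLocalRing.maximalIdeal A)
    (IsLocalRing.le_maximalIdeal (RingHom.ker_ne_top _)) A
  exact ⟨h, x, hx, hx.colonTrivial p (IsLocalRing.maximalIdeal A)
    fun Q' hQ' hker _ => hA.extAnnihilated p hn Q' hQ' hker⟩

end

namespace ExtBridge
variable {A : Type u} [CommRing A]

lemma subsingleton_succ_iff {X : ModuleCat.{u} A} (P : ProjectiveResolution X) (Y : ModuleCat.{u} A) (n : ℕ) :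
    Subsingleton (((Ext A (ModuleCat.{u} A) (n+1)).obj (Opposite.op X)).obj Y) ↔
      ∀ f : P.complex.X (n+1) ⟶ Y, P.complex.d (n+2) (n+1) ≫ f = 0 →
        ∃ g : P.complex.X n ⟶ Y, P.complex.d (n+1) n ≫ g = f := by
  rw [← ModuleCat.isZero_iff_subsingleton, (P.isoExt (R := A) (n+1) Y).isZero_iff,
    ← HomologicalComplex.exactAt_iff_isZero_homology,
    HomologicalComplex.exactAt_iff' _ n (n+1) (n+2) (by simp) (by simp),
    ShortComplex.moduleCat_exact_iff]
  rfl

lemma subsingleton_zero {X : ModuleCat.{u} A} (Y : ModuleCat.{u} A)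
    (h : ∀ f : X ⟶ Y, f = 0) :
    Subsingleton (((Ext A (ModuleCat.{u} A) 0).obj (Opposite.op X)).obj Y) := by
  let P := projectiveResolution X
  rw [← ModuleCat.isZero_iff_subsingleton, (P.isoExt (R := A) 0 Y).isZero_iff,
    ← HomologicalComplex.exactAt_iff_isZero_homology,
    HomologicalComplex.exactAt_iff' _ 0 0 1 (by simp) (by simp),
    ShortComplex.moduleCat_exact_iff]
  intro f hf
  have hf' : P.complex.d 1 0 ≫ f = 0 := hf
  have e := P.exact₀
  have : f = 0 := by
    have := e.g_desc f hf'
    rw [← this, show e.desc f hf' = 0 from h (e.desc f hf')]; exact Limits.comp_zero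
  exact ⟨0, by rw [map_zero]; exact this.symm⟩

lemma subsingleton_ext_succ_iff {X : ModuleCat.{u} A} (P : ProjectiveResolution X) (Y : ModuleCat.{u} A) (n : ℕ) :
    Subsingleton (Abelian.Ext X Y (n+1)) ↔
      ∀ f : P.complex.X (n+1) ⟶ Y, P.complex.d (n+2) (n+1) ≫ f = 0 →
        ∃ g : P.complex.X n ⟶ Y, P.complex.d (n+1) n ≫ g = f := by
  constructor
  · intro h f hf
    exact (P.extMk_eq_zero_iff f (n+2) rfl hf n rfl).1 (Subsingleton.elim _ _)
  · intro h
    refine subsingleton_of_forall_eq 0 fun α => ?_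
    obtain ⟨f, hf, rfl⟩ := P.extMk_surjective α (n+2) rfl
    exact (P.extMk_eq_zero_iff f (n+2) rfl hf n rfl).2 (h f hf)

lemma subsingleton_of_ext (X Y : ModuleCat.{u} A) (n : ℕ) (h : Subsingleton (Abelian.Ext X Y n)) :
    Subsingleton (((Ext A (ModuleCat.{u} A) n).obj (Opposite.op X)).obj Y) := by
  cases n with
  | zero =>
    apply subsingleton_zero
    have : Subsingleton (X ⟶ Y) := Abelian.Ext.addEquiv₀.subsingleton_congr.mp h
    intro f; exact Subsingleton.elim _ _
  | succ n =>
    rw [subsingleton_succ_iff (projectiveResolution X)]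
    exact (subsingleton_ext_succ_iff (projectiveResolution X) Y n).1 h

lemma hasInjectiveDimensionLT (Y : ModuleCat.{u} A) (n : ℕ)
    (h : ∀ N : ModuleCat.{u} A, Subsingleton (((Ext A (ModuleCat.{u} A) (n+1)).obj (Opposite.op N)).obj Y)) :
    HasInjectiveDimensionLT Y (n+1) := by
  apply hasInjectiveDimensionLT_of_enoughProjectives
  intro X
  rw [subsingleton_ext_succ_iff (projectiveResolution X)]
  exact (subsingleton_succ_iff (projectiveResolution X) Y n).1 (h X)

end ExtBridge

abbrev InjDim (A : Type u) [CommRing A] (M : Type u) [AddCommGroup M] [Module A M] (n : ℕ) : Prop :=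
  HasInjectiveDimensionLE (ModuleCat.of A M) n

namespace InjDim
section
variable {A : Type u} [CommRing A] {M N Z : Type u} [AddCommGroup M] [Module A M]
  [AddCommGroup N] [Module A N] [AddCommGroup Z] [Module A Z]

lemma zero_iff : InjDim A M 0 ↔ Module.Injective A M := by
  rw [InjDim, HasInjectiveDimensionLE, zero_add, ← injective_iff_hasInjectiveDimensionLT_one,
    ← Module.injective_iff_injective_object A M]

lemma of_injective (h : Module.Injective A M) (n : ℕ) : InjDim A M n := by
  have := zero_iff.2 h
  exact hasInjectiveDimensionLT_of_ge _ (0+1) _ (by simp)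

lemma congr (e : M ≃ₗ[A] N) {n : ℕ} (h : InjDim A M n) : InjDim A N n :=
  (ModuleCat.hasInjectiveDimensionLE_iff_of_linearEquiv (M := ModuleCat.of A M)
    (N := ModuleCat.of A N) e n).1 h

variable (A M) in
lemma exists_embedding : ∃ (I : Type u) (_ : AddCommGroup I) (_ : Module A I) (f : M →ₗ[A] I),
    Module.Injective A I ∧ Function.Injective f := by
  obtain ⟨⟨I, hI, f, hf⟩⟩ := EnoughInjectives.presentation (ModuleCat.of A M)
  exact ⟨I, _, _, f.hom, Module.injective_module_of_injective_object A I,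
    (ModuleCat.mono_iff_injective f).mp hf⟩

lemma succ_iff (hN : Module.Injective A N) (f : M →ₗ[A] N) (g : N →ₗ[A] Z)
    (hf : Function.Injective f) (hg : Function.Surjective g) (e : Function.Exact f g) {n : ℕ} :
    InjDim A M (n+1) ↔ InjDim A Z n := by
  have h := ModuleCat.shortComplex_shortExact (ModuleCat.shortComplexOfCompEqZero f g
    e.linearMap_comp_eq_zero) e hf hg
  exact (h.hasInjectiveDimensionLT_X₃_iff n
    ((Module.injective_iff_injective_object A N).1 hN)).symm

lemma right (f : M →ₗ[A] N) (g : N →ₗ[A] Z)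
    (hf : Function.Injective f) (hg : Function.Surjective g) (e : Function.Exact f g) {n : ℕ}
    (hM : InjDim A M (n+1)) (hN : InjDim A N n) : InjDim A Z n := by
  have h := ModuleCat.shortComplex_shortExact (ModuleCat.shortComplexOfCompEqZero f g
    e.linearMap_comp_eq_zero) e hf hg
  exact h.hasInjectiveDimensionLT_X₃ (n+1) hN hM

lemma exists_succ (n : ℕ) (h : InjDim A M (n+1)) :
    ∃ (I : Type u) (_ : AddCommGroup I) (_ : Module A I) (Y : Type u) (_ : AddCommGroup Y)
      (_ : Module A Y) (f : M →ₗ[A] I) (g : I →ₗ[A] Y),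
    Module.Injective A I ∧ Function.Injective f ∧ Function.Surjective g ∧ Function.Exact f g ∧
      InjDim A Y n := by
  obtain ⟨I, _, _, f, hI, hf⟩ := exists_embedding A M
  refine ⟨I, _, _, I ⧸ LinearMap.range f, inferInstance, inferInstance, f, Submodule.mkQ _, hI, hf,
    Submodule.mkQ_surjective _, f.exact_map_mkQ_range, ?_⟩
  exact (succ_iff hI f _ hf (Submodule.mkQ_surjective _) f.exact_map_mkQ_range).1 h

lemma surj_smul_of_injective (hM : Module.Injective A M) {x : A}
    (hx : x ∈ nonZeroDivisors A) (m : M) : ∃ m', x • m' = m := by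
  obtain ⟨h, hh⟩ := Module.Injective.extension_property A M A A (LinearMap.mulLeft A x)
    (fun a b hab => (mul_cancel_left_mem_nonZeroDivisors hx).1 hab) (LinearMap.toSpanSingleton A M m)
  refine ⟨h 1, ?_⟩
  rw [← map_smul]
  simpa using LinearMap.congr_fun hh 1

lemma injective_torsionBy (hM : Module.Injective A M) (x : A) :
    Module.Injective (A ⧸ Ideal.span {x}) (Submodule.torsionBy A M x) := by
  rw [← Module.Baer.iff_injective]
  intro J g
  let J' := J.comap (Ideal.Quotient.mk (Ideal.span {x}))
  let g' : J' →ₗ[A] M :=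
    { toFun j := g ⟨Ideal.Quotient.mk _ j.1, j.2⟩
      map_add' a b := by
        rw [← Submodule.coe_add, ← map_add]; rfl
      map_smul' a b := by
        have := congrArg (Subtype.val) (g.map_smul (Ideal.Quotient.mk _ a) ⟨Ideal.Quotient.mk _ b.1, b.2⟩)
        exact this }
  obtain ⟨h, hh⟩ := Module.Baer.of_injective hM J' g'
  have hx : x • h 1 = 0 := by
    have hxJ : x ∈ J' := by
      show Ideal.Quotient.mk _ x ∈ J
      rw [Ideal.Quotient.eq_zero_iff_mem.2 (Ideal.mem_span_singleton_self x)]; exact J.zero_mem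
    have := hh x hxJ
    rw [← map_smul]
    simp only [smul_eq_mul, mul_one]
    rw [this]
    show ((g ⟨Ideal.Quotient.mk _ x, hxJ⟩ : Submodule.torsionBy A M x) : M) = 0
    have : (⟨Ideal.Quotient.mk _ x, hxJ⟩ : J) = 0 := by
      ext; exact Ideal.Quotient.eq_zero_iff_mem.2 (Ideal.mem_span_singleton_self x)
    rw [this]; simp
  refine ⟨LinearMap.toSpanSingleton _ _ ⟨h 1, hx⟩, ?_⟩
  intro c hc
  obtain ⟨a, rfl⟩ := Ideal.Quotient.mk_surjective c
  apply Subtype.ext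
  have := hh a hc
  rw [show g ⟨(Ideal.Quotient.mk (Ideal.span {x})) a, hc⟩ = g' ⟨a, hc⟩ from rfl, ← this]
  show a • h 1 = h a
  rw [← map_smul]; simp

def torsionMap (x : A) (f : M →ₗ[A] N) :
    Submodule.torsionBy A M x →ₗ[A ⧸ Ideal.span {x}] Submodule.torsionBy A N x where
  toFun m := ⟨f m.1, by
    rw [Submodule.mem_torsionBy_iff, ← map_smul, (Submodule.mem_torsionBy_iff _ _).1 m.2, map_zero]⟩
  map_add' a b := Subtype.ext (by simp)
  map_smul' c b := by
    obtain ⟨a, rfl⟩ := Ideal.Quotient.mk_surjective c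
    exact Subtype.ext (f.map_smul a b.1)

lemma torsionBy {x : A} (hx : x ∈ nonZeroDivisors A) {n : ℕ} (hd : ∀ m : M, ∃ m', x • m' = m)
    (h : InjDim A M n) : InjDim (A ⧸ Ideal.span {x}) (Submodule.torsionBy A M x) n := by
  induction n generalizing M with
  | zero => exact zero_iff.2 (injective_torsionBy (zero_iff.1 h) x)
  | succ n ih =>
    obtain ⟨I, _, _, Y, _, _, f, g, hI, hf, hg, e, hY⟩ := exists_succ n h
    refine (succ_iff (injective_torsionBy hI x) (torsionMap x f) (torsionMap x g)
      (fun a b hab => Subtype.ext (hf (congrArg Subtype.val hab))) ?_ ?_).2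
      (ih ?_ hY)
    · intro w
      obtain ⟨i, hi⟩ := hg w.1
      have : g (x • i) = 0 := by
        rw [map_smul, hi]; exact (Submodule.mem_torsionBy_iff _ _).1 w.2
      obtain ⟨z, hz⟩ := (e _).1 this
      obtain ⟨z', rfl⟩ := hd z
      refine ⟨⟨i - f z', ?_⟩, Subtype.ext ?_⟩
      · rw [Submodule.mem_torsionBy_iff, smul_sub, ← map_smul, hz, sub_self]
      · show g (i - f z') = w.1
        rw [map_sub, hi, e.apply_apply_eq_zero, sub_zero]
    · intro b
      constructor
      · intro hb
        obtain ⟨a, ha⟩ := (e b.1).1 (congrArg Subtype.val hb)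
        refine ⟨⟨a, ?_⟩, Subtype.ext ha⟩
        rw [Submodule.mem_torsionBy_iff]
        apply hf
        rw [map_smul, ha, (Submodule.mem_torsionBy_iff _ _).1 b.2, map_zero]
      · rintro ⟨a, rfl⟩
        exact Subtype.ext (e.apply_apply_eq_zero a.1)
    · intro y
      obtain ⟨i, rfl⟩ := hg y
      obtain ⟨i', rfl⟩ := surj_smul_of_injective hI hx i
      exact ⟨g i', (map_smul g x i').symm⟩
end

variable {A : Type u} [CommRing A]

lemma quotient {x : A} (hx : x ∈ nonZeroDivisors A) {n : ℕ} (h : InjDim A A n) :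
    InjDim (A ⧸ Ideal.span {x}) (A ⧸ Ideal.span {x}) n := by
  have h1 : InjDim A A (n+1) := hasInjectiveDimensionLT_of_ge _ (n+1) _ (by simp)
  obtain ⟨I, _, _, Y, _, _, f, g, hI, hf, hg, e, hY⟩ := exists_succ n h1
  obtain ⟨i₁, hi₁⟩ := surj_smul_of_injective hI hx (f 1)
  have hfa : ∀ a, f a = x • a • i₁ := fun a => by
    rw [smul_comm, hi₁, ← map_smul]; simp
  have hYd : ∀ m : Y, ∃ m', x • m' = m := by
      intro y
      obtain ⟨i, rfl⟩ := hg y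
      obtain ⟨i', rfl⟩ := surj_smul_of_injective hI hx i
      exact ⟨g i', (map_smul g x i').symm⟩
  have hti : Function.Injective (torsionMap x g) := by
    rw [← LinearMap.ker_eq_bot, LinearMap.ker_eq_bot']
    intro b hb
    obtain ⟨a, ha⟩ := (e b.1).1 (congrArg Subtype.val hb)
    have : f (x • a) = 0 := by
      rw [map_smul, ha]; exact (Submodule.mem_torsionBy_iff _ _).1 b.2
    have h0 : x • a = 0 := hf (by rw [this, map_zero])
    have h0 : a = 0 := by simpa using hx.1 a h0
    apply Subtype.ext
    rw [← ha, h0, map_zero]; rfl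
  let y₁ : Submodule.torsionBy A Y x := ⟨g i₁, by
    rw [Submodule.mem_torsionBy_iff, ← map_smul, hi₁, e.apply_apply_eq_zero]⟩
  let φ := (LinearMap.range (torsionMap x g)).mkQ ∘ₗ LinearMap.toSpanSingleton (A ⧸ Ideal.span {x}) _ y₁
  have hφ : Function.Bijective φ := by
    constructor
    · rw [← LinearMap.ker_eq_bot, LinearMap.ker_eq_bot']
      intro c hc
      obtain ⟨a, rfl⟩ := Ideal.Quotient.mk_surjective c
      obtain ⟨i, hi⟩ := (Submodule.Quotient.mk_eq_zero _).1 hc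
      have hi : g i.1 = a • g i₁ := congrArg Subtype.val hi
      have : g (a • i₁ - i.1) = 0 := by rw [map_sub, map_smul, hi, sub_self]
      obtain ⟨b, hb⟩ := (e _).1 this
      have h2 : f (x • b) = f a := by
        rw [map_smul, hb, smul_sub, (Submodule.mem_torsionBy_iff _ _).1 i.2, sub_zero, hfa]
      rw [Ideal.Quotient.eq_zero_iff_mem, ← hf h2]
      exact Ideal.mul_mem_right _ _ (Ideal.mem_span_singleton_self x)
    · intro z
      obtain ⟨y, rfl⟩ := Submodule.mkQ_surjective _ z
      obtain ⟨i, hi⟩ := hg y.1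
      have : g (x • i) = 0 := by
        rw [map_smul, hi]; exact (Submodule.mem_torsionBy_iff _ _).1 y.2
      obtain ⟨a, ha⟩ := (e _).1 this
      refine ⟨Ideal.Quotient.mk _ a, ?_⟩
      refine (Submodule.Quotient.eq _).2 ⟨⟨a • i₁ - i, ?_⟩, Subtype.ext ?_⟩
      · rw [Submodule.mem_torsionBy_iff, smul_sub, ← ha, hfa, sub_self]
      · show g (a • i₁ - i) = a • g i₁ - y.1
        rw [map_sub, map_smul, hi]
  refine congr (LinearEquiv.ofBijective φ hφ).symm ?_
  exact right (torsionMap x g) (Submodule.mkQ _) hti (Submodule.mkQ_surjective _)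
    (torsionMap x g).exact_map_mkQ_range (of_injective (injective_torsionBy hI x) _)
    (torsionBy hx hYd hY)

lemma of_ringEquiv {B : Type u} [CommRing B] (e : A ≃+* B) {n : ℕ} (h : InjDim A A n) :
    InjDim B B n := by
  let e' : let := RingHomInvPair.of_ringEquiv e; let := RingHomInvPair.of_ringEquiv e.symm
      A ≃ₛₗ[RingHomClass.toRingHom e] B :=
    let := RingHomInvPair.of_ringEquiv e; let := RingHomInvPair.of_ringEquiv e.symm
    { e with map_smul' := fun a b => by simp }
  exact (ModuleCat.hasInjectiveDimensionLE_iff_of_semiLinearEquiv e (M := ModuleCat.of A A)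
    (N := ModuleCat.of B B) e' n).1 h

lemma of_isLocalization [IsNoetherianRing A] (S : Submonoid A) (B : Type u) [CommRing B] [Algebra A B]
    [IsLocalization S B] {n : ℕ} (h : InjDim A A n) : InjDim B B n := by
  have h' : HasInjectiveDimensionLE ((ModuleCat.of A A).localizedModule S) n :=
    ModuleCat.localizedModule_hasInjectiveDimensionLE n S _
  have : InjDim (Localization S) (Localization S) n := by
    refine (ModuleCat.hasInjectiveDimensionLE_iff_of_linearEquiv (N := ModuleCat.of (Localization S) (Localization S)) ?_ n).1 h'
    have := ModuleCat.localizedModule_isLocalizedModule (ModuleCat.of A A) S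
    exact (IsLocalizedModule.linearEquiv S ((ModuleCat.of A A).localizedModuleMkLinearMap S)
      (Algebra.linearMap A (Localization S))).extendScalarsOfIsLocalization S (Localization S)
  exact of_ringEquiv (IsLocalization.algEquiv S (Localization S) B).toRingEquiv this

end InjDim

open RingTheory.Sequence in
lemma isWeaklyRegular_concat_iff {A : Type u} [CommRing A] (rs : List A) (r : A) :
    IsWeaklyRegular A (rs ++ [r]) ↔ IsWeaklyRegular A rs ∧
      ∀ b, r * b ∈ Ideal.ofList rs → b ∈ Ideal.ofList rs := by
  rw [isWeaklyRegular_append_iff, isWeaklyRegular_singleton_iff,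
    isSMulRegular_quotient_iff_mem_of_smul_mem]
  simp

open RingTheory.Sequence in
lemma InjDim.quotient_ofList {A : Type u} [CommRing A] {n : ℕ} (h : InjDim A A n) (rs : List A)
    (hrs : IsWeaklyRegular A rs) : InjDim (A ⧸ Ideal.ofList rs) (A ⧸ Ideal.ofList rs) n := by
  induction rs using List.reverseRecOn with
  | nil =>
    rw [Ideal.ofList_nil]
    exact InjDim.of_ringEquiv (RingEquiv.quotientBot A).symm h
  | append_singleton rs r ih =>
    rw [isWeaklyRegular_concat_iff] at hrs
    have h2 := InjDim.quotient (x := Ideal.Quotient.mk (Ideal.ofList rs) r) (by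
      rw [mem_nonZeroDivisors_iff_right]
      intro b hb
      obtain ⟨b, rfl⟩ := Ideal.Quotient.mk_surjective b
      rw [← map_mul, Ideal.Quotient.eq_zero_iff_mem] at hb
      rw [Ideal.Quotient.eq_zero_iff_mem]
      exact hrs.2 b (by rwa [mul_comm])) (ih hrs.1)
    rw [Ideal.ofList_append, Ideal.ofList_singleton]
    refine InjDim.of_ringEquiv ?_ h2
    refine (Ideal.quotEquivOfEq ?_).trans (DoubleQuot.quotQuotEquivQuotSup _ _)
    rw [Ideal.map_span, Set.image_singleton]

open RingTheory.Sequence in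
lemma exists_isWeaklyRegular_maximal {A : Type u} [CommRing A] [IsNoetherianRing A] [IsLocalRing A]
    (𝔞 : Ideal A) (h𝔞 : 𝔞 ≤ maximalIdeal A) :
    ∃ rs : List A, (∀ r ∈ rs, r ∈ 𝔞) ∧ IsWeaklyRegular A rs ∧
      ∃ a, a ∉ Ideal.ofList rs ∧ ∀ y ∈ 𝔞, y * a ∈ Ideal.ofList rs := by
  obtain ⟨I, ⟨rs, hrs, hw, rfl⟩, hmax⟩ := set_has_maximal_iff_noetherian.2
    (inferInstance : IsNoetherian A A)
    {I | ∃ rs : List A, (∀ r ∈ rs, r ∈ 𝔞) ∧ IsWeaklyRegular A rs ∧ I = Ideal.ofList rs}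
    ⟨⊥, [], by simp, IsWeaklyRegular.nil A A, by simp⟩
  refine ⟨rs, hrs, hw, ?_⟩
  have hle : Ideal.ofList rs ≤ maximalIdeal A := (Ideal.span_le.2 hrs).trans h𝔞
  have : ¬ Subsingleton ((A ⧸ 𝔞) →ₗ[A] (A ⧸ Ideal.ofList rs)) := by
    rw [IsSMulRegular.subsingleton_linearMap_iff]
    rintro ⟨r, hr, hreg⟩
    rw [Ideal.annihilator_quotient] at hr
    rw [isSMulRegular_quotient_iff_mem_of_smul_mem] at hreg
    refine hmax (Ideal.ofList (rs ++ [r])) ⟨rs ++ [r], ?_, ?_, rfl⟩ ?_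
    · simp only [List.mem_append, List.mem_singleton]
      rintro x (hx | rfl)
      exacts [hrs x hx, hr]
    · exact (isWeaklyRegular_concat_iff _ _).2 ⟨hw, hreg⟩
    · rw [Ideal.ofList_append, Ideal.ofList_singleton]
      refine lt_of_le_of_ne le_sup_left fun h => ?_
      have hr' : r ∈ Ideal.ofList rs := by
        rw [h]; exact Ideal.mem_sup_right (Ideal.mem_span_singleton_self r)
      have := hle (hreg 1 (by simpa using hr'))
      exact (Ideal.ne_top_iff_one _).1 (maximalIdeal.isMaximal A).ne_top this
  rw [not_subsingleton_iff_nontrivial] at this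
  obtain ⟨f, hf⟩ := exists_ne (0 : (A ⧸ 𝔞) →ₗ[A] (A ⧸ Ideal.ofList rs))
  obtain ⟨a, ha⟩ := Ideal.Quotient.mk_surjective (f 1)
  refine ⟨a, fun h => hf ?_, fun y hy => ?_⟩
  · rw [← Ideal.Quotient.eq_zero_iff_mem, ha] at h
    ext; simpa using h
  · rw [← Ideal.Quotient.eq_zero_iff_mem, map_mul, ha]
    have : (Ideal.Quotient.mk (Ideal.ofList rs)) y * f 1 = y • f 1 := rfl
    rw [this, ← map_smul]
    have : y • (1 : A ⧸ 𝔞) = 0 := by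
      rw [Algebra.smul_def, mul_one]; exact Ideal.Quotient.eq_zero_iff_mem.2 hy
    rw [this, map_zero]

namespace InjDim
section
variable {A : Type u} [CommRing A] {M N Z L : Type u} [AddCommGroup M] [Module A M]
  [AddCommGroup N] [Module A N] [AddCommGroup Z] [Module A Z] [AddCommGroup L] [Module A L]

lemma shortExact {f : M →ₗ[A] N} {g : N →ₗ[A] Z}
    (hf : Function.Injective f) (hg : Function.Surjective g) (e : Function.Exact f g) :
    (ModuleCat.shortComplexOfCompEqZero f g e.linearMap_comp_eq_zero).ShortExact :=
  ModuleCat.shortComplex_shortExact (ModuleCat.shortComplexOfCompEqZero f g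
    e.linearMap_comp_eq_zero) e hf hg

variable (A M N) in
abbrev ExtZero (n : ℕ) : Prop :=
  Subsingleton (Abelian.Ext (ModuleCat.of A M) (ModuleCat.of A N) n)

lemma ExtZero.middle {f : M →ₗ[A] N} {g : N →ₗ[A] Z} {n : ℕ}
    (hf : Function.Injective f) (hg : Function.Surjective g) (e : Function.Exact f g)
    (h1 : ExtZero A M L n) (h3 : ExtZero A Z L n) : ExtZero A N L n := by
  refine subsingleton_of_forall_eq 0 fun x => ?_
  obtain ⟨y, rfl⟩ := Abelian.Ext.contravariant_sequence_exact₂ (shortExact hf hg e) (ModuleCat.of A L) x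
    (h1.elim _ _)
  rw [h3.elim y 0, Abelian.Ext.comp_zero]

lemma ExtZero.left {f : M →ₗ[A] N} {g : N →ₗ[A] Z} {n : ℕ}
    (hf : Function.Injective f) (hg : Function.Surjective g) (e : Function.Exact f g)
    (h2 : ExtZero A N L n) (h3 : ExtZero A Z L (n+1)) : ExtZero A M L n := by
  refine subsingleton_of_forall_eq 0 fun x => ?_
  obtain ⟨y, rfl⟩ := Abelian.Ext.contravariant_sequence_exact₁ (shortExact hf hg e) (ModuleCat.of A L) x
    (add_comm 1 n) (h3.elim _ _)
  rw [h2.elim y 0, Abelian.Ext.comp_zero]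

/-- covariant version -/
lemma ExtZero.right {f : M →ₗ[A] N} {g : N →ₗ[A] Z} {n : ℕ}
    (hf : Function.Injective f) (hg : Function.Surjective g) (e : Function.Exact f g)
    (h2 : ExtZero A L N n) (h1 : ExtZero A L M (n+1)) : ExtZero A L Z n := by
  refine subsingleton_of_forall_eq 0 fun x => ?_
  obtain ⟨y, rfl⟩ := Abelian.Ext.covariant_sequence_exact₃ (ModuleCat.of A L) (shortExact hf hg e) x
    rfl (h1.elim _ _)
  rw [h2.elim y 0, Abelian.Ext.zero_comp]

lemma ExtZero.of_injective (hN : Module.Injective A N) (n : ℕ) : ExtZero A M N (n+1) := by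
  have := (Module.injective_iff_injective_object A N).1 hN
  exact subsingleton_of_forall_eq 0 fun x => Abelian.Ext.eq_zero_of_injective x

lemma ExtZero.of_self (n : ℕ) : ExtZero A A N (n+1) := by
  have := (ModuleCat.of A A).projective_of_categoryTheory_projective
  exact subsingleton_of_forall_eq 0 fun x => Abelian.Ext.eq_zero_of_projective x

lemma ExtZero.of_injDim {n k : ℕ} (h : InjDim A N n) (hk : n < k) : ExtZero A M N k :=
  HasInjectiveDimensionLT.subsingleton _ (n+1) k hk _

lemma ExtZero.congr {n : ℕ} (e : M ≃ₗ[A] N) (h : ExtZero A N L n) : ExtZero A M L n := by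
  refine subsingleton_of_forall_eq 0 fun x => ?_
  have : x = (Abelian.Ext.mk₀ (ModuleCat.ofHom e.toLinearMap)).comp
    ((Abelian.Ext.mk₀ (ModuleCat.ofHom e.symm.toLinearMap)).comp x (zero_add n)) (zero_add n) := by
    rw [Abelian.Ext.mk₀_comp_mk₀_assoc, ← ModuleCat.ofHom_comp]
    simp
  rw [this, h.elim ((Abelian.Ext.mk₀ (ModuleCat.ofHom e.symm.toLinearMap)).comp x (zero_add n)) 0,
    Abelian.Ext.comp_zero]

lemma ExtZero.of_smul_surjective_implies {y : A} {n : ℕ} [IsNoetherianRing A] [IsLocalRing A]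
    [Module.Finite A M] [Module.Finite A N] (hy : y ∈ maximalIdeal A) (hr : IsSMulRegular M y)
    (h : ExtZero A (QuotSMulTop y M) N (n+1)) : ExtZero A M N n := by
  have hs : IsSMulRegular (ModuleCat.of A M) y := hr
  have key : ∀ x : Abelian.Ext (ModuleCat.of A M) (ModuleCat.of A N) n, ∃ z, y • z = x := by
    intro x
    obtain ⟨z, rfl⟩ := Abelian.Ext.contravariant_sequence_exact₁ hs.smulShortComplex_shortExact
      (ModuleCat.of A N) x (add_comm 1 n) (h.elim _ _)
    have hz : ∀ z' : Abelian.Ext (ModuleCat.of A M) (ModuleCat.of A N) n,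
        y • z' = (Abelian.Ext.mk₀ (y • 𝟙 (ModuleCat.of A M))).comp z' (zero_add n) := fun z' => by
      simp [Abelian.Ext.mk₀_smul]
    exact ⟨z, hz z⟩
  have : (⊤ : Submodule A (Abelian.Ext (ModuleCat.of A M) (ModuleCat.of A N) n)) = ⊥ := by
    refine Submodule.eq_bot_of_le_smul_of_le_jacobson_bot (maximalIdeal A) _
      Module.Finite.fg_top ?_ (maximalIdeal_le_jacobson _)
    intro x _
    obtain ⟨z, rfl⟩ := key x
    exact Submodule.smul_mem_smul hy trivial
  exact (Submodule.subsingleton_iff A).1 (subsingleton_of_bot_eq_top this.symm)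

lemma of_extZero (n : ℕ) (h : ∀ I : Ideal A, ExtZero A (A ⧸ I) M (n+1)) : InjDim A M n := by
  induction n generalizing M with
  | zero =>
    rw [zero_iff, ← Module.Baer.iff_injective]
    intro I g
    have e : Function.Exact I.subtype (Submodule.mkQ I) := by
      rw [LinearMap.exact_iff]; simp
    obtain ⟨y, hy⟩ := Abelian.Ext.contravariant_sequence_exact₁
      (shortExact I.subtype_injective I.mkQ_surjective e) (ModuleCat.of A M)
      (Abelian.Ext.mk₀ (ModuleCat.ofHom g)) (add_comm 1 0) ((h I).elim _ _)
    obtain ⟨φ, rfl⟩ := (Abelian.Ext.mk₀_bijective _ _).2 y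
    rw [Abelian.Ext.mk₀_comp_mk₀] at hy
    have := (Abelian.Ext.mk₀_bijective _ _).1 hy
    refine ⟨φ.hom, fun x hx => ?_⟩
    exact LinearMap.congr_fun (congrArg ModuleCat.Hom.hom this) ⟨x, hx⟩
  | succ n ih =>
    obtain ⟨I, _, _, f, hI, hf⟩ := exists_embedding A M
    refine (succ_iff hI f _ hf (Submodule.mkQ_surjective _) f.exact_map_mkQ_range).2 (ih fun J => ?_)
    exact ExtZero.right hf (Submodule.mkQ_surjective _) f.exact_map_mkQ_range
      (ExtZero.of_injective hI n) (h J)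
end

variable {B : Type u} [CommRing B] [IsNoetherianRing B] [IsLocalRing B]

lemma pred_of_socle {σ : B} (hσ : σ ≠ 0) (hm : ∀ y ∈ maximalIdeal B, y * σ = 0) {n : ℕ}
    (h : InjDim B B (n+1)) : InjDim B B n := by
  refine of_extZero n fun I => ?_
  have hk : ExtZero B (B ⧸ maximalIdeal B) B (n+1) := by
    let f : (B ⧸ maximalIdeal B) →ₗ[B] B := (maximalIdeal B).liftQ (LinearMap.toSpanSingleton B B σ)
      (fun y hy => by simpa using hm y hy)
    have hf : Function.Injective f := by
      rw [← LinearMap.ker_eq_bot, LinearMap.ker_eq_bot']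
      intro b hb
      obtain ⟨b, rfl⟩ := Ideal.Quotient.mk_surjective b
      have hb : b * σ = 0 := hb
      rw [Ideal.Quotient.eq_zero_iff_mem]
      by_contra hc
      have : IsUnit b := by simpa using hc
      exact hσ (by simpa [this.mul_right_eq_zero] using hb)
    exact ExtZero.left hf (Submodule.mkQ_surjective _) f.exact_map_mkQ_range
      (ExtZero.of_self n) (ExtZero.of_injDim h (by omega))
  refine IsNoetherianRing.induction_on_isQuotientEquivQuotientPrime B (M := B ⧸ I) inferInstance
    (motive := fun N _ _ _ => ExtZero B N B (n+1)) ?_ ?_ ?_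
  · intro N _ _ _ _
    have : Limits.IsZero (ModuleCat.of B N) := ModuleCat.isZero_of_subsingleton _
    refine subsingleton_of_forall_eq 0 fun x => ?_
    rw [← Abelian.Ext.mk₀_id_comp x, this.eq_of_src (𝟙 (ModuleCat.of B N)) 0]
    simp
  · intro N _ _ _ Q e
    refine ExtZero.congr e ?_
    by_cases hQ : Q.1 = maximalIdeal B
    · rw [hQ]; exact hk
    · obtain ⟨y, hy, hyQ⟩ := SetLike.exists_of_lt (lt_of_le_of_ne (le_maximalIdeal Q.2.ne_top) hQ)
      refine ExtZero.of_smul_surjective_implies hy ?_ (ExtZero.of_injDim h (by omega))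
      rw [isSMulRegular_quotient_iff_mem_of_smul_mem]
      intro b hb
      exact (Q.2.mem_or_mem hb).resolve_left hyQ
  · intro N₁ _ _ _ N₂ _ _ _ N₃ _ _ _ f g hf hg e h1 h3
    exact ExtZero.middle hf hg e h1 h3

lemma injective_of_socle {σ : B} (hσ : σ ≠ 0) (hm : ∀ y ∈ maximalIdeal B, y * σ = 0) {n : ℕ}
    (h : InjDim B B n) : Module.Injective B B := by
  induction n with
  | zero => exact zero_iff.1 h
  | succ n ih => exact ih (pred_of_socle hσ hm h)

lemma exists_mul_pow_of_injective (h : Module.Injective B B) (y : B) :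
    ∃ k c, y ^ k = c * y ^ (k+1) := by
  let F : ℕ →o Ideal B := ⟨fun k => LinearMap.ker (LinearMap.toSpanSingleton B B (y ^ k)), by
    intro a b hab x hx
    simp only [LinearMap.mem_ker, LinearMap.toSpanSingleton_apply, smul_eq_mul] at hx ⊢
    obtain ⟨c, rfl⟩ := Nat.exists_eq_add_of_le hab
    rw [pow_add, ← mul_assoc, hx, zero_mul]⟩
  obtain ⟨k, hk⟩ := monotone_stabilizes_iff_noetherian.2 (inferInstance : IsNoetherian B B) F
  have hk1 : F k = F (k+1) := hk (k+1) (by omega)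
  let φ : (B ⧸ F k) →ₗ[B] B := (F k).liftQ (LinearMap.toSpanSingleton B B (y^k)) le_rfl
  let ψ : (B ⧸ F k) →ₗ[B] B := (F k).liftQ (LinearMap.toSpanSingleton B B (y^(k+1))) hk1.le
  have hψ : Function.Injective ψ := by
    rw [← LinearMap.ker_eq_bot]
    exact Submodule.ker_liftQ_eq_bot _ _ _ hk1.ge
  obtain ⟨θ, hθ⟩ := Module.Injective.extension_property B B _ _ ψ hψ φ
  refine ⟨k, θ 1, ?_⟩
  have := LinearMap.congr_fun hθ (Submodule.Quotient.mk 1)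
  simp only [LinearMap.comp_apply, φ, ψ, Submodule.liftQ_apply, LinearMap.toSpanSingleton_apply,
    one_smul] at this
  rw [← this, mul_comm, ← smul_eq_mul, ← map_smul]
  simp

lemma maximalIdeal_pow_eq_bot (h : Module.Injective B B) : ∃ N, maximalIdeal B ^ N = ⊥ := by
  have hn : ∀ y ∈ maximalIdeal B, IsNilpotent y := by
    intro y hy
    obtain ⟨k, c, hc⟩ := exists_mul_pow_of_injective h y
    refine ⟨k, ?_⟩
    have h1 : (1 - c * y) * y ^ k = 0 := by rw [sub_mul, one_mul, mul_assoc, ← pow_succ', ← hc, sub_self]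
    have hu : IsUnit (1 - c * y) := by
      have : c * y ∈ maximalIdeal B := Ideal.mul_mem_left _ _ hy
      by_contra hc
      have := Ideal.add_mem _ this ((mem_maximalIdeal _).2 hc)
      rw [add_sub_cancel] at this
      exact (Ideal.ne_top_iff_one _).1 (maximalIdeal.isMaximal B).ne_top this
    exact (hu.mul_right_eq_zero).1 h1
  have : maximalIdeal B ≤ (⊥ : Ideal B).radical := fun y hy => (hn y hy)
  obtain ⟨N, hN⟩ := Ideal.exists_pow_le_of_le_radical_of_fg this (IsNoetherian.noetherian _)
  exact ⟨N, le_bot_iff.1 hN⟩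

end InjDim

theorem Ideal.mem_span_singleton_sup' {B : Type*} [CommRing B] {y b : B} {I : Ideal B} :
    b ∈ Ideal.span {y} ⊔ I ↔ ∃ c, ∃ u ∈ I, b = y * c + u := by
  rw [Submodule.mem_sup]
  constructor
  · rintro ⟨_, h, u, hu, rfl⟩
    obtain ⟨c, rfl⟩ := Ideal.mem_span_singleton'.1 h
    exact ⟨c, u, hu, by ring⟩
  · rintro ⟨c, u, hu, rfl⟩
    exact ⟨_, Ideal.mul_mem_right _ _ (Ideal.mem_span_singleton_self y), u, hu, rfl⟩

theorem FreeComplex.PowRegular.of_one {B : Type*} [CommRing B] {h : ℕ} {x : Fin h → B}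
    (hx : ∀ (J : Finset (Fin h)), ∀ l ∉ J, ∀ b, x l * b ∈ powIdeal x 1 J → b ∈ powIdeal x 1 J) :
    FreeComplex.PowRegular x := by
  classical
  have key : ∀ (n : ℕ) (t : Fin h → ℕ) (J : Finset (Fin h)), ∑ j ∈ J, t j = n → ∀ l ∉ J,
      ∀ s b, x l ^ s * b ∈ powIdeal x t J → b ∈ powIdeal x t J := by
    intro n
    induction n using Nat.strong_induction_on with
    | _ n ih =>
    intro t J hn l hl s
    induction s with
    | zero => simp
    | succ s ihs =>
    intro b hb
    rw [pow_succ, mul_assoc] at hb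
    replace hb := ihs _ hb
    by_cases h0 : ∃ j ∈ J, t j = 0
    · obtain ⟨j, hj, hj0⟩ := h0
      have := pow_mem_powIdeal x t hj
      rw [hj0, pow_zero] at this
      rw [(Ideal.eq_top_iff_one _).2 this]
      trivial
    by_cases h1 : ∀ j ∈ J, t j = 1
    · rw [powIdeal_congr (t' := 1) h1] at hb ⊢
      exact hx J l hl b hb
    push Not at h0 h1
    obtain ⟨j, hj, hj1⟩ := h1
    obtain ⟨k, hk⟩ : ∃ k, t j = k + 2 := ⟨t j - 2, by have := h0 j hj; omega⟩
    obtain ⟨K, hjK, rfl⟩ : ∃ K, j ∉ K ∧ insert j K = J :=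
      ⟨J.erase j, Finset.notMem_erase _ _, Finset.insert_erase hj⟩
    have hlK : l ∉ K := fun h => hl (Finset.mem_insert_of_mem h)
    rw [Finset.sum_insert hjK] at hn
    have hupd : ∀ m : ℕ, powIdeal x (Function.update t j m) (insert j K)
        = Ideal.span {x j ^ m} ⊔ powIdeal x t K := by
      intro m
      rw [powIdeal_insert, Function.update_self]
      congr 1
      exact powIdeal_congr fun i hi => by
        rw [Function.update_of_ne (by rintro rfl; exact hjK hi)]
    have hsum : ∀ m : ℕ, ∑ i ∈ insert j K, Function.update t j m i = m + ∑ i ∈ K, t i := by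
      intro m
      rw [Finset.sum_insert hjK, Function.update_self]
      congr 1
      exact Finset.sum_congr rfl fun i hi => by
        rw [Function.update_of_ne (by rintro rfl; exact hjK hi)]
    rw [powIdeal_insert, hk] at hb ⊢
    obtain ⟨c, u, hu, hbc⟩ := Ideal.mem_span_singleton_sup'.1 hb
    have hb1 := ih _ (by omega) (Function.update t j (k+1)) (insert j K) (hsum _) l hl 1 b (by
      rw [hupd, pow_one, hbc]
      exact Ideal.mem_span_singleton_sup'.2 ⟨x j * c, u, hu, by ring⟩)
    rw [hupd] at hb1
    obtain ⟨b', u', hu', rfl⟩ := Ideal.mem_span_singleton_sup'.1 hb1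
    have hb2 := ih _ (by omega) t K rfl j hjK (k+1) (x l * b' - x j * c) (by
      have : x j ^ (k+1) * (x l * b' - x j * c) = u - x l * u' := by linear_combination hbc
      rw [this]
      exact sub_mem hu (Ideal.mul_mem_left _ _ hu'))
    have hb3 := ih _ (by omega) (Function.update t j 1) (insert j K) (hsum _) l hl 1 b' (by
      rw [hupd, pow_one, pow_one]
      exact Ideal.mem_span_singleton_sup'.2 ⟨c, _, hb2, by ring⟩)
    rw [hupd] at hb3
    obtain ⟨d, w, hw, rfl⟩ := Ideal.mem_span_singleton_sup'.1 hb3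
    exact Ideal.mem_span_singleton_sup'.2 ⟨d, x j ^ (k+1) * w + u',
      add_mem (Ideal.mul_mem_left _ _ hw) hu', by ring⟩
  exact fun t J l hl s b => key _ t J rfl l hl s b

theorem Ideal.ofList_map_pow_eq_powIdeal {B : Type*} [CommRing B] {h : ℕ} (x : Fin h → B)
    (t : Fin h → ℕ) (L : List (Fin h)) :
    Ideal.ofList (L.map fun i => x i ^ t i) = powIdeal x t L.toFinset := by
  unfold Ideal.ofList powIdeal
  congr 1
  ext y
  simp

theorem FreeComplex.PowRegular.of_isWeaklyRegular {B : Type u} [CommRing B] [IsNoetherianRing B]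
    [IsLocalRing B] {h : ℕ} {x : Fin h → B} (hm : ∀ i, x i ∈ maximalIdeal B)
    (hx : RingTheory.Sequence.IsWeaklyRegular B (List.ofFn x)) : FreeComplex.PowRegular x := by
  classical
  refine .of_one fun J l hl b hb => ?_
  have hperm : List.Perm (List.finRange h) ((J.toList ++ [l]) ++ (insert l J)ᶜ.toList) := by
    refine (List.perm_ext_iff_of_nodup (List.nodup_finRange h) ?_).2 fun i => by
      simp; tauto
    refine List.Nodup.append (List.Nodup.append J.nodup_toList (by simp) ?_) (Finset.nodup_toList _) ?_
    · simpa using hl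
    · intro i; simp; tauto
  rw [List.ofFn_eq_map] at hx
  have h1 := IsLocalRing.isWeaklyRegular_of_perm_of_subset_maximalIdeal hx (hperm.map x) (by
    intro r hr
    obtain ⟨i, _, rfl⟩ := List.mem_map.1 hr
    exact hm i)
  rw [List.map_append, RingTheory.Sequence.isWeaklyRegular_append_iff, List.map_append, List.map_singleton,
    isWeaklyRegular_concat_iff] at h1
  have h2 := h1.1.2 b
  have h3 : Ideal.ofList (J.toList.map x) = powIdeal x 1 J := by
    have := Ideal.ofList_map_pow_eq_powIdeal x 1 J.toList
    simpa using this
  rw [h3] at h2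
  exact h2 hb

theorem FreeComplex.PowRegular.isWeaklyRegular {B : Type u} [CommRing B] {h : ℕ} {x : Fin h → B}
    (hx : FreeComplex.PowRegular x) (t : Fin h → ℕ) (L : List (Fin h)) (hL : L.Nodup) :
    RingTheory.Sequence.IsWeaklyRegular B (L.map fun i => x i ^ t i) := by
  classical
  induction L using List.reverseRecOn with
  | nil => simp
  | append_singleton L l ih =>
    rw [List.map_append, List.map_singleton, isWeaklyRegular_concat_iff,
      Ideal.ofList_map_pow_eq_powIdeal]
    rw [List.nodup_append] at hL
    exact ⟨ih hL.1, fun b hb => hx t _ l (fun hl => hL.2.2 l (by simpa using hl) l (by simp) rfl) _ b hb⟩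

open Matrix in
theorem FreeComplex.MatrixInjective.of_injective_quotient {B : Type u} [CommRing B] {I : Ideal B}
    (h : Module.Injective (B ⧸ I) (B ⧸ I)) : FreeComplex.MatrixInjective I := by
  intro m n D a ha
  let q := Ideal.Quotient.mk I
  let f := (D.map q).mulVecLin
  let g := (Matrix.of fun (_ : Unit) k => q (a k)).mulVecLin
  have hg : ∀ z, g z = fun _ => (fun k => q (a k)) ⬝ᵥ z := fun z => rfl
  let g₁ : (Fin m → B ⧸ I) →ₗ[B ⧸ I] B ⧸ I := LinearMap.proj () ∘ₗ g
  have hker : LinearMap.ker f ≤ LinearMap.ker g₁ := by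
    intro z hz
    choose w hw using fun k => Ideal.Quotient.mk_surjective (I := I) (z k)
    have hz' : ∀ k, (D *ᵥ w) k ∈ I := fun k => by
      rw [← Ideal.Quotient.eq_zero_iff_mem]
      have : f z k = 0 := by rw [LinearMap.mem_ker.1 hz]; rfl
      rw [← this]
      simp [f, Matrix.mulVec, dotProduct, hw, q]
    have := Ideal.Quotient.eq_zero_iff_mem.2 (ha w hz')
    rw [LinearMap.mem_ker, ← this]
    simp [g₁, g, Matrix.mulVec, dotProduct, hw, q]
  obtain ⟨e, he⟩ := Module.Injective.extension_property (B ⧸ I) (B ⧸ I)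
    ((Fin m → B ⧸ I) ⧸ LinearMap.ker f) (Fin n → B ⧸ I)
    ((LinearMap.ker f).liftQ f le_rfl) (by
      rw [← LinearMap.ker_eq_bot]; exact Submodule.ker_liftQ_eq_bot _ _ _ le_rfl)
    ((LinearMap.ker f).liftQ g₁ hker)
  choose ψ hψ using fun k => Ideal.Quotient.mk_surjective (I := I) (e (Pi.single k 1))
  refine ⟨ψ, fun k => ?_⟩
  rw [← Ideal.Quotient.eq_zero_iff_mem]
  have h1 : e (f (Pi.single k 1)) = g₁ (Pi.single k 1) :=
    LinearMap.congr_fun he (Submodule.Quotient.mk (Pi.single k 1))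
  have h2 : g₁ (Pi.single k 1) = q (a k) := by simp [g₁, g, q]
  have h3 : f (Pi.single k 1) = ∑ i, q (D i k) • Pi.single i (1 : B ⧸ I) := by
    ext i
    simp [f, Finset.sum_apply, Pi.single_apply]
  rw [h3, map_sum, h2] at h1
  simp only [map_smul, ← hψ, smul_eq_mul] at h1
  simp only [Pi.sub_apply, map_sub, sub_eq_zero, Matrix.vecMul, dotProduct, map_sum, map_mul]
  rw [← show _ = (Ideal.Quotient.mk I) (a k) from h1]
  exact Finset.sum_congr rfl fun i _ => mul_comm _ _

theorem IsLocalRing.exists_socle {B : Type u} [CommRing B] [IsLocalRing B] {I : Ideal B}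
    (hI : I ≠ ⊤) {N : ℕ} (hN : maximalIdeal B ^ N ≤ I) :
    ∃ σ, σ ∉ I ∧ ∀ b ∈ maximalIdeal B, σ * b ∈ I := by
  classical
  have hex : ∃ N, maximalIdeal B ^ N ≤ I := ⟨N, hN⟩
  obtain ⟨k, hk⟩ : ∃ k, Nat.find hex = k + 1 := by
    refine Nat.exists_eq_succ_of_ne_zero fun h0 => hI ?_
    have := Nat.find_spec hex
    rw [h0, pow_zero, Ideal.one_eq_top] at this
    exact top_le_iff.1 this
  obtain ⟨σ, hσ, hσI⟩ := SetLike.not_le_iff_exists.1 (Nat.find_min hex (m := k) (by omega))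
  refine ⟨σ, hσI, fun b hb => ?_⟩
  have := Nat.find_spec hex
  rw [hk, pow_succ] at this
  exact this (Ideal.mul_mem_mul hσ hb)

theorem InjDim.injective_quotient {B : Type u} [CommRing B] [IsNoetherianRing B] [IsLocalRing B]
    {n : ℕ} (h : InjDim B B n) (rs : List B) (hrs : RingTheory.Sequence.IsWeaklyRegular B rs)
    {σ : B} (hσ : σ ∉ Ideal.ofList rs) (hm : ∀ b ∈ maximalIdeal B, σ * b ∈ Ideal.ofList rs) :
    Module.Injective (B ⧸ Ideal.ofList rs) (B ⧸ Ideal.ofList rs) := by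
  have hI : Ideal.ofList rs ≠ ⊤ := fun h => hσ (h ▸ trivial)
  have := Ideal.Quotient.nontrivial_iff.2 hI
  have : IsLocalRing (B ⧸ Ideal.ofList rs) :=
    IsLocalRing.of_surjective' (Ideal.Quotient.mk _) Ideal.Quotient.mk_surjective
  refine InjDim.injective_of_socle (σ := Ideal.Quotient.mk _ σ) ?_ ?_ (h.quotient_ofList rs hrs)
  · rwa [Ne, Ideal.Quotient.eq_zero_iff_mem]
  · intro y hy
    obtain ⟨b, rfl⟩ := Ideal.Quotient.mk_surjective y
    rw [← map_mul, Ideal.Quotient.eq_zero_iff_mem, mul_comm]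
    refine hm b ?_
    rw [IsLocalRing.mem_maximalIdeal, mem_nonunits_iff] at hy ⊢
    exact fun hb => hy (hb.map _)

theorem IsLocalRing.exists_pow_le_of_quotient {B : Type u} [CommRing B] [IsLocalRing B]
    {I : Ideal B} (hI : I ≠ ⊤)
    (h : ∀ [IsLocalRing (B ⧸ I)], ∃ N, maximalIdeal (B ⧸ I) ^ N = ⊥) : ∃ N, maximalIdeal B ^ N ≤ I := by
  have := Ideal.Quotient.nontrivial_iff.2 hI
  have : IsLocalRing (B ⧸ I) :=
    IsLocalRing.of_surjective' (Ideal.Quotient.mk _) Ideal.Quotient.mk_surjective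
  obtain ⟨N, hN⟩ := h
  have := Ideal.comap_isMaximal_of_surjective (Ideal.Quotient.mk I) Ideal.Quotient.mk_surjective
    (K := maximalIdeal (B ⧸ I))
  have h1 : Ideal.map (Ideal.Quotient.mk I) (maximalIdeal B) ≤ maximalIdeal (B ⧸ I) :=
    Ideal.map_le_iff_le_comap.2 (IsLocalRing.eq_maximalIdeal this).ge
  refine ⟨N, fun y hy => Ideal.Quotient.eq_zero_iff_mem.1 ?_⟩
  have h2 := Ideal.mem_map_of_mem (Ideal.Quotient.mk I) hy
  rw [Ideal.map_pow] at h2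
  have h3 := Ideal.pow_right_mono h1 N h2
  rwa [hN, Ideal.mem_bot] at h3

theorem InjDim.exists_parameters {B : Type u} [CommRing B] [IsNoetherianRing B] [IsLocalRing B]
    {n : ℕ} (h : InjDim B B n) :
    ∃ (d : ℕ) (x : Fin d → B), (∀ i, x i ∈ maximalIdeal B) ∧ (∀ i, x i ∈ nonZeroDivisors B) ∧
      FreeComplex.PowRegular x ∧ (∀ t, FreeComplex.MatrixInjective (powIdeal x t Finset.univ)) ∧
      (∀ t, FreeComplex.MatrixCogenerator (powIdeal x t Finset.univ)) ∧
      ∃ N : ℕ, maximalIdeal B ^ N ≤ Ideal.span (Set.range x) := by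
  classical
  obtain ⟨rs, hrm, hrs, a, ha, hma⟩ := exists_isWeaklyRegular_maximal (maximalIdeal B) le_rfl
  have hI : Ideal.ofList rs ≠ ⊤ := fun h => ha (h ▸ trivial)
  obtain ⟨d, x, rfl⟩ : ∃ (d : ℕ) (x : Fin d → B), rs = List.ofFn x :=
    ⟨_, rs.get, (List.ofFn_get rs).symm⟩
  have hm : ∀ i, x i ∈ maximalIdeal B := fun i => hrm _ (by simp)
  have hx := FreeComplex.PowRegular.of_isWeaklyRegular hm hrs
  have hspan : Ideal.ofList (List.ofFn x) = Ideal.span (Set.range x) := by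
    unfold Ideal.ofList; congr 1; ext; simp
  obtain ⟨N, hN⟩ : ∃ N, maximalIdeal B ^ N ≤ Ideal.span (Set.range x) := by
    rw [← hspan]
    refine exists_pow_le_of_quotient hI ?_
    intro _
    exact maximalIdeal_pow_eq_bot (h.injective_quotient _ hrs ha fun b hb => by
      rw [mul_comm]; exact hma b hb)
  have key : ∀ t, powIdeal x t Finset.univ = ⊤ ∨ (Module.Injective (B ⧸ powIdeal x t Finset.univ) (B ⧸ powIdeal x t Finset.univ) ∧ ∃ σ, σ ∉ powIdeal x t Finset.univ ∧ ∀ b ∈ maximalIdeal B, σ * b ∈ powIdeal x t Finset.univ) := by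
    intro t
    rw [or_iff_not_imp_left]
    intro ht
    obtain ⟨M, hM⟩ : ∃ M, maximalIdeal B ^ M ≤ powIdeal x t Finset.univ := by
      refine Ideal.exists_pow_le_of_le_radical_of_fg ?_ (IsNoetherian.noetherian _)
      have h1 : Ideal.span (Set.range x) ≤ (powIdeal x t Finset.univ).radical := by
        rw [Ideal.span_le]
        rintro _ ⟨i, rfl⟩
        exact ⟨t i, pow_mem_powIdeal x t (Finset.mem_univ i)⟩
      intro y hy
      obtain ⟨k, hk⟩ := h1 (hN (Ideal.pow_mem_pow hy N))
      exact ⟨N * k, by rwa [pow_mul]⟩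
    obtain ⟨σ, hσ, hσm⟩ := exists_socle ht hM
    refine ⟨?_, σ, hσ, hσm⟩
    have he : Ideal.ofList ((List.finRange d).map fun i => x i ^ t i) = powIdeal x t Finset.univ := by
      rw [Ideal.ofList_map_pow_eq_powIdeal]
      congr 1
      ext; simp
    have := hx.isWeaklyRegular t _ (List.nodup_finRange d)
    rw [← he] at hσ hσm ⊢
    exact h.injective_quotient _ this hσ hσm
  have hinj : ∀ t, FreeComplex.MatrixInjective (powIdeal x t Finset.univ) := by
    intro t
    rcases key t with ht | ⟨ht, -⟩
    · intro m n D a _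
      exact ⟨0, fun k => ht ▸ trivial⟩
    · exact .of_injective_quotient ht
  refine ⟨d, x, hm, ?_, hx, hinj, ?_, N, hN⟩
  · intro i
    rw [mem_nonZeroDivisors_iff_right]
    intro b hb
    have := hx 1 ∅ i (by simp) 1 b
    rw [powIdeal_empty, pow_one, mul_comm] at this
    exact this hb
  · intro t
    rcases key t with ht | ⟨ht, σ, hσ, hσm⟩
    · intro n N hN v hv
      exact absurd (hN v fun k => ht ▸ trivial) hv
    · exact FreeComplex.MatrixInjective.cogenerator (hinj t) hσ hσm

theorem InjDim.exists_annihilator_eq {A : Type u} [CommRing A] [IsNoetherianRing A] {n : ℕ}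
    (h : InjDim A A n) {P : Ideal A} [P.IsPrime] {a : A} (ha : a ≠ 0) (hP : ∀ y ∈ P, y * a = 0) :
    ∃ a' : A, ∀ y, y * a' = 0 ↔ y ∈ P := by
  obtain ⟨Q, hQ', hle⟩ := exists_le_isAssociatedPrime_of_isNoetherianRing A a ha
  obtain ⟨hQ, a', hQa⟩ := isAssociatedPrime_iff.1 hQ'
  have hPQ : P ≤ Q := fun y hy => hle (by
    simpa [Submodule.mem_colon_singleton] using hP y hy)
  have hQa' : ∀ y, y * a' = 0 ↔ y ∈ Q := fun y => by
    rw [hQa]; simp [Submodule.mem_colon_singleton]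
  suffices hQP : Q ≤ P by
    exact ⟨a', fun y => (hQa' y).trans ⟨fun h => hQP h, fun h => hPQ h⟩⟩
  let B := Localization.AtPrime Q
  have : IsNoetherianRing B := IsLocalization.isNoetherianRing Q.primeCompl _ inferInstance
  have hB : InjDim B B n := InjDim.of_isLocalization Q.primeCompl B h
  have hz : ∀ y : A, algebraMap A B y = 0 ↔ ∃ s ∉ Q, s * y = 0 := by
    intro y
    rw [IsLocalization.map_eq_zero_iff Q.primeCompl B y]
    exact ⟨fun ⟨s, hs⟩ => ⟨s, s.2, hs⟩, fun ⟨s, hs, h⟩ => ⟨⟨s, hs⟩, h⟩⟩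
  have hσ : algebraMap A B a' ≠ 0 := fun h0 => by
    obtain ⟨s, hs, h1⟩ := (hz _).1 h0
    exact hs ((hQa' s).1 h1)
  have hmap : maximalIdeal B = Q.map (algebraMap A B) :=
    (Localization.AtPrime.map_eq_maximalIdeal (I := Q)).symm
  have hinj : Module.Injective B B := InjDim.injective_of_socle hσ (by
    intro y hy
    rw [hmap] at hy
    obtain ⟨⟨⟨q, hq⟩, s⟩, hqs⟩ := (IsLocalization.mem_map_algebraMap_iff Q.primeCompl B).1 hy
    have h1 : y * algebraMap A B a' * algebraMap A B s = 0 := by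
      rw [mul_right_comm, hqs, ← map_mul, (hQa' q).2 hq, map_zero]
    exact (IsUnit.mul_left_eq_zero (IsLocalization.map_units B s)).1 h1) hB
  obtain ⟨N, hN⟩ := InjDim.maximalIdeal_pow_eq_bot hinj
  intro y hy
  have h1 : algebraMap A B (y ^ N) = 0 := by
    rw [map_pow, ← Ideal.mem_bot, ← hN, hmap]
    exact Ideal.pow_mem_pow (Ideal.mem_map_of_mem _ hy) N
  obtain ⟨s, hs, h2⟩ := (hz _).1 h1
  have h3 : s * y ^ N ∈ P := h2 ▸ P.zero_mem
  exact Ideal.IsPrime.mem_of_pow_mem inferInstance N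
    ((Ideal.IsPrime.mem_or_mem inferInstance h3).resolve_left fun h => hs (hPQ h))

theorem InjDim.locallyGood {A : Type u} {Ω : Type v} [CommRing A] [IsNoetherianRing A] [Field Ω]
    [Algebra A Ω] {n : ℕ} (h : InjDim A A n) {a : A}
    (ha : ∀ y, y * a = 0 ↔ algebraMap A Ω y = 0) : LocallyGood A Ω := by
  intro Q _ hQ B _ _ _ _ _ _
  have : IsNoetherianRing B := IsLocalization.isNoetherianRing Q.primeCompl _ inferInstance
  have hB : InjDim B B n := InjDim.of_isLocalization Q.primeCompl B h
  obtain ⟨d, x, h1, h2, h3, h4, h5, h6⟩ := hB.exists_parameters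
  refine ⟨d, x, h1, fun i hi => ?_, h3, h4, h5, h6⟩
  obtain ⟨⟨y, s⟩, hys⟩ := IsLocalization.surj Q.primeCompl (x i)
  have h7 : algebraMap A Ω y = 0 := by
    rw [IsScalarTower.algebraMap_apply A B Ω, ← hys, map_mul, hi, zero_mul]
  have h8 : x i * (algebraMap A B s * algebraMap A B a) = 0 := by
    rw [← mul_assoc, hys, ← map_mul, (ha y).2 h7, map_zero]
  have h9 : algebraMap A B (s * a) = 0 := by
    rw [map_mul]
    exact (mem_nonZeroDivisors_iff.1 (h2 i)).1 _ h8
  obtain ⟨s', hs'⟩ := (IsLocalization.map_eq_zero_iff Q.primeCompl B _).1 h9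
  have h10 : (s' * s : A) * a = 0 := by rw [mul_assoc, hs']
  exact (s' * s).2 (hQ ((ha _).1 h10))

/-- Modulo a suitable regular sequence in a prime `P`, the prime becomes an annihilator. -/
theorem InjDim.exists_quotient_annihilator {A : Type u} [CommRing A] [IsNoetherianRing A]
    [IsLocalRing A] {n : ℕ} (h : InjDim A A n) (P : Ideal A) [hP : P.IsPrime] :
    ∃ I ≤ P, InjDim (A ⧸ I) (A ⧸ I) n ∧
      ∃ a : A ⧸ I, ∀ y : A, Ideal.Quotient.mk I y * a = 0 ↔ y ∈ P := by
  obtain ⟨rs, hrm, hrs, a, ha, hma⟩ := exists_isWeaklyRegular_maximal P (le_maximalIdeal hP.ne_top)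
  have hIP : Ideal.ofList rs ≤ P := Ideal.span_le.2 hrm
  refine ⟨_, hIP, h.quotient_ofList rs hrs, ?_⟩
  let q := Ideal.Quotient.mk (Ideal.ofList rs)
  have : (P.map q).IsPrime := Ideal.map_isPrime_of_surjective Ideal.Quotient.mk_surjective
    (by rwa [Ideal.mk_ker])
  have hmem : ∀ y, q y ∈ P.map q ↔ y ∈ P := fun y => by
    rw [← Ideal.mem_comap, Ideal.comap_map_of_surjective q Ideal.Quotient.mk_surjective,
      ← RingHom.ker_eq_comap_bot, Ideal.mk_ker, sup_eq_left.2 hIP]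
  obtain ⟨a', ha'⟩ := (h.quotient_ofList rs hrs).exists_annihilator_eq (P := P.map q) (a := q a)
    (by rwa [Ne, Ideal.Quotient.eq_zero_iff_mem]) (by
      intro y hy
      obtain ⟨y, rfl⟩ := Ideal.Quotient.mk_surjective y
      rw [← map_mul, Ideal.Quotient.eq_zero_iff_mem]
      exact hma y ((hmem y).1 hy))
  exact ⟨a', fun y => (ha' _).trans (hmem y)⟩

section
variable {A : Type u} [CommRing A] (G : FreeComplex A)

theorem FreeComplex.exists_extend_of_injective {Y : Type u} [AddCommGroup Y] [Module A Y]
    (hY : Module.Injective A Y) (j : ℕ) (g : (Fin (G.r (j + 1)) → A) →ₗ[A] Y)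
    (hg : g ∘ₗ (G.D (j + 1)).mulVecLin = 0) :
    ∃ ψ : (Fin (G.r j) → A) →ₗ[A] Y, g = ψ ∘ₗ (G.D j).mulVecLin := by
  have hker : LinearMap.ker (G.D j).mulVecLin ≤ LinearMap.ker g := by
    intro z hz
    obtain ⟨w, rfl⟩ := G.ker_le j z (by simpa using hz)
    exact LinearMap.congr_fun hg w
  obtain ⟨e, he⟩ := Module.Injective.extension_property A Y
    ((Fin (G.r (j + 1)) → A) ⧸ LinearMap.ker (G.D j).mulVecLin) (Fin (G.r j) → A)
    ((LinearMap.ker (G.D j).mulVecLin).liftQ (G.D j).mulVecLin le_rfl) (by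
      rw [← LinearMap.ker_eq_bot]; exact Submodule.ker_liftQ_eq_bot _ _ _ le_rfl)
    ((LinearMap.ker (G.D j).mulVecLin).liftQ g hker)
  exact ⟨e, LinearMap.ext fun z => (LinearMap.congr_fun he (Submodule.Quotient.mk z)).symm⟩

theorem FreeComplex.exists_extend_of_injDim {n : ℕ} {Y : Type u} [AddCommGroup Y] [Module A Y]
    (hY : InjDim A Y n) (j : ℕ) (hj : n ≤ j) (g : (Fin (G.r (j + 1)) → A) →ₗ[A] Y)
    (hg : g ∘ₗ (G.D (j + 1)).mulVecLin = 0) :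
    ∃ ψ : (Fin (G.r j) → A) →ₗ[A] Y, g = ψ ∘ₗ (G.D j).mulVecLin := by
  induction n generalizing Y j with
  | zero => exact G.exists_extend_of_injective (InjDim.zero_iff.1 hY) j g hg
  | succ n ih =>
    obtain ⟨I, _, _, Z, _, _, f, q, hI, hf, hq, hfq, hZ⟩ := InjDim.exists_succ n hY
    obtain ⟨j, rfl⟩ := Nat.exists_eq_succ_of_ne_zero (show j ≠ 0 by omega)
    obtain ⟨β, hβ⟩ := G.exists_extend_of_injective hI (j+1) (f ∘ₗ g) (by
      rw [LinearMap.comp_assoc, hg, LinearMap.comp_zero])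
    obtain ⟨γ, hγ⟩ := ih hZ j (by omega) (q ∘ₗ β) (by
      rw [LinearMap.comp_assoc, ← hβ, ← LinearMap.comp_assoc, hfq.linearMap_comp_eq_zero,
        LinearMap.zero_comp])
    obtain ⟨γ', rfl⟩ := Module.projective_lifting_property q γ hq
    have hD : (G.D j).mulVecLin ∘ₗ (G.D (j+1)).mulVecLin = 0 := by
      rw [← Matrix.mulVecLin_mul, G.D_mul, Matrix.mulVecLin_zero]
    have hr : ∀ v, (β - γ' ∘ₗ (G.D j).mulVecLin) v ∈ LinearMap.range f := fun v =>
      (hfq _).1 (by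
        have := LinearMap.congr_fun hγ v
        simp only [LinearMap.comp_apply] at this
        simp [this])
    refine ⟨(LinearEquiv.ofInjective f hf).symm.toLinearMap ∘ₗ
      (β - γ' ∘ₗ (G.D j).mulVecLin).codRestrict _ hr, LinearMap.ext fun z => hf ?_⟩
    have h1 : ∀ y : LinearMap.range f, f ((LinearEquiv.ofInjective f hf).symm y) = y := fun y =>
      congrArg Subtype.val ((LinearEquiv.ofInjective f hf).apply_symm_apply y)
    have h2 := LinearMap.congr_fun hβ z
    have h3 := LinearMap.congr_fun hD z
    simp only [LinearMap.comp_apply, LinearMap.zero_apply] at h2 h3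
    simp only [LinearMap.comp_apply, LinearEquiv.coe_coe]
    rw [h1]
    simp only [LinearMap.codRestrict_apply, LinearMap.sub_apply, LinearMap.comp_apply, h3, map_zero,
      sub_zero]
    exact h2

end

open Matrix in
theorem InjDim.dualExactAbove {A : Type u} [CommRing A] {n : ℕ} (h : InjDim A A n) :
    DualExactAbove A n := by
  intro G j hj g hg
  let L : ∀ {m : ℕ}, (Fin m → A) → ((Fin m → A) →ₗ[A] A) := fun v => dotProductBilin A A v
  have hL : ∀ {m : ℕ} (v w : Fin m → A), L v w = v ⬝ᵥ w := fun v w => rfl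
  obtain ⟨ψ, hψ⟩ := G.exists_extend_of_injDim h j hj (L g) (LinearMap.ext fun z => by
    simp [hL, Matrix.dotProduct_mulVec, hg])
  refine ⟨fun i => ψ (Pi.single i 1), ?_⟩
  have hψ' : ψ = L fun i => ψ (Pi.single i 1) := by
    refine LinearMap.pi_ext' fun i => LinearMap.ext_ring ?_
    simp [hL]
  rw [hψ'] at hψ
  ext k
  have := LinearMap.congr_fun hψ (Pi.single k 1)
  simp only [hL, LinearMap.comp_apply, Matrix.mulVecLin_apply, Matrix.dotProduct_mulVec,
    dotProduct_single, mul_one] at this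
  exact this

open ModuleCat Abelian Limits RingTheory.Sequence in
theorem ModuleCat.subsingleton_ext_of_isWeaklyRegular {R : Type u} [CommRing R]
    (N : ModuleCat.{u} R) (M : ModuleCat.{u} R) (rs : List R)
    (hN : ∀ r ∈ rs, ∃ k : ℕ, r ^ k ∈ Module.annihilator R N) (reg : IsWeaklyRegular M rs) :
    ∀ i < rs.length, Subsingleton (Abelian.Ext N M i) := by
  induction rs generalizing M with
  | nil => simp
  | cons a rs ih =>
    intro i hi
    obtain ⟨k, hk⟩ := hN a List.mem_cons_self
    rw [isWeaklyRegular_cons_iff] at reg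
    rw [List.length_cons] at hi
    match i with
    | 0 =>
      have : Subsingleton (N →ₗ[R] M) := by
        refine subsingleton_of_forall_eq 0 fun f => LinearMap.ext fun n => ?_
        refine (reg.1.pow k) ?_
        simp only [LinearMap.zero_apply, smul_zero]
        rw [← map_smul, Module.mem_annihilator.1 hk, map_zero]
      exact (Ext.addEquiv₀.trans ModuleCat.homAddEquiv).subsingleton
    | i + 1 =>
      let g := (AddCommGrpCat.ofHom ((Ext.mk₀ (smulShortComplex M a).f).postcomp N
        (add_zero (i + 1))))
      have mono_g : Mono g := by
        apply (Ext.covariant_sequence_exact₁' N reg.1.smulShortComplex_shortExact i (i + 1)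
          rfl).mono_g ((AddCommGrpCat.isZero_of_iff_subsingleton.mpr ?_).eq_zero_of_src _)
        exact ih (ModuleCat.of R (QuotSMulTop a M))
          (fun r hr => hN r (List.mem_cons_of_mem _ hr))
          reg.2 i (by omega)
      let gk := AddCommGrpCat.ofHom ((Ext.mk₀ (M.smulShortComplex (a ^ k)).f).postcomp N
        (add_zero (i + 1)))
      have mono_gk : Mono gk := by
        simp only [smulShortComplex_f_eq_smul_id, g, gk] at mono_g ⊢
        exact (Ext.postcomp_smul_id_mono_iff (a ^ k) (i + 1)).mpr <|
          ((Ext.postcomp_smul_id_mono_iff a (i + 1)).mp mono_g).pow k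
      have zero_gk : gk = 0 := Ext.postcomp_smul_id_eq_zero_of_mem_annihilator hk (i + 1)
      exact AddCommGrpCat.subsingleton_of_isZero (IsZero.of_mono_eq_zero _ zero_gk)

open Limits in
theorem localCohomology.subsingleton_of_ext {R : Type u} [CommRing R] (J : Ideal R) (i : ℕ)
    (M : ModuleCat.{u} R)
    (h : ∀ t : ℕ, Subsingleton (((Ext R (ModuleCat.{u} R) i).obj
      (Opposite.op (ModuleCat.of R (R ⧸ J ^ t)))).obj M)) :
    Subsingleton ((localCohomology J i).obj M) := by
  rw [← ModuleCat.isZero_iff_subsingleton]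
  have e := (colimitObjIsoColimitCompEvaluation
    (localCohomology.diagram (localCohomology.idealPowersDiagram J) i) M)
  refine IsZero.of_iso ?_ e
  rw [IsZero.iff_id_eq_zero]
  refine colimit.hom_ext fun j => ?_
  refine IsZero.eq_of_src ?_ _ _
  exact (ModuleCat.isZero_iff_subsingleton).2 (h _)

theorem RingTheory.Sequence.isWeaklyRegular_ofFn {R M : Type*} [CommRing R] [AddCommGroup M]
    [Module R M] {h : ℕ} {y : Fin h → R}
    (hy : ∀ J : Finset (Fin h), ∀ l ∉ J, ∀ b : M, y l • b ∈ powIdeal y 1 J • (⊤ : Submodule R M) →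
      b ∈ powIdeal y 1 J • (⊤ : Submodule R M)) :
    RingTheory.Sequence.IsWeaklyRegular M (List.ofFn y) := by
  classical
  rw [List.ofFn_eq_map]
  suffices key : ∀ L : List (Fin h), L.Nodup → IsWeaklyRegular M (L.map y) from
    key _ (List.nodup_finRange h)
  intro L hL
  induction L using List.reverseRecOn with
  | nil => simp
  | append_singleton L l ih =>
    rw [List.nodup_append] at hL
    rw [List.map_append, List.map_singleton, isWeaklyRegular_append_iff, isWeaklyRegular_singleton_iff,
      isSMulRegular_quotient_iff_mem_of_smul_mem]
    have h3 : Ideal.ofList (L.map y) = powIdeal y 1 L.toFinset := by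
      have := Ideal.ofList_map_pow_eq_powIdeal y 1 L
      simpa using this
    refine ⟨ih hL.1, fun b hb => ?_⟩
    rw [h3] at hb ⊢
    exact hy _ l (fun hl => hL.2.2 l (by simpa using hl) l (by simp) rfl) b hb

theorem ColonTrivial.isWeaklyRegular_integralClosure {A R Ω : Type*} [CommRing A] [CommRing R]
    [Field Ω] [Algebra A R] [Algebra A Ω] [Algebra R Ω] [IsScalarTower A R Ω]
    (hsurj : Function.Surjective (algebraMap A R)) {h : ℕ} {x : Fin h → A}
    (hx : ∀ J, ∀ l ∉ J, ColonTrivial Ω x J l) :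
    RingTheory.Sequence.IsWeaklyRegular (integralClosure R Ω)
      (List.ofFn fun i => algebraMap A R (x i)) := by
  refine RingTheory.Sequence.isWeaklyRegular_ofFn fun J l hl b hb => ?_
  have hint : ∀ w : integralClosure R Ω, IsIntegral A (w : Ω) := fun w => by
    have : Algebra.IsIntegral A R := Algebra.isIntegral_of_surjective hsurj
    exact isIntegral_trans (R := A) (A := R) (w : Ω) w.2
  have hsmul : ∀ (a : A) (w : integralClosure R Ω), ((algebraMap A R a • w : integralClosure R Ω) : Ω)
      = a • (w : Ω) := fun a w => by
    rw [Subalgebra.coe_smul, algebraMap_smul]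
  obtain ⟨c, -, hc⟩ := mem_powIdeal_smul.1 hb
  let T : Set Ω := insert (b : Ω) (Set.range fun i => (c i : Ω))
  have hT : T.Finite := (Set.finite_range _).insert _
  have hTint : ∀ w ∈ T, IsIntegral A w := by
    rintro w (rfl | ⟨i, rfl⟩)
    · exact hint b
    · exact hint (c i)
  let S : Subalgebra A Ω := Algebra.adjoin A T
  have hTS : T ⊆ S := Algebra.subset_adjoin
  obtain ⟨S', -, hS', hcol⟩ := hx J l hl S (fg_adjoin_of_finite hT hTint)
  have hb' := hcol 1 1 (b : Ω) (hTS (Set.mem_insert _ _)) (by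
    refine mem_powIdeal_smul.2 ⟨fun i => (c i : Ω), fun i => hTS (Set.mem_insert_of_mem _ ⟨i, rfl⟩), ?_⟩
    have := congrArg (Subtype.val) hc
    rw [hsmul] at this
    rw [pow_one, this, AddSubmonoidClass.coe_finsetSum]
    refine Finset.sum_congr rfl fun i _ => ?_
    simp only [Pi.one_apply, pow_one, hsmul])
  obtain ⟨d, hd, hbd⟩ := mem_powIdeal_smul.1 hb'
  have hdint : ∀ i, IsIntegral R (d i) := fun i =>
    (IsIntegral.of_mem_of_fg S' hS' _ (hd i)).tower_top
  refine mem_powIdeal_smul.2 ⟨fun i => ⟨d i, hdint i⟩, fun i => trivial, Subtype.ext ?_⟩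
  rw [hbd, AddSubmonoidClass.coe_finsetSum]
  refine Finset.sum_congr rfl fun i _ => ?_
  simp only [Pi.one_apply, pow_one, hsmul]

theorem IsLocalRing.ringKrullDim_le_of_pow_le_span {A : Type*} [CommRing A] [IsNoetherianRing A]
    [IsLocalRing A] {h : ℕ} (x : Fin h → A) {N : ℕ}
    (hx : ∀ i, x i ∈ maximalIdeal A) (hN : maximalIdeal A ^ N ≤ Ideal.span (Set.range x)) :
    ringKrullDim A ≤ h := by
  have hmin : maximalIdeal A ∈ (Ideal.span (Set.range x)).minimalPrimes := by
    refine ⟨⟨inferInstance, Ideal.span_le.2 (by rintro _ ⟨i, rfl⟩; exact hx i)⟩, ?_⟩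
    rintro Q ⟨hQ, hle⟩ -
    exact hQ.le_of_pow_le (hN.trans hle)
  rw [← IsLocalRing.maximalIdeal_height_eq_ringKrullDim]
  have h1 := Ideal.height_le_spanRank_toENat_of_mem_minimalPrimes _ _ hmin
  rw [Submodule.spanRank_toENat_eq_iInf_finset_card] at h1
  classical
  have h2 := h1.trans (iInf_le _ (⟨Finset.univ.image x, by simp [Ideal.span]⟩ :
    {s : Finset A // Submodule.span A (s : Set A) = Ideal.span (Set.range x)}))
  have h3 : ((Finset.univ.image x).card : ℕ∞) ≤ h := by
    exact_mod_cast Finset.card_image_le.trans (by simp)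
  exact_mod_cast h2.trans h3

/-- Parameters of a Gorenstein ring mapping onto `R` form a regular sequence on the integral
closure of `R`. -/
theorem InjDim.exists_isWeaklyRegular_integralClosure {A : Type u} {R Ω : Type*} [CommRing A]
    [IsNoetherianRing A] [IsLocalRing A] [CommRing R] [IsLocalRing R] [Field Ω] [IsAlgClosed Ω]
    [Algebra A R] [Algebra A Ω] [Algebra R Ω] [IsScalarTower A R Ω] (p : ℕ) [Fact p.Prime]
    [CharP Ω p] (hsurj : Function.Surjective (algebraMap A R)) {n : ℕ} (hA : InjDim A A n) {a : A}
    (ha : ∀ y, y * a = 0 ↔ algebraMap A Ω y = 0) :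
    ∃ rs : List R, (∀ r ∈ rs, r ∈ maximalIdeal R) ∧
      RingTheory.Sequence.IsWeaklyRegular (integralClosure R Ω) rs ∧
      ringKrullDim R ≤ rs.length := by
  obtain ⟨h, x, hx, hcol⟩ := (hA.locallyGood ha).exists_colonTrivial p hA.dualExactAbove
  refine ⟨_, ?_, ColonTrivial.isWeaklyRegular_integralClosure hsurj hcol, ?_⟩
  · intro r hr
    obtain ⟨i, rfl⟩ := (List.mem_ofFn' _ _).1 hr
    have hmax := Ideal.comap_isMaximal_of_surjective (algebraMap A R) hsurj (K := maximalIdeal R)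
    exact (IsLocalRing.eq_maximalIdeal hmax).ge (hx.mem i)
  · obtain ⟨N, hN⟩ := hx.pow_le
    rw [List.length_ofFn]
    exact (ringKrullDim_le_of_surjective _ hsurj).trans
      (IsLocalRing.ringKrullDim_le_of_pow_le_span x hx.mem hN)

theorem localCohomology.subsingleton_of_isWeaklyRegular {R : Type u} [CommRing R] (J : Ideal R)
    (M : Type u) [AddCommGroup M] [Module R M] (rs : List R) (hrs : ∀ r ∈ rs, r ∈ J)
    (reg : RingTheory.Sequence.IsWeaklyRegular M rs) {i : ℕ} (hi : i < rs.length) :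
    Subsingleton ((localCohomology J i).obj (ModuleCat.of R M)) := by
  refine localCohomology.subsingleton_of_ext J i _ fun t =>
    ExtBridge.subsingleton_of_ext _ _ _ ?_
  refine ModuleCat.subsingleton_ext_of_isWeaklyRegular _ (ModuleCat.of R M) rs (fun r hr => ⟨t, ?_⟩)
    reg i hi
  rw [Ideal.annihilator_quotient]
  exact Ideal.pow_mem_pow (hrs r hr) t

theorem IsImageOfGorensteinLocalRing.subsingleton_localCohomology_integralClosure {R : Type u}
    [CommRing R] [IsDomain R] [IsLocalRing R] (hR : IsImageOfGorensteinLocalRing R) (Ω : Type u)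
    [Field Ω] [IsAlgClosed Ω] [Algebra R Ω] (hΩ : Function.Injective (algebraMap R Ω)) (p : ℕ)
    [Fact p.Prime] [CharP Ω p] {i : ℕ} (hi : (i : WithBot ℕ∞) < ringKrullDim R) :
    Subsingleton ((localCohomology (maximalIdeal R) i).obj
      (ModuleCat.of R (integralClosure R Ω))) := by
  obtain ⟨A, _, ⟨_, _, n, hn⟩, f, hf⟩ := hR
  have hA : InjDim A A n := ExtBridge.hasInjectiveDimensionLT _ n (hn (n + 1) n.lt_succ_self)
  have : (RingHom.ker f).IsPrime := RingHom.ker_isPrime f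
  obtain ⟨I, hI, hInj, a, ha⟩ := hA.exists_quotient_annihilator (RingHom.ker f)
  let g : A ⧸ I →+* R := Ideal.Quotient.lift I f fun y hy => hI hy
  have hg : Function.Surjective g := Ideal.Quotient.lift_surjective_of_surjective _ _ hf
  let : Algebra (A ⧸ I) R := g.toAlgebra
  let : Algebra (A ⧸ I) Ω := ((algebraMap R Ω).comp g).toAlgebra
  have : IsScalarTower (A ⧸ I) R Ω := IsScalarTower.of_algebraMap_eq fun _ => rfl
  have : Nontrivial (A ⧸ I) := g.domain_nontrivial
  have : IsLocalRing (A ⧸ I) :=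
    IsLocalRing.of_surjective' (Ideal.Quotient.mk I) Ideal.Quotient.mk_surjective
  obtain ⟨rs, hmem, hreg, hdim⟩ := hInj.exists_isWeaklyRegular_integralClosure (R := R) (Ω := Ω)
    p hg (a := a) (by
      intro y
      obtain ⟨y, rfl⟩ := Ideal.Quotient.mk_surjective y
      rw [ha, RingHom.mem_ker]
      change _ ↔ algebraMap R Ω (f y) = 0
      rw [map_eq_zero_iff _ hΩ])
  exact localCohomology.subsingleton_of_isWeaklyRegular _ _ rs hmem hreg
    (by exact_mod_cast hi.trans_le hdim)

/-!
STATEMENT 2: If `R` is a commutative Noetherian local domain containing a field of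
characteristic `p > 0` which is a surjective image of a Gorenstein local ring, and
`R⁺ = integralClosure R K̄` is the absolute integral closure of `R` (the integral
closure of `R` in a fixed algebraic closure `K̄` of its fraction field `K`), then
`H^i_𝔪(R⁺) = 0` for all `i < dim R`.
-/
theorem statement2
    (R : Type u) [CommRing R] [IsDomain R] [IsNoetherianRing R] [IsLocalRing R]
    -- `R` contains a field `F` of characteristic `p > 0`:
    (p : ℕ) (hp : p ≠ 0) (F : Type u) [Field F] [Algebra F R] [CharP F p]
    (hGor : IsImageOfGorensteinLocalRing R)
    (i : ℕ) (hi : (i : WithBot ℕ∞) < ringKrullDim R) :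
    Subsingleton ((localCohomology (maximalIdeal R) i).obj
      (ModuleCat.of R (integralClosure R (AlgebraicClosure (FractionRing R))))) := by
  have hprime : Fact p.Prime := ⟨(CharP.char_is_prime_or_zero F p).resolve_right hp⟩
  have hΩ : Function.Injective (algebraMap R (AlgebraicClosure (FractionRing R))) := by
    rw [IsScalarTower.algebraMap_eq R (FractionRing R) (AlgebraicClosure (FractionRing R)),
      RingHom.coe_comp]
    exact (RingHom.injective _).comp (IsFractionRing.injective R (FractionRing R))
  have : CharP (AlgebraicClosure (FractionRing R)) p := charP_of_injective_ringHom
    (f := (algebraMap R (AlgebraicClosure (FractionRing R))).comp (algebraMap F R))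
    (RingHom.injective _) p
  exact hGor.subsingleton_localCohomology_integralClosure _ hΩ p hi
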